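/- There exist absolute constants C, c > 0 such that the following holds. Let δ > 0 and let f, g, h : ℤ → ℂ be 1-bounded functions supported in [N]. Suppose that |∑_{x∈ℤ} ∑_{y∈ℕ} f(x) g(x+y) h(x+y²)| ≥ δ N^{3/2}. Then either N ≤ C δ^{-C}, or there exist a real number α and a positive integer q ≤ C δ^{-C} such that ‖qα‖ ≤ C δ^{-C}/N and |∑_{x∈ℤ} h(x) e(αx)| ≥ c δ^C N. -/

import Mathlib

namespace MAC
open Finset
open scoped BigOperators ComplexConjugate
set_option linter.unusedSectionVars false
set_option linter.unusedVariables false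
set_option linter.unusedSimpArgs false

section basics
variable {ι κ : Type*}

lemma cs_complex (s : Finset ι) (f g : ι → ℂ) :
    ‖𝔼 i ∈ s, f i * g i‖ ^ 2 ≤ (𝔼 i ∈ s, ‖f i‖ ^ 2) * (𝔼 i ∈ s, ‖g i‖ ^ 2) := by
  calc ‖𝔼 i ∈ s, f i * g i‖ ^ 2 ≤ (𝔼 i ∈ s, ‖f i‖ * ‖g i‖) ^ 2 := by
        gcongr
        refine (RCLike.norm_expect_le (K := ℂ)).trans (le_of_eq ?_)
        simp
    _ ≤ _ := expect_mul_sq_le_sq_mul_sq _ _ _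

lemma expect_le_one (s : Finset ι) (f : ι → ℝ) (h : ∀ i ∈ s, f i ≤ 1) : 𝔼 i ∈ s, f i ≤ 1 := by
  rcases s.eq_empty_or_nonempty with rfl | hs
  · simp
  · exact expect_le hs h

lemma norm_expect_le' (s : Finset ι) (f : ι → ℂ) : ‖𝔼 i ∈ s, f i‖ ≤ 𝔼 i ∈ s, ‖f i‖ :=
  RCLike.norm_expect_le (K := ℂ)

lemma norm_expect_le_one (s : Finset ι) (f : ι → ℂ) (h : ∀ i ∈ s, ‖f i‖ ≤ 1) :
    ‖𝔼 i ∈ s, f i‖ ≤ 1 :=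
  (norm_expect_le' s f).trans (expect_le_one _ _ h)

lemma cs_bdd (s : Finset ι) (f g : ι → ℂ) (hf : ∀ i ∈ s, ‖f i‖ ≤ 1) :
    ‖𝔼 i ∈ s, f i * g i‖ ^ 2 ≤ 𝔼 i ∈ s, ‖g i‖ ^ 2 := by
  refine (cs_complex s f g).trans ?_
  refine mul_le_of_le_one_left (expect_nonneg fun _ _ => by positivity) ?_
  exact expect_le_one _ _ fun i hi => pow_le_one₀ (norm_nonneg _) (hf i hi)

lemma jensen_sq (s : Finset ι) (f : ι → ℝ) : (𝔼 i ∈ s, f i) ^ 2 ≤ 𝔼 i ∈ s, f i ^ 2 := by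
  have := expect_mul_sq_le_sq_mul_sq s f (fun _ => 1)
  simp only [mul_one, one_pow] at this
  refine this.trans (mul_le_of_le_one_right (expect_nonneg fun _ _ => by positivity) ?_)
  exact expect_le_one _ _ fun _ _ => le_rfl

lemma jensen_pow (s : Finset ι) (f : ι → ℝ) (hf : ∀ i ∈ s, 0 ≤ f i) (k : ℕ) :
    (𝔼 i ∈ s, f i) ^ (2 ^ k) ≤ 𝔼 i ∈ s, f i ^ (2 ^ k) := by
  induction k with
  | zero => simp
  | succ k ih =>
    rw [pow_succ, pow_mul]
    calc _ ≤ (𝔼 i ∈ s, f i ^ (2 ^ k)) ^ 2 := by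
          gcongr
          exact pow_nonneg (expect_nonneg hf) _
      _ ≤ _ := by
          refine (jensen_sq _ _).trans (le_of_eq ?_)
          refine expect_congr rfl fun i _ => ?_
          rw [pow_mul]

lemma norm_sq_expect (s : Finset ι) (f : ι → ℂ) :
    ((‖𝔼 i ∈ s, f i‖ ^ 2 : ℝ) : ℂ) = 𝔼 i ∈ s, 𝔼 j ∈ s, f i * conj (f j) := by
  have : ((‖𝔼 i ∈ s, f i‖ ^ 2 : ℝ) : ℂ) = (𝔼 i ∈ s, f i) * conj (𝔼 i ∈ s, f i) := by
    rw [Complex.mul_conj, Complex.normSq_eq_norm_sq]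
  rw [this, expect_mul]
  refine expect_congr rfl fun i _ => ?_
  rw [← mul_expect]
  congr 1
  simp [expect_eq_sum_div_card]

/-- regroup differences -/
lemma regroup {V : Type*} [AddCommGroup V] (B D : Finset V)
    (hD : ∀ u ∈ B, ∀ v ∈ B, v - u ∈ D) (Ψ : V → V → ℂ)
    (hΨ : ∀ v' v, v' ∉ B → Ψ v' v = 0) :
    𝔼 v' ∈ B, 𝔼 v ∈ B, Ψ v' v
      = ((#D : ℂ) / #B) * 𝔼 d ∈ D, 𝔼 v ∈ B, Ψ (v + d) v := by
  classical
  rcases B.eq_empty_or_nonempty with rfl | hB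
  · simp
  have hDne : D.Nonempty := by
    obtain ⟨v, hv⟩ := hB
    exact ⟨_, hD v hv v hv⟩
  have hB0 : (#B : ℂ) ≠ 0 := by exact_mod_cast (card_pos.2 hB).ne'
  have hD0 : (#D : ℂ) ≠ 0 := by exact_mod_cast (card_pos.2 hDne).ne'
  rw [expect_comm, expect_comm D B]
  rw [mul_expect]
  refine expect_congr rfl fun v hv => ?_
  rw [expect_eq_sum_div_card, expect_eq_sum_div_card]
  have : ∑ d ∈ D, Ψ (v + d) v = ∑ v' ∈ B, Ψ v' v := by
    symm
    have h1 : ∑ v' ∈ B, Ψ v' v = ∑ d ∈ B.image (fun b => b - v), Ψ (v + d) v := by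
      rw [sum_image (by intro a _ b _ h; simpa using h)]
      simp
    rw [h1]
    refine sum_subset ?_ ?_
    · intro d hd
      simp only [mem_image] at hd
      obtain ⟨b, hb, rfl⟩ := hd
      exact hD v hv b hb
    · intro d _ hd
      apply hΨ
      intro h
      apply hd
      simp only [mem_image]
      exact ⟨_, h, by abel⟩
  rw [this]
  field_simp

end basics

section group
variable {G : Type*} [AddCommGroup G] [Fintype G]

lemma shift {M : Type*} [AddCommMonoid M] [Module ℚ≥0 M] (F : G → M) (a : G) :
    𝔼 x, F (x + a) = 𝔼 x, F x :=
  Fintype.expect_equiv (Equiv.addRight a) _ _ (fun _ => rfl)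

/-- multiplicative differencing -/
def dd (a : G) (K : G → ℂ) : G → ℂ := fun x => K (x + a) * conj (K x)

lemma dd_comm (a b : G) (K : G → ℂ) : dd a (dd b K) = dd b (dd a K) := by
  funext x; simp only [dd, map_mul, Complex.conj_conj]
  rw [add_right_comm]; ring

lemma dd_bdd {a : G} {K : G → ℂ} (hK : ∀ x, ‖K x‖ ≤ 1) : ∀ x, ‖dd a K x‖ ≤ 1 := by
  intro x; simp only [dd, norm_mul, RCLike.norm_conj]
  exact mul_le_one₀ (hK _) (norm_nonneg _) (hK _)

lemma norm_sq_mean (K : G → ℂ) : ((‖𝔼 x, K x‖ ^ 2 : ℝ) : ℂ) = 𝔼 k, 𝔼 x, dd k K x := by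
  rw [norm_sq_expect, expect_comm]
  conv_rhs => rw [expect_comm]
  refine expect_congr rfl fun x _ => ?_
  rw [← shift _ x]
  refine expect_congr rfl fun y _ => ?_
  simp [dd, add_comm x y]

noncomputable def Q {V : Type*} (D : Finset V) : List (V → G) → (G → ℂ) → ℝ
  | [], K => ‖𝔼 x, K x‖
  | l :: ls, K => 𝔼 d ∈ D, Q D ls (dd (l d) K)

lemma Q_nonneg {V : Type*} (D : Finset V) (l : List (V → G)) (K : G → ℂ) : 0 ≤ Q D l K := by
  induction l generalizing K with
  | nil => exact norm_nonneg _
  | cons a l ih => exact expect_nonneg fun d _ => ih _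

lemma Q_le_one {V : Type*} (D : Finset V) (l : List (V → G)) (K : G → ℂ)
    (hK : ∀ x, ‖K x‖ ≤ 1) : Q D l K ≤ 1 := by
  induction l generalizing K with
  | nil => exact norm_expect_le_one _ _ fun x _ => hK x
  | cons a l ih => exact expect_le_one _ _ fun d _ => ih _ (dd_bdd hK)

lemma list_prod_bdd {V : Type*} [AddCommGroup V] (l : List ((G → ℂ) × (V →+ G)))
    (hl : ∀ p ∈ l, ∀ x, ‖p.1 x‖ ≤ 1) (x : G) (v : V) :
    ‖(l.map fun p => p.1 (x + p.2 v)).prod‖ ≤ 1 := by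
  induction l with
  | nil => simp
  | cons p l ih =>
    simp only [List.map_cons, List.prod_cons, norm_mul]
    exact mul_le_one₀ (hl p (by simp) _) (norm_nonneg _)
      (ih fun p hp => hl p (by simp [hp]))

set_option maxHeartbeats 1000000 in
theorem elim {V : Type*} [AddCommGroup V] (B D : Finset V) (hB : B.Nonempty)
    (hD : ∀ u ∈ B, ∀ v ∈ B, v - u ∈ D) (κ : ℝ) (hκ1 : 1 ≤ κ) (hκ : (#D : ℝ) ≤ κ * #B)
    (Lt : V →+ G) (l : List ((G → ℂ) × (V →+ G))) (hl : ∀ p ∈ l, ∀ x, ‖p.1 x‖ ≤ 1)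
    (w : V → ℂ) (hw : ∀ v, ‖w v‖ ≤ 1) (hwB : ∀ v, v ∉ B → w v = 0) (K : G → ℂ) :
    ‖𝔼 x, 𝔼 v ∈ B, w v * (l.map fun p => p.1 (x + p.2 v)).prod * K (x + Lt v)‖ ^ (2 ^ l.length)
      ≤ κ ^ (2 ^ l.length) * Q D (l.map fun p v => Lt v - p.2 v) K := by
  generalize hn : l.length = n
  induction n generalizing l w K with
  | zero =>
    obtain rfl := List.length_eq_zero_iff.1 hn
    simp only [List.map_nil, List.prod_nil, mul_one, pow_zero, pow_one, Q]
    have : 𝔼 x, 𝔼 v ∈ B, w v * K (x + Lt v) = (𝔼 v ∈ B, w v) * 𝔼 x, K x := by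
      rw [expect_comm, expect_mul]
      refine expect_congr rfl fun v _ => ?_
      rw [← mul_expect, shift]
    rw [this, norm_mul]
    gcongr
    exact (norm_expect_le_one _ _ fun v _ => hw v).trans hκ1
  | succ n ih =>
    obtain ⟨p, l, rfl⟩ : ∃ p l', l = p :: l' := by
      cases l with
      | nil => simp at hn
      | cons p l => exact ⟨p, l, rfl⟩
    have hln : l.length = n := by simpa using hn
    set R : G → V → ℂ := fun x v => (l.map fun p => p.1 (x + p.2 v)).prod with hR
    set N := ‖𝔼 x, 𝔼 v ∈ B, w v * ((p :: l).map fun p => p.1 (x + p.2 v)).prod * K (x + Lt v)‖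
      with hN
    have hp := hl p (by simp)
    have hl' : ∀ p ∈ l, ∀ x, ‖p.1 x‖ ≤ 1 := fun p hp => hl p (by simp [hp])
    -- shifted
    have e1 : 𝔼 x, 𝔼 v ∈ B, w v * ((p :: l).map fun p => p.1 (x + p.2 v)).prod * K (x + Lt v)
        = 𝔼 x, p.1 x * 𝔼 v ∈ B, w v * R (x - p.2 v) v * K (x - p.2 v + Lt v) := by
      simp_rw [mul_expect]
      rw [expect_comm, expect_comm univ B]
      refine expect_congr rfl fun v _ => ?_
      rw [← shift _ (-p.2 v)]
      refine expect_congr rfl fun x _ => ?_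
      simp only [List.map_cons, List.prod_cons, hR]
      rw [← sub_eq_add_neg, sub_add_cancel]
      ring
    set wd : V → V → ℂ := fun d v => w (v + d) * conj (w v) with hwd
    set ld : V → List ((G → ℂ) × (V →+ G)) := fun d =>
      l.map fun q => (dd (q.2 d - p.2 d) q.1, q.2) with hld
    set Nd : V → ℝ := fun d => ‖𝔼 x, 𝔼 v ∈ B, wd d v * ((ld d).map fun p => p.1 (x + p.2 v)).prod
      * dd (Lt d - p.2 d) K (x + Lt v)‖ with hNd
    have e2 : N ^ 2 ≤ κ * 𝔼 d ∈ D, Nd d := by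
      have s1 : N ^ 2 ≤ 𝔼 x, ‖𝔼 v ∈ B, w v * R (x - p.2 v) v * K (x - p.2 v + Lt v)‖ ^ 2 := by
        rw [hN, e1]; exact cs_bdd _ _ _ fun x _ => hp x
      have s2 : ((𝔼 x, ‖𝔼 v ∈ B, w v * R (x - p.2 v) v * K (x - p.2 v + Lt v)‖ ^ 2 : ℝ) : ℂ)
          = (#D : ℂ) / #B * 𝔼 d ∈ D, 𝔼 x, 𝔼 v ∈ B, wd d v *
            ((ld d).map fun p => p.1 (x + p.2 v)).prod * dd (Lt d - p.2 d) K (x + Lt v) := by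
        rw [Complex.ofReal_expect]
        simp_rw [norm_sq_expect]
        have : ∀ x : G, 𝔼 v' ∈ B, 𝔼 v ∈ B, (w v' * R (x - p.2 v') v' * K (x - p.2 v' + Lt v')) *
            conj (w v * R (x - p.2 v) v * K (x - p.2 v + Lt v)) = 
            (#D : ℂ) / #B * 𝔼 d ∈ D, 𝔼 v ∈ B,
            (w (v + d) * R (x - p.2 (v + d)) (v + d) * K (x - p.2 (v + d) + Lt (v + d))) *
            conj (w v * R (x - p.2 v) v * K (x - p.2 v + Lt v)) := fun x => 
          regroup B D hD (fun v' v => (w v' * R (x - p.2 v') v' * K (x - p.2 v' + Lt v')) *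
            conj (w v * R (x - p.2 v) v * K (x - p.2 v + Lt v)))
            (fun v' v hv' => by simp [hwB v' hv'])
        simp_rw [this]
        rw [← mul_expect]
        congr 1
        rw [expect_comm]
        refine expect_congr rfl fun d _ => ?_
        rw [expect_comm, expect_comm univ B]
        refine expect_congr rfl fun v _ => ?_
        rw [← shift _ (p.2 v)]
        refine expect_congr rfl fun x _ => ?_
        have h1 : R (x + p.2 v - p.2 (v + d)) (v + d) * conj (R (x + p.2 v - p.2 v) v)
            = ((ld d).map fun p => p.1 (x + p.2 v)).prod := by
          simp only [hR, hld, List.map_map]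
          rw [map_list_prod, List.map_map, ← List.prod_map_mul]
          congr 1
          refine List.map_congr_left fun q _ => ?_
          simp only [Function.comp, dd, map_add]
          congr 2
          · abel_nf
          · congr 1; abel
        rw [← h1]
        have h2 : dd (Lt d - p.2 d) K (x + Lt v) = K (x + p.2 v - p.2 (v + d) + Lt (v + d)) *
            conj (K (x + p.2 v - p.2 v + Lt v)) := by
          simp only [dd, map_add]
          congr 2
          · abel_nf
          · congr 1; abel
        rw [h2]
        simp only [hwd, map_mul]
        ring
      have s3 : (𝔼 x, ‖𝔼 v ∈ B, w v * R (x - p.2 v) v * K (x - p.2 v + Lt v)‖ ^ 2 : ℝ)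
          ≤ (#D : ℝ) / #B * 𝔼 d ∈ D, Nd d := by
        rw [← Complex.norm_of_nonneg (expect_nonneg fun x _ => by positivity), s2, norm_mul]
        simp only [norm_div, Complex.norm_natCast]
        gcongr
        exact norm_expect_le' _ _
      refine s1.trans (s3.trans ?_)
      refine mul_le_mul_of_nonneg_right ?_ (expect_nonneg fun _ _ => norm_nonneg _)
      · rw [div_le_iff₀ (by exact_mod_cast card_pos.2 hB)]; exact hκ
    have e3 : ∀ d, Nd d ^ (2 ^ n) ≤ κ ^ (2 ^ n) *
        Q D (l.map fun p v => Lt v - p.2 v) (dd (Lt d - p.2 d) K) := by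
      intro d
      have := ih (ld d) (by
        intro q hq
        simp only [hld, List.mem_map] at hq
        obtain ⟨q', hq', rfl⟩ := hq
        exact dd_bdd (hl' q' hq')) (wd d) (by
          intro v
          simp only [hwd, norm_mul, RCLike.norm_conj]
          exact mul_le_one₀ (hw _) (norm_nonneg _) (hw _)) (by
          intro v hv
          simp [hwd, hwB v hv]) (dd (Lt d - p.2 d) K) (by simp [hld, hln])
      have hm : (ld d).map (fun p v => Lt v - p.2 v) = l.map (fun p v => Lt v - p.2 v) := by
        simp only [hld, List.map_map]
        rfl
      rw [hm] at this
      exact this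
    have hpow : (2 : ℕ) ^ (n + 1) = 2 * 2 ^ n := by
      simp [pow_succ, mul_comm]
    rw [hpow, pow_mul]
    have hN2 : 0 ≤ N ^ 2 := by positivity
    calc (N ^ 2) ^ (2 ^ n) ≤ (κ * 𝔼 d ∈ D, Nd d) ^ (2 ^ n) := by gcongr
      _ = κ ^ (2 ^ n) * (𝔼 d ∈ D, Nd d) ^ (2 ^ n) := mul_pow _ _ _
      _ ≤ κ ^ (2 ^ n) * 𝔼 d ∈ D, (Nd d) ^ (2 ^ n) := by
          gcongr
          exact jensen_pow _ _ (fun _ _ => norm_nonneg _) _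
      _ ≤ κ ^ (2 ^ n) * 𝔼 d ∈ D, (κ ^ (2 ^ n) *
            Q D (l.map fun p v => Lt v - p.2 v) (dd (Lt d - p.2 d) K)) := by
          gcongr with d _
          exact e3 d
      _ = κ ^ (2 * 2 ^ n) * Q D ((p :: l).map fun p v => Lt v - p.2 v) K := by
          rw [← mul_expect, two_mul, pow_add, mul_assoc]
          rfl

end group
end MAC

namespace MAC
open Finset
open scoped BigOperators ComplexConjugate
set_option linter.unusedSectionVars false
set_option linter.unusedVariables false
set_option linter.unusedSimpArgs false

section box

lemma expect_cons {X M : Type*} [Fintype X] [AddCommMonoid M] [Module ℚ≥0 M] {t : ℕ}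
    (F : (Fin (t + 1) → X) → M) :
    𝔼 n, F n = 𝔼 a : X, 𝔼 m : Fin t → X, F (Fin.cons a m) := by
  rw [← expect_product' univ univ (fun (a : X) (m : Fin t → X) => F (Fin.cons a m))]
  rw [univ_product_univ]
  exact (Fintype.expect_equiv (Fin.consEquiv (fun _ => X)) _ _ (fun _ => rfl)).symm

noncomputable def box {X : Type} : (t : ℕ) → ((Fin t → X) → ℂ) → (Fin t → X) → (Fin t → X) → ℂ
  | 0, F, n, _ => F n
  | t + 1, F, n, n' => box t (fun m => F (Fin.cons (n 0) m) * conj (F (Fin.cons (n' 0) m)))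
      (Fin.tail n) (Fin.tail n')

lemma box_mul {X : Type} (t : ℕ) (F H : (Fin t → X) → ℂ) (n n' : Fin t → X) :
    box t (fun m => F m * H m) n n' = box t F n n' * box t H n n' := by
  induction t with
  | zero => rfl
  | succ t ih =>
    simp only [box]
    rw [← ih]
    congr 1
    funext m
    simp only [map_mul]
    ring

lemma box_bdd {X : Type} (t : ℕ) (F : (Fin t → X) → ℂ) (hF : ∀ n, ‖F n‖ ≤ 1)
    (n n' : Fin t → X) : ‖box t F n n'‖ ≤ 1 := by
  induction t with
  | zero => exact hF _
  | succ t ih =>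
    refine ih _ (fun m => ?_) _ _
    rw [norm_mul, RCLike.norm_conj]
    exact mul_le_one₀ (hF _) (norm_nonneg _) (hF _)

theorem boxCS {X : Type} [Fintype X] [Nonempty X] (t : ℕ) : ∀ {Y : Type} [Fintype Y]
    (F : Y → (Fin t → X) → ℂ) (b : Fin t → Y → (Fin t → X) → ℂ)
    (hb : ∀ i y n, ‖b i y n‖ ≤ 1) (hbi : ∀ i y n v, b i y (Function.update n i v) = b i y n),
    ‖𝔼 y, 𝔼 n, F y n * ∏ i, b i y n‖ ^ (2 ^ t) ≤ ‖𝔼 n, 𝔼 n', 𝔼 y, box t (F y) n n'‖ := by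
  induction t with
  | zero =>
    intro Y _ F b hb hbi
    simp only [pow_zero, pow_one, univ_eq_empty, prod_empty, mul_one, box]
    rw [expect_comm]
    simp [expect_const]
  | succ t ih =>
    intro Y _ F b hb hbi
    obtain ⟨a0⟩ := ‹Nonempty X›
    have e1 : 𝔼 y, 𝔼 n, F y n * ∏ i, b i y n = 𝔼 p : Y × (Fin t → X),
        b 0 p.1 (Fin.cons a0 p.2) *
          𝔼 a, F p.1 (Fin.cons a p.2) * ∏ i : Fin t, b i.succ p.1 (Fin.cons a p.2) := by
      rw [← univ_product_univ, expect_product]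
      refine expect_congr rfl fun y _ => ?_
      rw [expect_cons, expect_comm]
      refine expect_congr rfl fun m _ => ?_
      rw [mul_expect]
      refine expect_congr rfl fun a _ => ?_
      rw [Fin.prod_univ_succ]
      have : b 0 y (Fin.cons a m) = b 0 y (Fin.cons a0 m) := by
        rw [← hbi 0 y (Fin.cons a0 m) a, Fin.update_cons_zero]
      rw [this]; ring
    set F' : (X × X) × Y → (Fin t → X) → ℂ := fun q m =>
      F q.2 (Fin.cons q.1.1 m) * conj (F q.2 (Fin.cons q.1.2 m)) with hF'
    set b' : Fin t → (X × X) × Y → (Fin t → X) → ℂ := fun i q m =>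
      b i.succ q.2 (Fin.cons q.1.1 m) * conj (b i.succ q.2 (Fin.cons q.1.2 m)) with hb'
    have e2 : ((𝔼 p : Y × (Fin t → X), ‖𝔼 a, F p.1 (Fin.cons a p.2) *
        ∏ i : Fin t, b i.succ p.1 (Fin.cons a p.2)‖ ^ 2 : ℝ) : ℂ)
        = 𝔼 q, 𝔼 m, F' q m * ∏ i, b' i q m := by
      rw [Complex.ofReal_expect]
      simp_rw [norm_sq_expect]
      rw [← univ_product_univ, expect_product, ← univ_product_univ, expect_product]
      rw [expect_comm univ univ (fun (i : X × X) (j : Y) => _)]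
      refine expect_congr rfl fun y _ => ?_
      rw [expect_comm univ univ (fun (i : X × X) (j : Fin t → X) => _)]
      refine expect_congr rfl fun m _ => ?_
      rw [← univ_product_univ, expect_product]
      refine expect_congr rfl fun a _ => ?_
      refine expect_congr rfl fun a' _ => ?_
      simp only [hF', hb', map_mul, map_prod, prod_mul_distrib]
      ring
    have e3 : ‖𝔼 y, 𝔼 n, F y n * ∏ i, b i y n‖ ^ 2 ≤ ‖𝔼 q, 𝔼 m, F' q m * ∏ i, b' i q m‖ := by
      rw [← e2, Complex.norm_of_nonneg (expect_nonneg fun x _ => by positivity), e1]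
      exact cs_bdd _ _ _ fun p _ => hb _ _ _
    have e4 := ih F' b' (by
      intro i q m
      simp only [hb', norm_mul, RCLike.norm_conj]
      exact mul_le_one₀ (hb _ _ _) (norm_nonneg _) (hb _ _ _)) (by
      intro i q m v
      simp only [hb']
      rw [Fin.cons_update, Fin.cons_update, hbi, hbi])
    rw [pow_succ', pow_mul]
    calc _ ≤ ‖𝔼 q, 𝔼 m, F' q m * ∏ i, b' i q m‖ ^ (2 ^ t) := by gcongr
      _ ≤ _ := e4
      _ = _ := by
        congr 1
        rw [expect_cons]
        rw [expect_comm univ univ (fun (a : X) (m : Fin t → X) => _)]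
        refine expect_congr rfl fun m _ => ?_
        have : ∀ a : X, 𝔼 n', 𝔼 y, box (t + 1) (F y) (Fin.cons a m) n' =
          𝔼 m', 𝔼 a', 𝔼 y, box (t + 1) (F y) (Fin.cons a m) (Fin.cons a' m') := by
          intro a
          rw [expect_cons, expect_comm]
        simp_rw [this]
        rw [expect_comm univ univ (fun (a : X) (m : Fin t → X) => _)]
        refine expect_congr rfl fun m' _ => ?_
        rw [← univ_product_univ, expect_product, ← univ_product_univ, expect_product]
        rfl

end box

section group
variable {G : Type} [AddCommGroup G] [Fintype G]

noncomputable def VV : ℕ → (G → ℂ) → ℝ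
  | 0, K => ‖𝔼 x, K x‖ ^ 2
  | s + 1, K => 𝔼 n, VV s (dd n K)

lemma VV_nonneg (s : ℕ) (K : G → ℂ) : 0 ≤ VV s K := by
  induction s generalizing K with
  | zero => exact sq_nonneg _
  | succ s ih => exact expect_nonneg fun _ _ => ih _

noncomputable def ds : (t : ℕ) → (Fin t → G) → (G → ℂ) → G → ℂ
  | 0, _, K => K
  | t + 1, n, K => ds t (Fin.tail n) (dd (n 0) K)

lemma ds_dd (t : ℕ) (n : Fin t → G) (a : G) (K : G → ℂ) :
    ds t n (dd a K) = dd a (ds t n K) := by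
  induction t generalizing K with
  | zero => rfl
  | succ t ih => simp only [ds]; rw [dd_comm, ih]

lemma ds_bdd (t : ℕ) (n : Fin t → G) (K : G → ℂ) (hK : ∀ x, ‖K x‖ ≤ 1) :
    ∀ x, ‖ds t n K x‖ ≤ 1 := by
  induction t generalizing K with
  | zero => exact hK
  | succ t ih => exact ih _ _ (dd_bdd hK)

lemma VV_ds (t s : ℕ) (K : G → ℂ) : VV (s + t) K = 𝔼 n : Fin t → G, VV s (ds t n K) := by
  induction t generalizing K with
  | zero => simp [ds]
  | succ t ih =>
    rw [expect_cons, ← add_assoc]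
    simp only [VV]
    refine expect_congr rfl fun a _ => ?_
    rw [ih]
    simp [ds]

/-- factor off the top vertex -/
lemma ds_top (t : ℕ) (K : G → ℂ) (hK : ∀ x, ‖K x‖ ≤ 1) :
    ∃ b : Fin t → G → (Fin t → G) → ℂ, (∀ i x n, ‖b i x n‖ ≤ 1) ∧
      (∀ i x n v, b i x (Function.update n i v) = b i x n) ∧
      ∀ x n, ds t n K x = K (x + ∑ i, n i) * ∏ i, b i x n := by
  induction t with
  | zero => exact ⟨fun i => i.elim0, fun i => i.elim0, fun i => i.elim0, by simp [ds]⟩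
  | succ t ih =>
    obtain ⟨b, hb, hbi, hbe⟩ := ih
    refine ⟨fun i x n => Fin.cases (conj (ds t (Fin.tail n) K x))
      (fun j => b j (x + n 0) (Fin.tail n)) i, ?_, ?_, ?_⟩
    · intro i x n
      refine Fin.cases ?_ (fun j => ?_) i
      · simp only [Fin.cases_zero, RCLike.norm_conj]; exact ds_bdd _ _ _ hK _
      · simp only [Fin.cases_succ]; exact hb _ _ _
    · intro i x n v
      refine Fin.cases ?_ (fun j => ?_) i
      · simp only [Fin.cases_zero, Fin.tail_update_zero]
      · simp only [Fin.cases_succ, Fin.tail_update_succ, hbi]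
        rw [Function.update_of_ne (Fin.succ_ne_zero j).symm]
    · intro x n
      simp only [ds]
      rw [ds_dd, Fin.prod_univ_succ, Fin.sum_univ_succ]
      simp only [dd, Fin.cases_zero, Fin.cases_succ, hbe (x + n 0)]
      rw [add_assoc]
      simp only [Fin.tail]
      ring

lemma box_sum (t : ℕ) (K : G → ℂ) (x : G) (n n' : Fin t → G) :
    box t (fun m => K (x + ∑ i, m i)) n n' = ds t (n - n') K (x + ∑ i, n' i) := by
  induction t generalizing K x with
  | zero => simp [box, ds]
  | succ t ih =>
    simp only [box, ds, Fin.sum_univ_succ, Fin.cons_zero, Fin.cons_succ]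
    have : (fun m : Fin t → G => K (x + (n 0 + ∑ i, m i)) * conj (K (x + (n' 0 + ∑ i, m i)))) =
        fun m => dd ((n - n') 0) K (x + n' 0 + ∑ i, m i) := by
      funext m
      simp only [dd, Pi.sub_apply]
      congr 2
      · abel
      · rw [add_assoc]
    rw [this, ih, add_assoc]
    rfl

/-- Gowers-type inequality -/
theorem gowersCS {Y : Type} [Fintype Y] (t : ℕ) (K : Y → G → ℂ) (hK : ∀ y x, ‖K y x‖ ≤ 1)
    (b : Fin t → Y → G → (Fin t → G) → ℂ)
    (hb : ∀ i y x n, ‖b i y x n‖ ≤ 1)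
    (hbi : ∀ i y x n v, b i y x (Function.update n i v) = b i y x n) :
    ‖𝔼 y, 𝔼 x, 𝔼 n, ds t n (K y) x * ∏ i, b i y x n‖ ^ (2 ^ t)
      ≤ ‖𝔼 n, 𝔼 y, 𝔼 x, ds t n (K y) x‖ := by
  choose c hc hci hce using fun y => ds_top t (K y) (hK y)
  have := boxCS (X := G) (Y := Y × G) t (fun p n => K p.1 (p.2 + ∑ i, n i))
    (fun i p n => c p.1 i p.2 n * b i p.1 p.2 n) (by
      intro i p n
      rw [norm_mul]
      exact mul_le_one₀ (hc _ _ _ _) (norm_nonneg _) (hb _ _ _ _)) (by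
      intro i p n v
      rw [hci, hbi])
  refine le_trans (le_of_eq ?_) (this.trans (le_of_eq ?_))
  · congr 2
    rw [← univ_product_univ, expect_product]
    refine expect_congr rfl fun y _ => expect_congr rfl fun x _ => expect_congr rfl fun n _ => ?_
    rw [hce, prod_mul_distrib, mul_assoc]
  · congr 1
    rw [expect_comm]
    rw [← expect_const (s := (univ : Finset (Fin t → G))) univ_nonempty
      (𝔼 n : Fin t → G, 𝔼 y, 𝔼 x, ds t n (K y) x)]
    refine expect_congr rfl fun n' _ => ?_
    rw [← shift _ n']
    refine expect_congr rfl fun n _ => ?_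
    rw [← univ_product_univ, expect_product]
    refine expect_congr rfl fun y _ => ?_
    simp only [box_sum, add_sub_cancel_right]
    rw [shift]

end group
end MAC

namespace MAC
open Finset
open scoped BigOperators ComplexConjugate
set_option linter.unusedSectionVars false
set_option linter.unusedVariables false
set_option linter.unusedSimpArgs false

section fourier
variable {P : ℕ} [NeZero P]

/-- standard character -/
noncomputable def ee (x : ZMod P) : ℂ := ZMod.stdAddChar x

lemma ee_add (x y : ZMod P) : ee (x + y) = ee x * ee y := AddChar.map_add_eq_mul _ _ _
lemma ee_zero : ee (0 : ZMod P) = 1 := AddChar.map_zero_eq_one _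
lemma ee_norm (x : ZMod P) : ‖ee x‖ = 1 := by
  exact Circle.norm_coe _
lemma ee_neg (x : ZMod P) : ee (-x) = conj (ee x) := by
  have h : ee x * ee (-x) = 1 := by rw [← ee_add, add_neg_cancel, ee_zero]
  have h2 : ee x * conj (ee x) = 1 := by
    rw [Complex.mul_conj, Complex.normSq_eq_norm_sq, ee_norm]; simp
  have h3 : ee x ≠ 0 := by intro h0; rw [h0] at h; simp at h
  exact mul_left_cancel₀ h3 (h.trans h2.symm)
lemma ee_sub (x y : ZMod P) : ee (x - y) = ee x * conj (ee y) := by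
  rw [sub_eq_add_neg, ee_add, ee_neg]
lemma ee_int (j : ℤ) : ee ((j : ℤ) : ZMod P) = Complex.exp (2 * Real.pi * Complex.I * j / P) := by
  rw [ee, ZMod.stdAddChar_coe]

noncomputable def fh (K : ZMod P → ℂ) (r : ZMod P) : ℂ := 𝔼 x, K x * ee (r * x)

lemma sum_ee (b : ZMod P) : ∑ r : ZMod P, ee (r * b) = if b = 0 then (P : ℂ) else 0 := by
  have := AddChar.sum_mulShift b (ZMod.isPrimitive_stdAddChar P)
  simp only [ZMod.card] at this
  simp only [ee, this]
  split_ifs <;> simp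

lemma fh_inv (K : ZMod P → ℂ) (x : ZMod P) : K x = ∑ r, fh K r * ee (-(r * x)) := by
  have hP : (P : ℂ) ≠ 0 := by exact_mod_cast NeZero.ne P
  simp only [fh, expect_mul]
  rw [← expect_sum_comm]
  have : ∀ z : ZMod P, ∑ r, K z * ee (r * z) * ee (-(r * x)) =
      if z = x then (P : ℂ) * K z else 0 := by
    intro z
    have h1 : ∀ r : ZMod P, K z * ee (r * z) * ee (-(r * x)) = K z * ee (r * (z - x)) := by
      intro r
      rw [mul_assoc, ← ee_add]; congr 2; ring
    simp_rw [h1, ← mul_sum, sum_ee, sub_eq_zero]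
    split_ifs <;> ring
  simp_rw [this, Fintype.expect_eq_sum_div_card]
  simp [ZMod.card]
  field_simp

lemma plancherel (F K : ZMod P → ℂ) : 𝔼 x, F x * K x = ∑ r, fh K r * fh F (-r) := by
  have : ∀ x, F x * K x = ∑ r, fh K r * (F x * ee (-r * x)) := by
    intro x
    conv_lhs => rw [fh_inv K x, mul_sum]
    refine sum_congr rfl fun r _ => ?_
    rw [neg_mul]; ring
  simp_rw [this]
  rw [expect_sum_comm]
  refine sum_congr rfl fun r _ => ?_
  rw [← mul_expect]; rfl

lemma fh_conj (K : ZMod P → ℂ) (r : ZMod P) : fh (fun x => conj (K x)) (-r) = conj (fh K r) := by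
  simp only [fh, Fintype.expect_eq_sum_div_card, map_div₀, map_sum, map_mul, neg_mul, ee_neg]
  simp

lemma parseval (K : ZMod P → ℂ) : ∑ r, ‖fh K r‖ ^ 2 = 𝔼 x, ‖K x‖ ^ 2 := by
  have h := plancherel (fun x => conj (K x)) K
  have e : ∀ z : ℂ, z * conj z = ((‖z‖ ^ 2 : ℝ) : ℂ) := by
    intro z; rw [Complex.mul_conj, Complex.normSq_eq_norm_sq]
  simp only [fh_conj, e] at h
  simp only [mul_comm (conj _), e] at h
  rw [← Complex.ofReal_expect, ← Complex.ofReal_sum] at h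
  exact_mod_cast h.symm

lemma parseval_le (K : ZMod P → ℂ) (hK : ∀ x, ‖K x‖ ≤ 1) : ∑ r, ‖fh K r‖ ^ 2 ≤ 1 := by
  rw [parseval]
  exact expect_le_one _ _ fun x _ => pow_le_one₀ (norm_nonneg _) (hK x)

lemma u2_inverse (K : ZMod P → ℂ) (hK : ∀ x, ‖K x‖ ≤ 1) : ∃ r, VV 1 K ≤ ‖fh K r‖ ^ 2 := by
  set A : ZMod P → ℂ := fun m => 𝔼 x, dd m K x with hA
  have h1 : VV 1 K = ∑ r, ‖fh A r‖ ^ 2 := by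
    rw [parseval]; rfl
  have h2 : ∀ r, ‖fh A r‖ = ‖fh K r‖ ^ 2 := by
    intro r
    have : fh A r = conj (fh K r) * fh K r := by
      have e : conj (fh K r) = 𝔼 x, conj (K x) * ee (-(r * x)) := by
        rw [← fh_conj]; simp [fh]
      rw [e, expect_mul]
      simp only [fh, hA, dd, expect_mul]
      rw [expect_comm]
      refine expect_congr rfl fun x _ => ?_
      rw [mul_expect]
      conv_rhs => rw [← shift _ x]
      refine expect_congr rfl fun m _ => ?_
      have : ee (r * m) = ee (-(r * x)) * ee (r * (m + x)) := by
        rw [← ee_add]; congr 1; ring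
      rw [this, add_comm x m]; ring
    rw [this, norm_mul, RCLike.norm_conj, sq]
  obtain ⟨r, -, hr⟩ := exists_max_image (univ : Finset (ZMod P)) (fun r => ‖fh K r‖ ^ 2) univ_nonempty
  refine ⟨r, ?_⟩
  rw [h1]
  calc ∑ s, ‖fh A s‖ ^ 2 ≤ ∑ s, ‖fh K r‖ ^ 2 * ‖fh K s‖ ^ 2 := by
        refine sum_le_sum fun s _ => ?_
        rw [h2, sq (‖fh K s‖ ^ 2)]
        exact mul_le_mul_of_nonneg_right (hr s (mem_univ _)) (by positivity)
    _ = ‖fh K r‖ ^ 2 * ∑ s, ‖fh K s‖ ^ 2 := by rw [mul_sum]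
    _ ≤ _ := mul_le_of_le_one_right (by positivity) (parseval_le K hK)

end fourier
end MAC

namespace MAC
open Finset
open scoped BigOperators ComplexConjugate
set_option linter.unusedSectionVars false
set_option linter.unusedVariables false
set_option linter.unusedSimpArgs false

section vino
variable {P : ℕ} [NeZero P]

lemma int_eq_of_cast (a b : ℤ) (h : (a : ZMod P) = b) (hab : |a - b| < P) : a = b := by
  have h1 : (P : ℤ) ∣ a - b := by
    rw [← ZMod.intCast_zmod_eq_zero_iff_dvd]; push_cast; rw [h, sub_self]
  have := Int.eq_zero_of_abs_lt_dvd h1 (by exact_mod_cast hab)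
  linarith

set_option maxHeartbeats 2000000 in
lemma vino (β : ZMod P) (M : ℕ) (A : Finset ℕ) (m : ℕ → ℤ) (η R : ℝ) (hη : 0 < η) (hη1 : η ≤ 1)
    (hA : ∀ a ∈ A, 1 ≤ a ∧ a ≤ M) (hm : ∀ a ∈ A, ((m a : ℤ) : ZMod P) = a * β)
    (hmR : ∀ a ∈ A, |(m a : ℝ)| ≤ R) (hcard : η * M ≤ #A) (hM : 2 ≤ η * M)
    (hR : 64 * R ≤ η * P) :
    ∃ (q : ℕ) (j : ℤ), 1 ≤ q ∧ (q : ℝ) ≤ 2 / η ∧ |(j : ℝ)| ≤ 16 * R / (η ^ 2 * M) ∧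
      (q : ZMod P) * β = j := by
  have hP : 0 < (P : ℝ) := by exact_mod_cast NeZero.pos P
  have hMpos : 0 < (M : ℝ) := by
    rcases Nat.eq_zero_or_pos M with h | h
    · subst h; simp at hM; linarith
    · exact_mod_cast h
  -- close pair
  set L := ⌊2 / η⌋₊ + 1 with hL
  have hLgt : 2 / η < (L : ℝ) := by rw [hL]; push_cast; exact Nat.lt_floor_add_one _
  have hLpos : 0 < (L : ℝ) := lt_trans (by positivity) hLgt
  obtain ⟨a, ha, a', ha', hne, hdiv⟩ : ∃ a ∈ A, ∃ a' ∈ A, a ≠ a' ∧ a / L = a' / L := by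
    refine exists_ne_map_eq_of_card_lt_of_maps_to (t := range (M / L + 1)) ?_ ?_
    · rw [card_range]
      have h1 : ((M / L + 1 : ℕ) : ℝ) < #A := by
        refine lt_of_lt_of_le ?_ hcard
        push_cast
        have h2 : ((M / L : ℕ) : ℝ) ≤ (M : ℝ) / L := Nat.cast_div_le
        have h3 : (M : ℝ) / L < η * M / 2 := by
          rw [div_lt_iff₀ hLpos]
          have : 2 < η * L := by rwa [div_lt_iff₀' hη] at hLgt
          nlinarith
        linarith
      exact_mod_cast h1
    · intro x hx
      simp only [coe_range, Set.mem_Iio]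
      exact Nat.lt_succ_of_le (Nat.div_le_div_right (hA x hx).2)
  wlog hlt : a < a' generalizing a a'
  · exact this a' ha' a ha hne.symm hdiv.symm (by omega)
  have hLp : 0 < L := by omega
  set q := a' - a with hq
  have hq1 : 1 ≤ q := by omega
  have hqL : q < L := by
    have h1 := Nat.div_add_mod a L
    have h2 := Nat.div_add_mod a' L
    rw [← hdiv] at h2
    have h3 := Nat.mod_lt a' hLp
    omega
  have hq2 : (q : ℝ) ≤ 2 / η := by
    have : q ≤ ⌊2 / η⌋₊ := by omega
    exact (Nat.le_floor_iff (by positivity)).1 this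
  set τ := m a' - m a with hτ
  have hqβ : (q : ZMod P) * β = ((τ : ℤ) : ZMod P) := by
    rw [hτ, hq, Nat.cast_sub hlt.le]; push_cast; rw [hm a ha, hm a' ha']; ring
  have hR0 : 0 ≤ R := (abs_nonneg _).trans (hmR a ha)
  have hτR : |(τ : ℝ)| ≤ 2 * R := by
    rw [hτ]; push_cast
    have := abs_sub (m a' : ℝ) (m a)
    linarith [hmR a ha, hmR a' ha']
  refine ⟨q, τ, hq1, hq2, ?_, hqβ⟩
  rcases eq_or_ne τ 0 with h0 | h0
  · rw [h0]; simp; positivity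
  have hτpos : 1 ≤ |(τ : ℝ)| := by
    have := Int.one_le_abs h0
    exact_mod_cast this
  set T := |(τ : ℝ)| with hT
  have hTP : T ≤ P / 32 := by nlinarith
  set b := ⌊(P : ℝ) / (2 * T)⌋₊ with hb
  have hTpos : 0 < T := by linarith
  have hb1 : 1 ≤ b := by
    rw [hb, Nat.one_le_floor_iff, le_div_iff₀ (by positivity)]; linarith
  have hbT : (b : ℝ) * T ≤ P / 2 := by
    have := Nat.floor_le (a := (P : ℝ) / (2 * T)) (by positivity)
    rw [← hb, le_div_iff₀ (by positivity)] at this; linarith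
  have hbT2 : (P : ℝ) ≤ 4 * T * b := by
    have := Nat.lt_floor_add_one ((P : ℝ) / (2 * T))
    rw [← hb, div_lt_iff₀ (by positivity)] at this
    have : (1 : ℝ) ≤ b := by exact_mod_cast hb1
    nlinarith
  set W := ⌊2 * R / T⌋₊ with hW
  have key : #A ≤ (W + 1) * #((range q) ×ˢ (range (M / (q * b) + 1))) := by
    refine card_le_mul_card_image_of_maps_to (f := fun a => (a % q, a / (q * b))) ?_ _ ?_
    · intro x hx
      simp only [mem_product, mem_range]
      exact ⟨Nat.mod_lt _ hq1, Nat.lt_succ_of_le (Nat.div_le_div_right (hA x hx).2)⟩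
    · rintro ⟨u, v⟩ -
      rcases (A.filter (fun a => (a % q, a / (q * b)) = (u, v))).eq_empty_or_nonempty with he | hne
      · rw [he]; simp
      set S := A.filter (fun a => (a % q, a / (q * b)) = (u, v)) with hS
      set a0 := S.min' hne with ha0
      have ha0S : a0 ∈ S := min'_mem _ _
      have hmem : ∀ x ∈ S, x ∈ A ∧ x % q = u ∧ x / (q * b) = v := by
        intro x hx; simpa [hS] using hx
      have hform : ∀ x ∈ S, x = a0 + q * ((x - a0) / q) := by
        intro x hx
        have hle : a0 ≤ x := min'_le _ _ hx
        have hd : q ∣ x - a0 := by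
          refine (Nat.modEq_iff_dvd' hle).1 ?_
          rw [Nat.ModEq, (hmem x hx).2.1, (hmem a0 ha0S).2.1]
        rw [Nat.mul_div_cancel' hd]; omega
      have hcard2 : #S ≤ #(range (W + 1)) := by
        refine card_le_card_of_injOn (fun x => (x - a0) / q) ?_ ?_
        · intro x hx
          simp only [coe_range, Set.mem_Iio]
          refine Nat.lt_succ_of_le ?_
          rw [hW]
          refine Nat.le_floor ?_
          rw [le_div_iff₀ hTpos]
          have hx' : x ∈ S := hx
          set w := (x - a0) / q with hw
          have hxw := hform x hx'
          rw [← hw] at hxw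
          have hwb : w < b := by
            have h1 := Nat.div_add_mod x (q * b)
            have h2 := Nat.div_add_mod a0 (q * b)
            rw [(hmem x hx').2.2] at h1
            rw [(hmem a0 ha0S).2.2] at h2
            have h3 := Nat.mod_lt x (Nat.mul_pos hq1 hb1)
            have h4 : q * w < q * b := by omega
            exact lt_of_mul_lt_mul_left h4 (Nat.zero_le _)
          have heq : (w : ℤ) * τ = m x - m a0 := by
            refine int_eq_of_cast (P := P) _ _ ?_ ?_
            · push_cast
              rw [hm x (hmem x hx').1, hm a0 (hmem a0 ha0S).1, ← hqβ]
              conv_rhs => rw [hxw]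
              push_cast; ring
            · have : |((w : ℝ) * τ - (m x - m a0))| < P := by
                have t1 : |(w : ℝ) * τ| ≤ P / 2 := by
                  rw [abs_mul, Nat.abs_cast]
                  refine le_trans ?_ hbT
                  rw [← hT]
                  gcongr
                have t2 := hmR x (hmem x hx').1
                have t3 := hmR a0 (hmem a0 ha0S).1
                have t4 := abs_sub ((w : ℝ) * τ) ((m x : ℝ) - m a0)
                have t5 := abs_sub (m x : ℝ) (m a0)
                nlinarith
              exact_mod_cast this
          have : (w : ℝ) * T = |((m x : ℝ) - m a0)| := by
            have : ((w : ℝ) * τ) = m x - m a0 := by exact_mod_cast heq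
            rw [← this, abs_mul, Nat.abs_cast]
          rw [this]
          have t5 := abs_sub (m x : ℝ) (m a0)
          linarith [hmR x (hmem x hx').1, hmR a0 (hmem a0 ha0S).1]
        · intro x hx y hy hxy
          have h1 := hform x hx
          have h2 := hform y hy
          simp only at hxy
          rw [hxy] at h1
          omega
      simpa using hcard2
  have key2 : (#A : ℝ) ≤ (2 * R / T + 1) * (q * (M / (q * b) + 1)) := by
    have h1 : (#A : ℝ) ≤ ((W : ℝ) + 1) * (q * ((M / (q * b) : ℕ) + 1)) := by
      have : (#A : ℝ) ≤ (((W + 1) * #((range q) ×ˢ (range (M / (q * b) + 1))) : ℕ) : ℝ) := by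
        exact_mod_cast key
      rw [card_product, card_range, card_range] at this
      push_cast at this ⊢
      linarith
    refine h1.trans ?_
    have h2 : (W : ℝ) ≤ 2 * R / T := Nat.floor_le (by positivity)
    have h3 : ((M / (q * b) : ℕ) : ℝ) ≤ (M : ℝ) / (q * b) := by
      have := Nat.cast_div_le (α := ℝ) (m := M) (n := q * b)
      push_cast at this; exact this
    gcongr
  have hqpos : (0 : ℝ) < q := by exact_mod_cast hq1
  have hbpos : (0 : ℝ) < b := by exact_mod_cast hb1
  have h5 : (q : ℝ) * (M / (q * b) + 1) = M / b + q := by field_simp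
  rw [h5] at key2
  have h6 : 2 * R / T + 1 ≤ 4 * R / T := by
    rw [div_add_one hTpos.ne', div_le_div_iff_of_pos_right hTpos]; linarith
  have h7 : (M : ℝ) / b ≤ 4 * T * M / P := by
    rw [div_le_div_iff₀ hbpos hP]; nlinarith
  have h8 : η * M ≤ 4 * R / T * (4 * T * M / P + q) := by
    refine hcard.trans (key2.trans ?_)
    gcongr
  have h9 : 4 * R / T * (4 * T * M / P + q) = 16 * R * M / P + 4 * R * q / T := by
    field_simp; ring
  have h10 : 16 * R * M / P ≤ η * M / 4 := by
    rw [div_le_iff₀ hP]; nlinarith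
  have h11 : η * M / 2 ≤ 4 * R * q / T := by linarith
  rw [le_div_iff₀ hTpos] at h11
  rw [le_div_iff₀ (by positivity)]
  have h12 : η * q ≤ 2 := by rwa [le_div_iff₀' hη] at hq2
  have h13 : η * (η * M / 2 * T) ≤ η * (4 * R * q) := by gcongr
  nlinarith

end vino
end MAC

namespace MAC
open Finset
open scoped BigOperators ComplexConjugate
set_option linter.unusedSectionVars false
set_option linter.unusedVariables false
set_option linter.unusedSimpArgs false

section W
variable {P : ℕ} [NeZero P]

noncomputable def Lam (M : ℕ) (f g h : ZMod P → ℂ) : ℂ :=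
  𝔼 x, 𝔼 y ∈ Icc (1 : ℤ) M, f x * g (x + (y : ZMod P)) * h (x + (y : ZMod P) ^ 2)

lemma ee_sub_one (m : ℤ) (hm : 2 * |(m : ℝ)| ≤ P) :
    4 * |(m : ℝ)| / P ≤ ‖ee ((m : ℤ) : ZMod P) - 1‖ := by
  have hP : 0 < (P : ℝ) := by exact_mod_cast NeZero.pos P
  have h1 : (2 * Real.pi * Complex.I * m / P : ℂ) = Complex.I * ((2 * Real.pi * m / P : ℝ) : ℂ) := by
    push_cast; ring
  rw [ee_int, h1, Complex.norm_exp_I_mul_ofReal_sub_one, Real.norm_eq_abs, abs_mul]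
  have h2 : |2 * Real.pi * m / P / 2| = Real.pi * |(m : ℝ)| / P := by
    rw [show 2 * Real.pi * m / P / 2 = Real.pi * m / P by ring, abs_div, abs_mul,
      abs_of_pos Real.pi_pos, abs_of_pos hP]
  have h3 := Real.mul_abs_le_abs_sin (x := 2 * Real.pi * m / P / 2) (by
    rw [h2, div_le_iff₀ hP]
    nlinarith [Real.pi_pos])
  rw [h2] at h3
  have h4 : 2 / Real.pi * (Real.pi * |(m : ℝ)| / P) = 2 * |(m : ℝ)| / P := by
    field_simp
  rw [h4] at h3
  rw [abs_two]
  calc 4 * |(m : ℝ)| / P = 2 * (2 * |(m : ℝ)| / P) := by ring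
    _ ≤ _ := by gcongr

lemma ee_lip (m : ℤ) : ‖ee ((m : ℤ) : ZMod P) - 1‖ ≤ 7 * |(m : ℝ)| / P := by
  have hP : 0 < (P : ℝ) := by exact_mod_cast NeZero.pos P
  have h1 : (2 * Real.pi * Complex.I * m / P : ℂ) = Complex.I * ((2 * Real.pi * m / P : ℝ) : ℂ) := by
    push_cast; ring
  rw [ee_int, h1]
  refine (Real.norm_exp_I_mul_ofReal_sub_one_le).trans ?_
  rw [Real.norm_eq_abs, abs_div, abs_mul, abs_mul, abs_two, abs_of_pos Real.pi_pos, abs_of_pos hP]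
  gcongr
  linarith [Real.pi_lt_d2]

lemma geom_int (θ : ZMod P) (lo hi : ℤ) :
    ‖∑ v ∈ Icc lo hi, ee (θ * (v : ZMod P))‖ * ‖ee θ - 1‖ ≤ 2 := by
  rw [← norm_mul, sum_mul]
  have h1 : ∀ v : ℤ, ee (θ * (v : ZMod P)) * (ee θ - 1) =
      ee (θ * ((v + 1 : ℤ) : ZMod P)) - ee (θ * (v : ZMod P)) := by
    intro v
    push_cast
    rw [mul_add, mul_one, ee_add]; ring
  simp_rw [h1]
  rw [Int.Icc_eq_finset_map, sum_map]
  have h2 := sum_range_sub (fun i : ℕ => ee (θ * ((lo + i : ℤ) : ZMod P))) (hi + 1 - lo).toNat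
  have h3 : ∑ x ∈ range (hi + 1 - lo).toNat,
      (ee (θ * (((Nat.castEmbedding.trans (addLeftEmbedding lo)) x + 1 : ℤ) : ZMod P)) -
        ee (θ * (((Nat.castEmbedding.trans (addLeftEmbedding lo)) x : ℤ) : ZMod P))) =
        ee (θ * ((lo + (hi + 1 - lo).toNat : ℤ) : ZMod P)) - ee (θ * ((lo + (0 : ℕ) : ℤ) : ZMod P)) := by
    rw [← h2]
    refine sum_congr rfl fun i _ => ?_
    simp [add_assoc]
  rw [h3]
  refine (norm_sub_le _ _).trans ?_
  rw [ee_norm, ee_norm]; norm_num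

lemma W_step (T : ℕ) (hT : 0 < T) (f g : ZMod P → ℂ) (hf : ∀ x, ‖f x‖ ≤ 1) (hg : ∀ x, ‖g x‖ ≤ 1)
    (r : ZMod P) :
    ‖Lam T f g (fun x => ee (r * x))‖ ^ 2 * T ≤ ∑ d ∈ Ioo (-T : ℤ) T,
      ‖𝔼 v ∈ Icc (1 : ℤ) T, (if v + d ∈ Icc (1 : ℤ) T then (1 : ℂ) else 0) *
        ee (2 * r * (d : ZMod P) * (v : ZMod P))‖ := by
  set B := Icc (1 : ℤ) T with hB
  set D := Ioo (-T : ℤ) T with hD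
  set w : ℤ → ℂ := fun v => if v ∈ B then 1 else 0 with hw
  have hBc : #B = T := by simp [hB]
  have hDB : ∀ u ∈ B, ∀ v ∈ B, v - u ∈ D := by
    intro u hu v hv
    simp only [hB, hD, mem_Icc, mem_Ioo] at *
    omega
  have hTR : (0 : ℝ) < T := by exact_mod_cast hT
  have hDne : D.Nonempty := ⟨0, by simp [hD]; omega⟩
  set Y : ZMod P → ℤ → ℂ := fun x y => w y * g (x + y) * ee (r * (x + (y : ZMod P) ^ 2)) with hY
  have s1 : ‖Lam T f g (fun x => ee (r * x))‖ ^ 2 ≤ 𝔼 x, ‖𝔼 y ∈ B, Y x y‖ ^ 2 := by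
    have : Lam T f g (fun x => ee (r * x)) = 𝔼 x, f x * 𝔼 y ∈ B, Y x y := by
      simp only [Lam, mul_expect]
      refine expect_congr rfl fun x _ => expect_congr rfl fun y hy => ?_
      simp only [hY, hw, if_pos (show y ∈ B from hy)]
      ring
    rw [this]
    exact cs_bdd _ _ _ fun x _ => hf x
  have s2 : ((𝔼 x, ‖𝔼 y ∈ B, Y x y‖ ^ 2 : ℝ) : ℂ) = (#D : ℂ) / #B * 𝔼 d ∈ D, 
      ((𝔼 x, dd (d : ZMod P) g x) * ee (r * (d : ZMod P) ^ 2)) * 𝔼 v ∈ B, w (v + d) *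
        ee (2 * r * (d : ZMod P) * (v : ZMod P)) := by
    rw [Complex.ofReal_expect]
    simp_rw [norm_sq_expect]
    have := fun x => regroup B D hDB (fun v' v => Y x v' * conj (Y x v))
      (fun v' v hv' => by simp [hY, hw, if_neg hv'])
    simp_rw [this]
    rw [← mul_expect]
    congr 1
    rw [expect_comm]
    refine expect_congr rfl fun d _ => ?_
    rw [expect_comm, mul_expect]
    refine expect_congr rfl fun v hv => ?_
    rw [mul_assoc, expect_mul, ← shift (fun x => dd (d : ZMod P) g x * _) (v : ZMod P)]
    refine expect_congr rfl fun x _ => ?_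
    have hwv : w v = 1 := by simp only [hw, if_pos hv]
    simp only [hY, map_mul, hwv, dd, map_one, one_mul]
    rw [← ee_neg]
    have : ee (r * (x + ((v + d : ℤ) : ZMod P) ^ 2)) * ee (-(r * (x + (v : ZMod P) ^ 2))) =
      ee (r * (d : ZMod P) ^ 2) * ee (2 * r * (d : ZMod P) * (v : ZMod P)) := by
      rw [← ee_add, ← ee_add]; congr 1; push_cast; ring
    have h3 : x + ((v + d : ℤ) : ZMod P) = x + v + d := by push_cast; ring
    rw [h3]
    linear_combination (w (v + d) * g (x + v + d) * conj (g (x + v))) * this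
  have s3 : 𝔼 x, ‖𝔼 y ∈ B, Y x y‖ ^ 2 ≤ (#D : ℝ) / #B * 𝔼 d ∈ D, ‖𝔼 v ∈ B, w (v + d) *
        ee (2 * r * (d : ZMod P) * (v : ZMod P))‖ := by
    rw [← Complex.norm_of_nonneg (expect_nonneg fun x _ => by positivity), s2, norm_mul]
    simp only [norm_div, Complex.norm_natCast]
    refine mul_le_mul_of_nonneg_left ?_ (by positivity)
    refine (norm_expect_le' _ _).trans (expect_le_expect fun d _ => ?_)
    rw [norm_mul]
    refine mul_le_of_le_one_left (norm_nonneg _) ?_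
    rw [norm_mul, ee_norm, mul_one]
    exact norm_expect_le_one _ _ fun x _ => dd_bdd hg x
  have s4 := s1.trans s3
  rw [expect_eq_sum_div_card, hBc] at s4
  have hDc : (0 : ℝ) < #D := by exact_mod_cast card_pos.2 hDne
  rw [div_mul_div_comm, mul_comm (#D : ℝ), mul_div_mul_right _ _ hDc.ne', le_div_iff₀ hTR] at s4
  exact s4

set_option maxHeartbeats 1000000 in
theorem lemW (T : ℕ) (δ : ℝ) (hδ : 0 < δ) (hδ1 : δ ≤ 1) (hT : 1024 / δ ^ 4 ≤ T)
    (f g : ZMod P → ℂ) (hf : ∀ x, ‖f x‖ ≤ 1) (hg : ∀ x, ‖g x‖ ≤ 1)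
    (r : ZMod P) (hL : δ ≤ ‖Lam T f g (fun x => ee (r * x))‖) :
    ∃ (q : ℕ) (j : ℤ), 1 ≤ q ∧ (q : ℝ) ≤ 32 / δ ^ 2 ∧ |(j : ℝ)| ≤ 2048 * P / (δ ^ 6 * T ^ 2) ∧
      (q : ZMod P) * r = j := by
  have hP : 0 < (P : ℝ) := by exact_mod_cast NeZero.pos P
  have hTR : (0 : ℝ) < T := lt_of_lt_of_le (by positivity) hT
  have hT0 : 0 < T := by exact_mod_cast hTR
  have hT4 : 1024 ≤ δ ^ 4 * T := by rwa [div_le_iff₀' (by positivity)] at hT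
  have hδ24 : δ ^ 4 ≤ δ ^ 2 := pow_le_pow_of_le_one hδ.le hδ1 (by norm_num)
  have hT2 : 1024 ≤ δ ^ 2 * T := by nlinarith
  set s : ℤ → ℝ := fun d => ‖𝔼 v ∈ Icc (1 : ℤ) T, (if v + d ∈ Icc (1 : ℤ) T then (1 : ℂ) else 0) *
        ee (2 * r * (d : ZMod P) * (v : ZMod P))‖ with hs
  have h1 : δ ^ 2 * T ≤ ∑ d ∈ Ioo (-T : ℤ) T, s d := by
    refine le_trans ?_ (W_step T hT0 f g hf hg r)
    gcongr
  have hs1 : ∀ d, s d ≤ 1 := by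
    intro d
    refine norm_expect_le_one _ _ fun v _ => ?_
    rw [norm_mul, ee_norm, mul_one]
    split_ifs <;> simp
  set D' := (Ioo (-T : ℤ) T).filter (fun d => δ ^ 2 / 4 ≤ s d) with hD'
  have h2 : δ ^ 2 * T / 2 ≤ #D' := by
    have : ∑ d ∈ Ioo (-T : ℤ) T, s d ≤ #D' + 2 * T * (δ ^ 2 / 4) := by
      rw [← sum_filter_add_sum_filter_not _ (fun d => δ ^ 2 / 4 ≤ s d)]
      refine add_le_add ?_ ?_
      · refine (sum_le_card_nsmul _ _ 1 fun d _ => hs1 d).trans ?_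
        simp [hD']
      · refine (sum_le_card_nsmul _ _ (δ ^ 2 / 4) fun d hd => ?_).trans ?_
        · simp only [mem_filter, not_le] at hd; exact hd.2.le
        · rw [nsmul_eq_mul]
          refine mul_le_mul_of_nonneg_right ?_ (by positivity)
          have : #((Ioo (-T : ℤ) T).filter (fun d => ¬ δ ^ 2 / 4 ≤ s d)) ≤ 2 * T := by
            refine (card_filter_le _ _).trans ?_
            simp; omega
          exact_mod_cast this
    linarith
  have hval : ∀ d ∈ D', |(((2 * r * (d : ZMod P)).valMinAbs : ℤ) : ℝ)| ≤ 2 * P / (δ ^ 2 * T) := by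
    intro d hd
    simp only [hD', mem_filter] at hd
    set θ := 2 * r * (d : ZMod P) with hθ
    have e1 : s d = ‖∑ v ∈ Icc (max 1 (1 - d)) (min (T : ℤ) (T - d)), ee (θ * (v : ZMod P))‖ / T := by
      simp only [hs]
      rw [expect_eq_sum_div_card, norm_div]
      simp only [ite_mul, one_mul, zero_mul]
      rw [← sum_filter]
      congr 2
      · refine sum_congr ?_ fun v _ => rfl
        ext v; simp only [mem_filter, mem_Icc]; omega
      · simp
    have e2 := geom_int θ (max 1 (1 - d)) (min (T : ℤ) (T - d))
    have e3 := ee_sub_one (P := P) θ.valMinAbs (by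
      have := ZMod.natAbs_valMinAbs_le θ
      have h3 : 2 * θ.valMinAbs.natAbs ≤ P := by omega
      have : |((θ.valMinAbs : ℤ) : ℝ)| = (θ.valMinAbs.natAbs : ℝ) := by
        rw [Nat.cast_natAbs, Int.cast_abs]
      rw [this]; exact_mod_cast h3)
    rw [ZMod.coe_valMinAbs] at e3
    set N := ‖∑ v ∈ Icc (max 1 (1 - d)) (min (T : ℤ) (T - d)), ee (θ * (v : ZMod P))‖
    have e4 : δ ^ 2 / 4 * T ≤ N := by
      have := hd.2
      rw [e1, le_div_iff₀ hTR] at this; exact this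
    have e5 : δ ^ 2 / 4 * T * (4 * |((θ.valMinAbs : ℤ) : ℝ)| / P) ≤ 2 := by
      refine le_trans ?_ e2
      gcongr
    rw [le_div_iff₀ (by positivity)]
    rw [← mul_div_assoc, div_le_iff₀ hP] at e5
    linarith
  set A := (D'.image Int.natAbs).erase 0 with hA
  have hcA : δ ^ 2 / 8 * T ≤ #A := by
    have c1 : #D' ≤ 2 * #(D'.image Int.natAbs) := by
      refine card_le_mul_card_image _ 2 ?_
      intro n hn
      have : D'.filter (fun d => d.natAbs = n) ⊆ {(n : ℤ), -(n : ℤ)} := by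
        intro d hd
        simp only [mem_filter] at hd
        simp only [mem_insert, mem_singleton]
        omega
      exact (card_le_card this).trans card_le_two
    have c2 : #(D'.image Int.natAbs) - 1 ≤ #A := pred_card_le_card_erase
    have c3 : (#D' : ℝ) ≤ 2 * (#A + 1) := by
      have : #D' ≤ 2 * (#A + 1) := by omega
      exact_mod_cast this
    linarith
  obtain ⟨q, j, hq1, hq2, hj, hqj⟩ := vino (2 * r) T A (fun a => ((a : ZMod P) * (2 * r)).valMinAbs)
    (δ ^ 2 / 8) (2 * P / (δ ^ 2 * T)) (by positivity) (by nlinarith) (by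
      intro a ha
      simp only [hA, mem_erase, mem_image] at ha
      obtain ⟨h0, d, hd, rfl⟩ := ha
      simp only [hD', mem_filter, mem_Ioo] at hd
      omega) (by
      intro a _
      exact ZMod.coe_valMinAbs _) (by
      intro a ha
      simp only [hA, mem_erase, mem_image] at ha
      obtain ⟨h0, d, hd, rfl⟩ := ha
      have := hval d hd
      refine le_trans (le_of_eq ?_) this
      have key : (((d.natAbs : ZMod P) * (2 * r)).valMinAbs).natAbs =
          ((2 * r * (d : ZMod P)).valMinAbs).natAbs := by
        rcases Int.natAbs_eq d with h | h
        · conv_rhs => rw [h]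
          rw [mul_comm]; simp
        · conv_rhs => rw [h]
          rw [Int.cast_neg, Int.cast_natCast]
          rw [mul_neg, ZMod.natAbs_valMinAbs_neg, mul_comm]
      have e : ∀ z : ℤ, |(z : ℝ)| = (z.natAbs : ℝ) := by
        intro z; rw [Nat.cast_natAbs, Int.cast_abs]
      rw [e, e, key]) hcA (by linarith) (by
      rw [← mul_div_assoc, div_le_iff₀ (by positivity)]
      have : δ ^ 2 / 8 * P * (δ ^ 2 * T) = (δ ^ 4 * T) * P / 8 := by ring
      rw [this]
      nlinarith)
  refine ⟨q * 2, j, by omega, ?_, ?_, ?_⟩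
  · push_cast
    calc (q : ℝ) * 2 ≤ 2 / (δ ^ 2 / 8) * 2 := by gcongr
      _ = 32 / δ ^ 2 := by field_simp; norm_num
  · refine hj.trans (le_of_eq ?_)
    field_simp; norm_num
  · rw [← hqj]; push_cast; ring

end W
end MAC

namespace MAC
open Finset
open scoped BigOperators ComplexConjugate
set_option linter.unusedSectionVars false
set_option linter.unusedVariables false
set_option linter.unusedSimpArgs false

section pet
variable {P : ℕ} [NeZero P]

lemma Q_shift {V : Type*} (D : Finset V) (l : List (V → ZMod P)) (K : ZMod P → ℂ) (s : ZMod P) :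
    Q D l (fun x => K (x + s)) = Q D l K := by
  induction l generalizing K with
  | nil => simp only [Q]; rw [shift]
  | cons a l ih =>
    simp only [Q]
    refine expect_congr rfl fun d _ => ?_
    rw [← ih (dd (a d) K)]
    congr 1
    funext x
    simp only [dd]
    rw [add_right_comm]

lemma of_real_le {a : ℝ} {z : ℂ} (ha : 0 ≤ a) (h : (a : ℂ) = z) : a ≤ ‖z‖ := by
  rw [← h, Complex.norm_of_nonneg ha]

lemma pet1a (M : ℕ) (hM : 0 < M) (f g h : ZMod P → ℂ) (hf : ∀ x, ‖f x‖ ≤ 1) (hg : ∀ x, ‖g x‖ ≤ 1)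
    (hh : ∀ x, ‖h x‖ ≤ 1) :
    ‖Lam M f g h‖ ^ 2 ≤ 2 * 𝔼 a ∈ Ioo (-M : ℤ) M, ‖𝔼 x, dd (a : ZMod P) g x * 𝔼 y ∈ Icc (1 : ℤ) M,
      (if y + a ∈ Icc (1 : ℤ) M then (1 : ℂ) else 0) * h (x + ((y + a : ZMod P)) ^ 2 - y) *
        conj (h (x + (y : ZMod P) ^ 2 - y))‖ := by
  set B := Icc (1 : ℤ) M with hB
  set D := Ioo (-M : ℤ) M with hD
  set w : ℤ → ℂ := fun v => if v ∈ B then 1 else 0 with hw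
  have hBc : #B = M := by simp [hB]
  have hDB : ∀ u ∈ B, ∀ v ∈ B, v - u ∈ D := by
    intro u hu v hv
    simp only [hB, hD, mem_Icc, mem_Ioo] at *
    omega
  have hDc : (#D : ℝ) ≤ 2 * #B := by
    rw [hBc]
    have : #D ≤ 2 * M := by simp [hD]; omega
    exact_mod_cast this
  set Y : ZMod P → ℤ → ℂ := fun x y => w y * g (x + y) * h (x + (y : ZMod P) ^ 2) with hY
  have s1 : ‖Lam M f g h‖ ^ 2 ≤ 𝔼 x, ‖𝔼 y ∈ B, Y x y‖ ^ 2 := by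
    have : Lam M f g h = 𝔼 x, f x * 𝔼 y ∈ B, Y x y := by
      simp only [Lam, mul_expect]
      refine expect_congr rfl fun x _ => expect_congr rfl fun y hy => ?_
      simp only [hY, hw, if_pos (show y ∈ B from hy)]
      ring
    rw [this]
    exact cs_bdd _ _ _ fun x _ => hf x
  have s2 : ((𝔼 x, ‖𝔼 y ∈ B, Y x y‖ ^ 2 : ℝ) : ℂ) = (#D : ℂ) / #B * 𝔼 a ∈ D,
      𝔼 x, dd (a : ZMod P) g x * 𝔼 y ∈ B, w (y + a) * h (x + ((y + a : ZMod P)) ^ 2 - y) *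
        conj (h (x + (y : ZMod P) ^ 2 - y)) := by
    rw [Complex.ofReal_expect]
    simp_rw [norm_sq_expect]
    have := fun x => regroup B D hDB (fun v' v => Y x v' * conj (Y x v))
      (fun v' v hv' => by simp [hY, hw, if_neg hv'])
    simp_rw [this]
    rw [← mul_expect]
    congr 1
    rw [expect_comm]
    refine expect_congr rfl fun d _ => ?_
    simp_rw [mul_expect]
    rw [expect_comm]
    conv_rhs => rw [expect_comm]
    refine expect_congr rfl fun v hv => ?_
    rw [← shift (fun x => dd (d : ZMod P) g x * _) (v : ZMod P)]
    refine expect_congr rfl fun x _ => ?_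
    have hwv : w v = 1 := by simp only [hw, if_pos hv]
    simp only [hY, map_mul, hwv, dd, map_one, one_mul]
    have h3 : x + ((v + d : ℤ) : ZMod P) = x + v + d := by push_cast; ring
    have h4 : x + v + (v + d : ZMod P) ^ 2 - v = x + ((v + d : ℤ) : ZMod P) ^ 2 := by push_cast; ring
    have h5 : x + v + (v : ZMod P) ^ 2 - v = x + (v : ZMod P) ^ 2 := by ring
    rw [h3, h4, h5]
    ring
  refine s1.trans ((of_real_le (expect_nonneg fun x _ => by positivity) s2).trans ?_)
  rw [norm_mul]
  refine mul_le_mul ?_ (norm_expect_le' _ _) (norm_nonneg _) (by norm_num)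
  simp only [norm_div, Complex.norm_natCast]
  refine div_le_of_le_mul₀ (by positivity) (by norm_num) hDc

lemma pet1b (M : ℕ) (hM : 0 < M) (h : ZMod P → ℂ) (hh : ∀ x, ‖h x‖ ≤ 1) (a : ℤ) 
    (u : ZMod P → ℂ) (hu : ∀ x, ‖u x‖ ≤ 1) :
    ‖𝔼 x, u x * 𝔼 y ∈ Icc (1 : ℤ) M,
      (if y + a ∈ Icc (1 : ℤ) M then (1 : ℂ) else 0) * h (x + ((y + a : ZMod P)) ^ 2 - y) *
        conj (h (x + (y : ZMod P) ^ 2 - y))‖ ^ 2 ≤ 2 * 𝔼 b ∈ Ioo (-M : ℤ) M,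
      ‖𝔼 x, 𝔼 z ∈ Icc (1 : ℤ) M, (if z ∈ Icc (1 : ℤ) M ∧ z + a ∈ Icc (1 : ℤ) M ∧ z + b ∈ Icc (1 : ℤ) M ∧
          z + b + a ∈ Icc (1 : ℤ) M then (1 : ℂ) else 0) *
        (h x * conj (h (x + 2 * a * z + a ^ 2)) * conj (h (x + 2 * b * z + b ^ 2 - b))) *
          h (x + 2 * (a + b) * z + ((a + b) ^ 2 - b))‖ := by
  set B := Icc (1 : ℤ) M with hB
  set D := Ioo (-M : ℤ) M with hD
  have hBc : #B = M := by simp [hB]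
  have hDB : ∀ u ∈ B, ∀ v ∈ B, v - u ∈ D := by
    intro u hu v hv
    simp only [hB, hD, mem_Icc, mem_Ioo] at *
    omega
  have hDc : (#D : ℝ) ≤ 2 * #B := by
    rw [hBc]
    have : #D ≤ 2 * M := by simp [hD]; omega
    exact_mod_cast this
  set w : ℤ → ℂ := fun v => if v ∈ B then 1 else 0 with hw
  have hwc : ∀ v, conj (w v) = w v := by intro v; simp only [hw]; split_ifs <;> simp
  set Z : ZMod P → ℤ → ℂ := fun x y => w y * w (y + a) * h (x + ((y + a : ZMod P)) ^ 2 - y) *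
        conj (h (x + (y : ZMod P) ^ 2 - y)) with hZ
  have s1 : ‖𝔼 x, u x * 𝔼 y ∈ B,
      (if y + a ∈ B then (1 : ℂ) else 0) * h (x + ((y + a : ZMod P)) ^ 2 - y) *
        conj (h (x + (y : ZMod P) ^ 2 - y))‖ ^ 2 ≤ 𝔼 x, ‖𝔼 y ∈ B, Z x y‖ ^ 2 := by
    refine (cs_bdd _ _ _ fun x _ => hu x).trans (le_of_eq ?_)
    refine expect_congr rfl fun x _ => ?_
    congr 2
    refine expect_congr rfl fun y hy => ?_
    simp only [hZ, hw, if_pos hy, one_mul]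
  have s2 : ((𝔼 x, ‖𝔼 y ∈ B, Z x y‖ ^ 2 : ℝ) : ℂ) = (#D : ℂ) / #B * 𝔼 b ∈ D,
      𝔼 x, 𝔼 z ∈ B, (if z ∈ B ∧ z + a ∈ B ∧ z + b ∈ B ∧ z + b + a ∈ B then (1 : ℂ) else 0) *
        (h x * conj (h (x + 2 * a * z + a ^ 2)) * conj (h (x + 2 * b * z + b ^ 2 - b))) *
          h (x + 2 * (a + b) * z + ((a + b) ^ 2 - b)) := by
    rw [Complex.ofReal_expect]
    simp_rw [norm_sq_expect]
    have := fun x => regroup B D hDB (fun v' v => Z x v' * conj (Z x v))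
      (fun v' v hv' => by simp [hZ, hw, if_neg hv'])
    simp_rw [this]
    rw [← mul_expect]
    congr 1
    rw [expect_comm]
    refine expect_congr rfl fun b _ => ?_
    rw [expect_comm]
    conv_rhs => rw [expect_comm]
    refine expect_congr rfl fun z hz => ?_
    conv_rhs => rw [← shift _ ((z : ZMod P) ^ 2 - z)]
    refine expect_congr rfl fun x _ => ?_
    have hww : (if z ∈ B ∧ z + a ∈ B ∧ z + b ∈ B ∧ z + b + a ∈ B then (1 : ℂ) else 0) =
        w z * w (z + a) * w (z + b) * w (z + b + a) := by
      simp only [hw]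
      by_cases h1 : z ∈ B <;> by_cases h2 : z + a ∈ B <;> by_cases h3 : z + b ∈ B <;>
        by_cases h4 : z + b + a ∈ B <;> simp [h1, h2, h3, h4]
    rw [hww]
    simp only [hZ, map_mul, hwc, Complex.conj_conj]
    have e1 : x + (((z + b : ℤ) : ZMod P) + a) ^ 2 - ((z + b : ℤ) : ZMod P) =
      x + ((z : ZMod P) ^ 2 - z) + 2 * (a + b) * z + ((a + b) ^ 2 - b) := by push_cast; ring
    have e2 : x + (((z + b : ℤ) : ZMod P)) ^ 2 - ((z + b : ℤ) : ZMod P) =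
      x + ((z : ZMod P) ^ 2 - z) + 2 * b * z + b ^ 2 - b := by push_cast; ring
    have e3 : x + (z + a : ZMod P) ^ 2 - z = x + ((z : ZMod P) ^ 2 - z) + 2 * a * z + a ^ 2 := by ring
    have e4 : x + (z : ZMod P) ^ 2 - z = x + ((z : ZMod P) ^ 2 - z) := by ring
    rw [e1, e2, e3, e4]
    ring
  refine s1.trans ((of_real_le (expect_nonneg fun x _ => by positivity) s2).trans ?_)
  rw [norm_mul]
  refine mul_le_mul ?_ (norm_expect_le' _ _) (norm_nonneg _) (by norm_num)
  simp only [norm_div, Complex.norm_natCast]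
  refine div_le_of_le_mul₀ (by positivity) (by norm_num) hDc

/-- multiplication map -/
def mulHom (u : ZMod P) : ℤ →+ ZMod P := (AddMonoidHom.mulLeft u).comp (Int.castAddHom (ZMod P))

@[simp] lemma mulHom_apply (u : ZMod P) (z : ℤ) : mulHom u z = u * z := rfl

lemma pet1c (M : ℕ) (hM : 0 < M) (h : ZMod P → ℂ) (hh : ∀ x, ‖h x‖ ≤ 1) (a b : ℤ) :
      ‖𝔼 x, 𝔼 z ∈ Icc (1 : ℤ) M, (if z ∈ Icc (1 : ℤ) M ∧ z + a ∈ Icc (1 : ℤ) M ∧ z + b ∈ Icc (1 : ℤ) M ∧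
          z + b + a ∈ Icc (1 : ℤ) M then (1 : ℂ) else 0) *
        (h x * conj (h (x + 2 * a * z + a ^ 2)) * conj (h (x + 2 * b * z + b ^ 2 - b))) *
          h (x + 2 * (a + b) * z + ((a + b) ^ 2 - b))‖ ^ 8 ≤ 2 ^ 8 * 
      𝔼 c₁ ∈ Ioo (-M : ℤ) M, 𝔼 c₂ ∈ Ioo (-M : ℤ) M, 𝔼 c₃ ∈ Ioo (-M : ℤ) M,
        ‖𝔼 x, dd (2 * a * c₃ : ZMod P) (dd (2 * b * c₂) (dd (2 * (a + b) * c₁) h)) x‖ := by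
  set B := Icc (1 : ℤ) M with hB
  set D := Ioo (-M : ℤ) M with hD
  have hBc : #B = M := by simp [hB]
  have hDB : ∀ u ∈ B, ∀ v ∈ B, v - u ∈ D := by
    intro u hu v hv
    simp only [hB, hD, mem_Icc, mem_Ioo] at *
    omega
  have hDc : (#D : ℝ) ≤ 2 * #B := by
    rw [hBc]
    have : #D ≤ 2 * M := by simp [hD]; omega
    exact_mod_cast this
  have := elim B D ⟨1, by simp [hB]; omega⟩ hDB 2 (by norm_num) hDc (mulHom (2 * (a + b) : ZMod P))
    [(h, mulHom 0), (fun x => conj (h (x + a ^ 2)), mulHom (2 * a)),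
      (fun x => conj (h (x + b ^ 2 - b)), mulHom (2 * b))] (by
      intro p hp x
      simp only [List.mem_cons, List.not_mem_nil, or_false] at hp
      rcases hp with rfl | rfl | rfl
      · exact hh _
      · simpa using hh _
      · simpa using hh _)
    (fun z => if z ∈ B ∧ z + a ∈ B ∧ z + b ∈ B ∧ z + b + a ∈ B then (1 : ℂ) else 0)
    (by intro z; split_ifs <;> simp) (by intro z hz; simp [hz])
    (fun x => h (x + ((a + b) ^ 2 - b)))
  rw [Q_shift] at this
  simp only [List.length_cons, List.length_nil, List.map_cons, List.map_nil, List.prod_cons,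
    List.prod_nil, mul_one, mulHom_apply, zero_mul, add_zero, Q, sub_zero] at this
  have h1 : ∀ c : ℤ, 2 * ((a : ZMod P) + b) * c - 2 * a * c = 2 * b * c := by intro c; ring
  have h2 : ∀ c : ℤ, 2 * ((a : ZMod P) + b) * c - 2 * b * c = 2 * a * c := by intro c; ring
  simp only [h1, h2] at this
  norm_num only at this
  rw [show (2 : ℝ) ^ 8 = 256 by norm_num]
  simpa only [mul_assoc] using this

lemma pet1 (M : ℕ) (hM : 0 < M) (f g h : ZMod P → ℂ) (hf : ∀ x, ‖f x‖ ≤ 1) (hg : ∀ x, ‖g x‖ ≤ 1)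
    (hh : ∀ x, ‖h x‖ ≤ 1) :
    ‖Lam M f g h‖ ^ 32 ≤ 2 ^ 32 * 𝔼 a ∈ Ioo (-M : ℤ) M, 𝔼 b ∈ Ioo (-M : ℤ) M,
      𝔼 c₁ ∈ Ioo (-M : ℤ) M, 𝔼 c₂ ∈ Ioo (-M : ℤ) M, 𝔼 c₃ ∈ Ioo (-M : ℤ) M,
        ‖𝔼 x, dd (2 * a * c₃ : ZMod P) (dd (2 * b * c₂) (dd (2 * (a + b) * c₁) h)) x‖ := by
  set D := Ioo (-M : ℤ) M with hD
  have h1 := pet1a M hM f g h hf hg hh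
  set F := fun a : ℤ => ‖𝔼 x, dd (a : ZMod P) g x * 𝔼 y ∈ Icc (1 : ℤ) M,
      (if y + a ∈ Icc (1 : ℤ) M then (1 : ℂ) else 0) * h (x + ((y + a : ZMod P)) ^ 2 - y) *
        conj (h (x + (y : ZMod P) ^ 2 - y))‖ with hF
  have h2 : ∀ a : ℤ, F a ^ 2 ≤ _ := fun a => pet1b M hM h hh a (dd (a : ZMod P) g) (dd_bdd hg)
  set R := fun a b : ℤ => ‖𝔼 x, 𝔼 z ∈ Icc (1 : ℤ) M, (if z ∈ Icc (1 : ℤ) M ∧ z + a ∈ Icc (1 : ℤ) M ∧ z + b ∈ Icc (1 : ℤ) M ∧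
          z + b + a ∈ Icc (1 : ℤ) M then (1 : ℂ) else 0) *
        (h x * conj (h (x + 2 * a * z + a ^ 2)) * conj (h (x + 2 * b * z + b ^ 2 - b))) *
          h (x + 2 * (a + b) * z + ((a + b) ^ 2 - b))‖ with hR
  have h3 : ∀ a b : ℤ, R a b ^ 8 ≤ _ := fun a b => pet1c M hM h hh a b
  have hF0 : ∀ a, 0 ≤ F a := fun a => norm_nonneg _
  have hR0 : ∀ a b, 0 ≤ R a b := fun a b => norm_nonneg _
  have e4 : ‖Lam M f g h‖ ^ 4 ≤ 8 * 𝔼 a ∈ D, 𝔼 b ∈ D, R a b := by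
    calc ‖Lam M f g h‖ ^ 4 = (‖Lam M f g h‖ ^ 2) ^ 2 := by ring
      _ ≤ (2 * 𝔼 a ∈ D, F a) ^ 2 := by gcongr
      _ = 4 * (𝔼 a ∈ D, F a) ^ 2 := by ring
      _ ≤ 4 * 𝔼 a ∈ D, F a ^ 2 := by gcongr; exact jensen_sq _ _
      _ ≤ 4 * 𝔼 a ∈ D, 2 * 𝔼 b ∈ D, R a b := by gcongr with a ha; exact h2 a
      _ = _ := by rw [← mul_expect]; ring
  calc ‖Lam M f g h‖ ^ 32 = (‖Lam M f g h‖ ^ 4) ^ 8 := by ring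
    _ ≤ (8 * 𝔼 a ∈ D, 𝔼 b ∈ D, R a b) ^ 8 := by gcongr
    _ = 8 ^ 8 * (𝔼 a ∈ D, 𝔼 b ∈ D, R a b) ^ (2 ^ 3) := by ring
    _ ≤ 8 ^ 8 * 𝔼 a ∈ D, 𝔼 b ∈ D, R a b ^ (2 ^ 3) := by
        gcongr
        refine (jensen_pow _ _ (fun a _ => expect_nonneg fun b _ => hR0 a b) 3).trans ?_
        exact expect_le_expect fun a _ => jensen_pow _ _ (fun b _ => hR0 a b) 3
    _ ≤ 8 ^ 8 * 𝔼 a ∈ D, 𝔼 b ∈ D, 2 ^ 8 * 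
      𝔼 c₁ ∈ D, 𝔼 c₂ ∈ D, 𝔼 c₃ ∈ D,
        ‖𝔼 x, dd (2 * a * c₃ : ZMod P) (dd (2 * b * c₂) (dd (2 * (a + b) * c₁) h)) x‖ := by
        gcongr with a ha b hb
        exact h3 a b
    _ = _ := by
        simp_rw [← mul_expect]
        ring

end pet
end MAC

namespace MAC
open Finset
open scoped BigOperators ComplexConjugate
set_option linter.unusedSectionVars false
set_option linter.unusedVariables false
set_option linter.unusedSimpArgs false

section pet
variable {P : ℕ} [NeZero P]

/-- linear form in two variables -/
def lin2 (u v : ZMod P) : ℤ × ℤ →+ ZMod P := (mulHom u).coprod (mulHom v)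

@[simp] lemma lin2_apply (u v : ZMod P) (z : ℤ × ℤ) : lin2 u v z = u * z.1 + v * z.2 := rfl

/-- the three one dimensional directions -/
def R3 (c₁ c₂ c₃ : ℤ) : List (ℤ × ℤ → ZMod P) :=
  [fun d => 2 * c₁ * (d.1 + d.2), fun d => 2 * c₂ * d.2, fun d => 2 * c₃ * d.1]

/-- the seven directions -/
def R7 (c₁ c₂ c₃ : ℤ) : List (ℤ × ℤ → ZMod P) :=
  (fun d => 2 * ((c₁ + c₃ : ℤ) * d.1 + (c₁ + c₂ : ℤ) * d.2)) ::
  (fun d => 2 * ((c₁ : ℤ) * d.1 + (c₁ + c₂ : ℤ) * d.2)) ::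
  (fun d => 2 * ((c₁ + c₃ : ℤ) * d.1 + (c₁ : ℤ) * d.2)) ::
  (fun d => 2 * ((c₃ : ℤ) * d.1 + (c₂ : ℤ) * d.2)) :: R3 c₁ c₂ c₃

lemma pet2a (M : ℕ) (hM : 0 < M) (K : ZMod P → ℂ) (hK : ∀ x, ‖K x‖ ≤ 1) (c₁ c₂ c₃ : ℤ) :
    ‖𝔼 x, 𝔼 a ∈ Ioo (-M : ℤ) M, 𝔼 b ∈ Ioo (-M : ℤ) M, 
      dd (2 * a * c₃ : ZMod P) (dd (2 * b * c₂) (dd (2 * (a + b) * c₁) K)) x‖ ^ 128 ≤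
    49 ^ 128 * Q (Ioo (-(4 * M) : ℤ) (4 * M) ×ˢ Ioo (-(4 * M) : ℤ) (4 * M)) (R7 c₁ c₂ c₃) K := by
  set B := Ioo (-M : ℤ) M with hB
  set E := Ioo (-(4 * M) : ℤ) (4 * M) with hE
  set K' : ZMod P → ℂ := fun x => conj (K x) with hK'
  have hK'b : ∀ x, ‖K' x‖ ≤ 1 := by intro x; simpa [hK'] using hK x
  have hBc : #B = 2 * M - 1 := by simp [hB]; omega
  have hEc : #E = 8 * M - 1 := by simp [hE]; omega
  have := elim (B ×ˢ B) (E ×ˢ E) ⟨(0, 0), by simp [hB]; omega⟩ (by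
      intro u hu v hv
      simp only [hB, hE, mem_product, mem_Ioo, Prod.fst_sub, Prod.snd_sub] at *
      omega) 49 (by norm_num) (by
      rw [card_product, card_product]
      have : #E ≤ 7 * #B := by omega
      have h2 : #E * #E ≤ 49 * (#B * #B) := by nlinarith
      exact_mod_cast h2)
    (lin2 (2 * (c₁ + c₃)) (2 * (c₁ + c₂)) : ℤ × ℤ →+ ZMod P)
    [(K', lin2 0 0), (K, lin2 (2 * c₃) 0), (K, lin2 0 (2 * c₂)), (K, lin2 (2 * c₁) (2 * c₁)),
     (K', lin2 (2 * c₃) (2 * c₂)), (K', lin2 (2 * (c₁ + c₃)) (2 * c₁)),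
     (K', lin2 (2 * c₁) (2 * (c₁ + c₂)))] (by
      intro p hp x
      simp only [List.mem_cons, List.not_mem_nil, or_false] at hp
      rcases hp with rfl | rfl | rfl | rfl | rfl | rfl | rfl
      all_goals first | exact hK _ | exact hK'b _)
    (fun z => if z ∈ B ×ˢ B then (1 : ℂ) else 0)
    (by intro z; split_ifs <;> simp) (by intro z hz; simp only [if_neg hz]) K
  have e : (List.map (fun (p : (ZMod P → ℂ) × (ℤ × ℤ →+ ZMod P)) v => lin2 (2 * (c₁ + c₃) : ZMod P) (2 * (c₁ + c₂) : ZMod P) v - p.2 v)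
      [(K', lin2 0 0), (K, lin2 (2 * c₃ : ZMod P) 0), (K, lin2 0 (2 * c₂)), (K, lin2 (2 * c₁) (2 * c₁)),
     (K', lin2 (2 * c₃) (2 * c₂)), (K', lin2 (2 * (c₁ + c₃)) (2 * c₁)),
     (K', lin2 (2 * c₁) (2 * (c₁ + c₂)))]) = R7 c₁ c₂ c₃ := by
    simp only [List.map_cons, List.map_nil, R7, R3, lin2_apply, List.cons.injEq, and_true]
    refine ⟨?_, ?_, ?_, ?_, ?_, ?_, ?_⟩ <;> (funext d; push_cast; ring)
  rw [e] at this
  refine le_trans (le_of_eq ?_) this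
  simp only [List.length_cons, List.length_nil]
  norm_num only
  congr 2
  refine expect_congr rfl fun x _ => ?_
  rw [expect_product]
  refine expect_congr rfl fun a ha => expect_congr rfl fun b hb => ?_
  rw [if_pos (mem_product.2 ⟨ha, hb⟩)]
  simp only [List.map_cons, List.map_nil, List.prod_cons, List.prod_nil, lin2_apply, dd, hK', map_mul,
    Complex.conj_conj, zero_mul, add_zero, mul_one, one_mul, zero_add]
  have e1 : x + 2 * a * c₃ + 2 * b * c₂ + 2 * (a + b) * c₁ =
    x + (2 * (c₁ + c₃) * a + 2 * (c₁ + c₂) * b : ZMod P) := by ring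
  have e2 : x + 2 * a * c₃ + 2 * b * c₂ = x + (2 * c₃ * a + 2 * c₂ * b : ZMod P) := by ring
  have e3 : x + 2 * a * c₃ + 2 * (a + b) * c₁ = x + (2 * (c₁ + c₃) * a + 2 * c₁ * b : ZMod P) := by ring
  have e4 : x + 2 * b * c₂ + 2 * (a + b) * c₁ = x + (2 * c₁ * a + 2 * (c₁ + c₂) * b : ZMod P) := by ring
  have e5 : x + 2 * a * c₃ = x + (2 * c₃ * a : ZMod P) := by ring
  have e6 : x + 2 * b * c₂ = x + (2 * c₂ * b : ZMod P) := by ring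
  have e7 : x + 2 * (a + b) * c₁ = x + (2 * c₁ * a + 2 * c₁ * b : ZMod P) := by ring
  rw [e1, e2, e3, e4, e5, e6, e7]
  ring

lemma num_pet (x X' Y Z : ℝ) (hx : 0 ≤ x) (hZ0 : 0 ≤ Z) (h1 : x ^ 32 ≤ 2 ^ 32 * X')
    (h2 : X' ^ 2 ≤ Y) (h3 : Y ^ (2 ^ 7) ≤ 49 ^ 128 * Z) : x ^ (2 ^ 13) ≤ 98 ^ (2 ^ 13) * Z := by
  have a1 : (2 ^ 13 : ℕ) = 32 * (2 * 2 ^ 7) := by norm_num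
  have a2 : (128 : ℕ) ≤ 2 ^ 13 := by norm_num
  have a3 : (98 : ℝ) = 2 * 49 := by norm_num
  generalize 2 ^ 7 = m at *
  generalize 2 ^ 13 = n at *
  calc x ^ n = ((x ^ 32) ^ 2) ^ m := by rw [← pow_mul, ← pow_mul, a1]
    _ ≤ ((2 ^ 32 * X') ^ 2) ^ m := by gcongr
    _ = 2 ^ n * (X' ^ 2) ^ m := by rw [mul_pow, mul_pow, ← pow_mul, ← pow_mul, a1]
    _ ≤ 2 ^ n * (49 ^ 128 * Z) := by
        gcongr
        refine le_trans ?_ h3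
        gcongr
    _ ≤ 2 ^ n * (49 ^ n * Z) := by
        gcongr
        norm_num
    _ = _ := by rw [a3, mul_pow, mul_assoc]

lemma pet2 (M : ℕ) (hM : 0 < M) (f g h : ZMod P → ℂ) (hf : ∀ x, ‖f x‖ ≤ 1) (hg : ∀ x, ‖g x‖ ≤ 1)
    (hh : ∀ x, ‖h x‖ ≤ 1) :
    ‖Lam M f g h‖ ^ (2 ^ 13) ≤ 98 ^ (2 ^ 13) * 
      𝔼 c₁ ∈ Ioo (-M : ℤ) M, 𝔼 c₂ ∈ Ioo (-M : ℤ) M, 𝔼 c₃ ∈ Ioo (-M : ℤ) M, 𝔼 k : ZMod P,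
       Q (Ioo (-(4 * M) : ℤ) (4 * M) ×ˢ Ioo (-(4 * M) : ℤ) (4 * M)) (R7 c₁ c₂ c₃) (dd k h) := by
  set D := Ioo (-M : ℤ) M with hD
  set E := Ioo (-(4 * M) : ℤ) (4 * M) with hE
  have h1 := pet1 M hM f g h hf hg hh
  set X := fun (a b c₁ c₂ c₃ : ℤ) => ‖𝔼 x, dd (2 * a * c₃ : ZMod P) (dd (2 * b * c₂) (dd (2 * (a + b) * c₁) h)) x‖ with hX
  set Y := fun (c₁ c₂ c₃ : ℤ) (k : ZMod P) => ‖𝔼 x, 𝔼 a ∈ D, 𝔼 b ∈ D, 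
      dd (2 * a * c₃ : ZMod P) (dd (2 * b * c₂) (dd (2 * (a + b) * c₁) (dd k h))) x‖ with hY
  have h2 : (𝔼 a ∈ D, 𝔼 b ∈ D, 𝔼 c₁ ∈ D, 𝔼 c₂ ∈ D, 𝔼 c₃ ∈ D, X a b c₁ c₂ c₃) ^ 2 ≤
     𝔼 c₁ ∈ D, 𝔼 c₂ ∈ D, 𝔼 c₃ ∈ D, 𝔼 k, Y c₁ c₂ c₃ k := by
    calc _ ≤ 𝔼 a ∈ D, 𝔼 b ∈ D, 𝔼 c₁ ∈ D, 𝔼 c₂ ∈ D, 𝔼 c₃ ∈ D, X a b c₁ c₂ c₃ ^ 2 := by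
          refine (jensen_sq _ _).trans (expect_le_expect fun a _ => ?_)
          refine (jensen_sq _ _).trans (expect_le_expect fun b _ => ?_)
          refine (jensen_sq _ _).trans (expect_le_expect fun c₁ _ => ?_)
          refine (jensen_sq _ _).trans (expect_le_expect fun c₂ _ => ?_)
          exact (jensen_sq _ _)
      _ = 𝔼 c₁ ∈ D, 𝔼 c₂ ∈ D, 𝔼 c₃ ∈ D, 𝔼 a ∈ D, 𝔼 b ∈ D, X a b c₁ c₂ c₃ ^ 2 := by
          have : ∀ F : ℤ → ℤ → ℤ → ℤ → ℤ → ℝ, 𝔼 a ∈ D, 𝔼 b ∈ D, 𝔼 c₁ ∈ D, 𝔼 c₂ ∈ D, 𝔼 c₃ ∈ D, F a b c₁ c₂ c₃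
            = 𝔼 c₁ ∈ D, 𝔼 c₂ ∈ D, 𝔼 c₃ ∈ D, 𝔼 a ∈ D, 𝔼 b ∈ D, F a b c₁ c₂ c₃ := by
            intro F
            have : ∀ G : ℤ → ℤ → ℤ → ℝ, 𝔼 a ∈ D, 𝔼 b ∈ D, 𝔼 c ∈ D, G a b c = 𝔼 c ∈ D, 𝔼 a ∈ D, 𝔼 b ∈ D, G a b c := by
              intro G
              rw [expect_comm (s := D)]
              conv_rhs => rw [expect_comm]
              rw [expect_comm]
              refine expect_congr rfl fun a _ => ?_
              rw [expect_comm]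
            rw [this]
            refine expect_congr rfl fun c₁ _ => ?_
            rw [this]
            refine expect_congr rfl fun c₂ _ => ?_
            rw [this]
          exact this _
      _ ≤ _ := by
          refine expect_le_expect fun c₁ _ => expect_le_expect fun c₂ _ => expect_le_expect fun c₃ _ => ?_
          have : ((𝔼 a ∈ D, 𝔼 b ∈ D, X a b c₁ c₂ c₃ ^ 2 : ℝ) : ℂ) = 𝔼 k, 𝔼 x, 𝔼 a ∈ D, 𝔼 b ∈ D, 
              dd (2 * a * c₃ : ZMod P) (dd (2 * b * c₂) (dd (2 * (a + b) * c₁) (dd k h))) x := by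
            simp only [Complex.ofReal_expect, hX, norm_sq_mean]
            have hc : ∀ (k : ZMod P) (a b : ℤ), dd k (dd (2 * a * c₃ : ZMod P) (dd (2 * b * c₂) (dd (2 * (a + b) * c₁) h))) = 
              dd (2 * a * c₃ : ZMod P) (dd (2 * b * c₂) (dd (2 * (a + b) * c₁) (dd k h))) := by
              intro k a b
              rw [dd_comm k, dd_comm k, dd_comm k]
            simp_rw [hc]
            have hs : ∀ F : ℤ → ℤ → ZMod P → ℂ, 𝔼 a ∈ D, 𝔼 b ∈ D, 𝔼 k, F a b k = 𝔼 k, 𝔼 a ∈ D, 𝔼 b ∈ D, F a b k := by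
              intro F
              conv_rhs => rw [expect_comm]
              refine expect_congr rfl fun a _ => ?_
              rw [expect_comm]
            rw [hs]
            refine expect_congr rfl fun k _ => ?_
            rw [hs]
          refine (of_real_le (expect_nonneg fun a _ => expect_nonneg fun b _ => sq_nonneg _) this).trans ?_
          exact norm_expect_le' _ _
  have hYn : ∀ c₁ c₂ c₃ k, 0 ≤ Y c₁ c₂ c₃ k := fun _ _ _ _ => norm_nonneg _
  have h3 : (𝔼 c₁ ∈ D, 𝔼 c₂ ∈ D, 𝔼 c₃ ∈ D, 𝔼 k, Y c₁ c₂ c₃ k) ^ (2 ^ 7) ≤ 𝔼 c₁ ∈ D, 𝔼 c₂ ∈ D, 𝔼 c₃ ∈ D, 𝔼 k, 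
      49 ^ 128 * Q (E ×ˢ E) (R7 c₁ c₂ c₃) (dd k h) := by
    refine (jensen_pow _ _ (fun c _ => expect_nonneg fun _ _ => expect_nonneg fun _ _ => expect_nonneg fun _ _ => hYn _ _ _ _) _).trans (expect_le_expect fun c₁ _ => ?_)
    refine (jensen_pow _ _ (fun c _ => expect_nonneg fun _ _ => expect_nonneg fun _ _ => hYn _ _ _ _) _).trans (expect_le_expect fun c₂ _ => ?_)
    refine (jensen_pow _ _ (fun c _ => expect_nonneg fun _ _ => hYn _ _ _ _) _).trans (expect_le_expect fun c₃ _ => ?_)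
    refine (jensen_pow _ _ (fun c _ => hYn _ _ _ _) _).trans (expect_le_expect fun k _ => ?_)
    exact pet2a M hM (dd k h) (dd_bdd hh) c₁ c₂ c₃
  simp_rw [← mul_expect] at h3
  set Z := 𝔼 c₁ ∈ D, 𝔼 c₂ ∈ D, 𝔼 c₃ ∈ D, 𝔼 k : ZMod P, Q (E ×ˢ E) (R7 c₁ c₂ c₃) (dd k h) with hZ
  have hZ0 : 0 ≤ Z := expect_nonneg fun c _ => expect_nonneg fun _ _ => expect_nonneg fun _ _ => expect_nonneg fun _ _ => Q_nonneg _ _ _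
  set X' := 𝔼 a ∈ D, 𝔼 b ∈ D, 𝔼 c₁ ∈ D, 𝔼 c₂ ∈ D, 𝔼 c₃ ∈ D, X a b c₁ c₂ c₃ with hX'
  exact num_pet _ _ _ _ (norm_nonneg _) hZ0 h1 h2 h3

end pet
end MAC

namespace MAC
open Finset
open scoped BigOperators ComplexConjugate
set_option linter.unusedSectionVars false
set_option linter.unusedVariables false
set_option linter.unusedSimpArgs false

section cnt

lemma card_ap (L k : ℕ) (hk : 0 < k) (S : Finset ℤ) (hS : ∀ a ∈ S, -(L : ℤ) < a ∧ a < L)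
    (hc : ∀ a ∈ S, ∀ b ∈ S, (k : ℤ) ∣ a - b) : #S ≤ 2 * L / k + 1 := by
  rcases S.eq_empty_or_nonempty with rfl | hne
  · simp
  set m := S.min' hne with hm
  have hmS : m ∈ S := S.min'_mem hne
  have hkz : (0 : ℤ) < k := by exact_mod_cast hk
  rw [← card_range (2 * L / k + 1)]
  have hnn : ∀ a ∈ S, 0 ≤ (a - m) / k := fun a ha =>
    Int.ediv_nonneg (by have := S.min'_le a ha; omega) hkz.le
  refine card_le_card_of_injOn (fun a => ((a - m) / k).toNat) ?_ ?_
  · intro a ha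
    simp only [coe_range, Set.mem_Iio]
    have h1 := hnn a ha
    have h2 : (a - m) / k ≤ ((2 * L / k : ℕ) : ℤ) := by
      push_cast
      refine Int.ediv_le_ediv hkz ?_
      have := hS a ha; have := hS m hmS; omega
    omega
  · intro a ha b hb hab
    simp only at hab
    have h1 := hnn a ha
    have h2 := hnn b hb
    have h3 : (a - m) / k = (b - m) / k := by omega
    have h4 := Int.ediv_mul_cancel (hc a ha m hmS)
    have h5 := Int.ediv_mul_cancel (hc b hb m hmS)
    rw [h3, h5] at h4
    omega

variable {P : ℕ} [NeZero P]

/-- good pairs -/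
def good (P : ℕ) [NeZero P] (M : ℕ) (A : ℝ) (u v : ℤ) : Prop := ∀ n : ZMod P,
  (#{d ∈ Ioo (-(4 * M) : ℤ) (4 * M) ×ˢ Ioo (-(4 * M) : ℤ) (4 * M) |
    (2 * ((u : ZMod P) * d.1 + v * d.2) : ZMod P) = n} : ℝ) * P ≤
    A * #(Ioo (-(4 * M) : ℤ) (4 * M) ×ˢ Ioo (-(4 * M) : ℤ) (4 * M))

lemma good_avg (M : ℕ) (hM : 0 < M) (A : ℝ) (u v : ℤ) (hg : good P M A u v) (T : ZMod P → ℝ)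
    (hT : ∀ n, 0 ≤ T n) :
    𝔼 d ∈ Ioo (-(4 * M) : ℤ) (4 * M) ×ˢ Ioo (-(4 * M) : ℤ) (4 * M),
      T (2 * ((u : ZMod P) * d.1 + v * d.2)) ≤ A * 𝔼 n, T n := by
  set E := Ioo (-(4 * M) : ℤ) (4 * M) ×ˢ Ioo (-(4 * M) : ℤ) (4 * M) with hE
  have hP : 0 < (P : ℝ) := by exact_mod_cast NeZero.pos P
  have hEc : (0 : ℝ) < #E := by
    have : E.Nonempty := ⟨(0, 0), by simp [hE]; omega⟩
    exact_mod_cast card_pos.2 this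
  rw [expect_eq_sum_div_card, expect_eq_sum_div_card, card_univ, ZMod.card, div_le_iff₀ hEc]
  rw [← sum_fiberwise E (fun d : ℤ × ℤ => (2 * ((u : ZMod P) * d.1 + v * d.2) : ZMod P))]
  have : A * ((∑ n, T n) / P) * #E = ∑ n : ZMod P, A * #E / P * T n := by
    rw [← mul_sum]; ring
  rw [this]
  refine sum_le_sum fun n _ => ?_
  rw [sum_congr rfl (g := fun _ => T n) (fun d hd => by rw [(mem_filter.1 hd).2]), sum_const, nsmul_eq_mul]
  refine mul_le_mul_of_nonneg_right ?_ (hT n)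
  rw [le_div_iff₀ hP]
  exact hg n

lemma good_of (M : ℕ) (hM : 0 < M) (hP1 : M ^ 2 ≤ P) (hP2 : P ≤ 16 * M ^ 2) (η : ℝ) (hη : 0 < η) (hη1 : η ≤ 1)
    (u v : ℤ) (hu : u ∈ Ioo (-(2 * M) : ℤ) (2 * M)) (hv : v ∈ Ioo (-(2 * M) : ℤ) (2 * M)) (hvη : η * M ≤ |(v : ℝ)|)
    (hgcd : (Int.gcd u v : ℝ) ≤ 1 / η) : good P M (200 / η ^ 2) u v := by
  intro n
  have hMR : (0 : ℝ) < M := by exact_mod_cast hM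
  have hPpos : 0 < P := NeZero.pos P
  have hv0 : v ≠ 0 := by
    rintro rfl
    simp at hvη
    nlinarith
  set E := Ioo (-(4 * M) : ℤ) (4 * M) with hE
  set S := {d ∈ E ×ˢ E | (2 * ((u : ZMod P) * d.1 + v * d.2) : ZMod P) = n} with hS
  set g := Int.gcd u v with hg
  have hgpos : 0 < g := Int.gcd_pos_of_ne_zero_right _ hv0
  set k := v.natAbs / g with hk
  have hgv : g ∣ v.natAbs := Int.gcd_dvd_natAbs_right u v
  have hkg : k * g = v.natAbs := Nat.div_mul_cancel hgv
  have hkpos : 0 < k := by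
    have := Int.natAbs_pos.2 hv0
    rw [← hkg] at this
    exact Nat.pos_of_mul_pos_right this
  simp only [mem_Ioo] at hu hv
  have c1 : #(S.image fun d => 2 * (u * d.1 + v * d.2)) ≤ 65 := by
    refine (card_ap (32 * M ^ 2) P hPpos _ ?_ ?_).trans ?_
    · intro a ha
      simp only [mem_image, hS, mem_filter, mem_product, hE, mem_Ioo] at ha
      obtain ⟨d, ⟨⟨⟨h1, h2⟩, h3, h4⟩, -⟩, rfl⟩ := ha
      have a1 : |u * d.1| ≤ (2 * M) * (4 * M) := by
        rw [abs_mul]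
        exact mul_le_mul (abs_le.2 ⟨by omega, by omega⟩) (abs_le.2 ⟨by omega, by omega⟩) (abs_nonneg _) (by positivity)
      have a2 : |v * d.2| ≤ (2 * M - 1) * (4 * M) := by
        rw [abs_mul]
        exact mul_le_mul (abs_le.2 ⟨by omega, by omega⟩) (abs_le.2 ⟨by omega, by omega⟩) (abs_nonneg _) (by omega)
      have := abs_le.1 a1
      have := abs_le.1 a2
      push_cast
      constructor <;> nlinarith
    · intro a ha b hb
      simp only [mem_image, hS, mem_filter] at ha hb
      obtain ⟨d, ⟨-, h1⟩, rfl⟩ := ha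
      obtain ⟨e, ⟨-, h2⟩, rfl⟩ := hb
      rw [← ZMod.intCast_zmod_eq_zero_iff_dvd]
      push_cast
      rw [h1, h2, sub_self]
    · have : 2 * (32 * M ^ 2) / P ≤ 64 := by
        refine Nat.div_le_of_le_mul ?_
        nlinarith
      omega
  have c2 : #S ≤ (2 * (4 * M) / k + 1) * #(S.image fun d => 2 * (u * d.1 + v * d.2)) := by
    refine card_le_mul_card_image _ _ ?_
    intro m hm
    set F := S.filter (fun d => 2 * (u * d.1 + v * d.2) = m) with hF
    have hinj : #F = #(F.image Prod.fst) := by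
      refine (card_image_of_injOn ?_).symm
      intro d hd e he hde
      simp only [hF, coe_filter, Set.mem_ofPred_eq] at hd he
      have h1 := hd.2.trans he.2.symm
      rw [hde] at h1
      have h2 : v * d.2 = v * e.2 := by linarith
      exact Prod.ext hde (mul_left_cancel₀ hv0 h2)
    rw [hinj]
    refine card_ap (4 * M) k hkpos _ ?_ ?_
    · intro a ha
      simp only [mem_image, hF, hS, mem_filter, mem_product, hE, mem_Ioo] at ha
      obtain ⟨d, ⟨⟨⟨⟨h1, h2⟩, h3, h4⟩, -⟩, -⟩, rfl⟩ := ha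
      push_cast; exact ⟨h1, h2⟩
    · intro a ha b hb
      simp only [mem_image, hF, mem_filter] at ha hb
      obtain ⟨d, ⟨-, h1⟩, rfl⟩ := ha
      obtain ⟨e, ⟨-, h2⟩, rfl⟩ := hb
      have h3 : v ∣ u * (d.1 - e.1) := ⟨e.2 - d.2, by linarith⟩
      have h4 : (k : ℤ) ∣ (u / g) * (d.1 - e.1) := by
        have hgz : (g : ℤ) ≠ 0 := by exact_mod_cast hgpos.ne'
        have : (k : ℤ) * g ∣ ((u / g) * (d.1 - e.1)) * g := by
          have e1 : ((k : ℤ) * g) = v.natAbs := by exact_mod_cast hkg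
          have e2 : (u / g) * (d.1 - e.1) * g = u * (d.1 - e.1) := by
            rw [mul_right_comm, Int.ediv_mul_cancel (Int.gcd_dvd_left ..)]
          rw [e1, e2, Int.natAbs_dvd]
          exact h3
        exact (mul_dvd_mul_iff_right hgz).1 this
      refine IsCoprime.dvd_of_dvd_mul_left ?_ h4
      have h5 := Int.gcd_ediv_gcd_ediv_gcd (i := u) (j := v) hgpos
      rw [Int.isCoprime_iff_gcd_eq_one, Int.gcd_comm]
      rw [← h5]
      have : (k : ℤ).natAbs = (v / g).natAbs := by
        rw [Int.natAbs_natCast, hk, Int.natAbs_ediv_of_dvd (Int.gcd_dvd_right ..), Int.natAbs_natCast]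
      rw [Int.gcd_def, Int.gcd_def, this]
  have c3 : (#S : ℝ) ≤ 65 * (9 / η ^ 2) := by
    have h1 : ((2 * (4 * M) / k : ℕ) : ℝ) ≤ 8 / η ^ 2 := by
      refine Nat.cast_div_le.trans ?_
      have hkR : (0 : ℝ) < k := by exact_mod_cast hkpos
      have h2 : (k : ℝ) * g = |(v : ℝ)| := by
        have : ((k * g : ℕ) : ℝ) = (v.natAbs : ℝ) := by exact_mod_cast hkg
        rw [Nat.cast_natAbs, Int.cast_abs] at this
        push_cast at this; exact this
      rw [div_le_div_iff₀ hkR (by positivity)]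
      have h3 : η * (M : ℝ) ≤ k * (1 / η) := by
        calc η * (M : ℝ) ≤ |(v : ℝ)| := hvη
          _ = k * g := h2.symm
          _ ≤ _ := by gcongr
      rw [mul_one_div, le_div_iff₀ hη] at h3
      push_cast
      nlinarith
    have h2 : (#S : ℝ) ≤ (((2 * (4 * M) / k : ℕ) : ℝ) + 1) * 65 := by
      have : #S ≤ (2 * (4 * M) / k + 1) * 65 := c2.trans (by gcongr)
      exact_mod_cast this
    have h3 : (1 : ℝ) ≤ 1 / η ^ 2 := by
      rw [le_div_iff₀ (by positivity), one_mul]; exact pow_le_one₀ hη.le hη1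
    have h4 : (9 : ℝ) / η ^ 2 = 8 / η ^ 2 + 1 / η ^ 2 := by ring
    rw [h4]
    linarith
  have c4 : (49 : ℝ) * M ^ 2 ≤ #(E ×ˢ E) := by
    have : #E = 8 * M - 1 := by simp [hE]; omega
    have h7 : 7 * M ≤ #E := by omega
    rw [card_product]
    have : 49 * M ^ 2 ≤ #E * #E := by nlinarith
    exact_mod_cast this
  have hPR : (P : ℝ) ≤ 16 * M ^ 2 := by exact_mod_cast hP2
  calc (#S : ℝ) * P ≤ 65 * (9 / η ^ 2) * (16 * M ^ 2) := by gcongr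
    _ = 9360 / η ^ 2 * M ^ 2 := by ring
    _ ≤ 9800 / η ^ 2 * M ^ 2 := by gcongr; norm_num
    _ = 200 / η ^ 2 * (49 * M ^ 2) := by ring
    _ ≤ _ := by gcongr

lemma bad_count (M : ℕ) (hM : 0 < M) (hP1 : M ^ 2 ≤ P) (hP2 : P ≤ 16 * M ^ 2) (η : ℝ) (hη : 0 < η) (hη1 : η ≤ 1)
    (hηM : 1 ≤ η * M) (S : Finset (ℤ × ℤ)) (hS : ∀ p ∈ S, p.1 ∈ Ioo (-(2 * M) : ℤ) (2 * M) ∧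
      p.2 ∈ Ioo (-(2 * M) : ℤ) (2 * M) ∧ ¬ good P M (200 / η ^ 2) p.1 p.2) :
    (#S : ℝ) ≤ 100 * η * M ^ 2 := by
  classical
  have hMR : (0 : ℝ) < M := by exact_mod_cast hM
  set I := Ioo (-(2 * M) : ℤ) (2 * M) with hI
  set S₁ := I ×ˢ (I.filter fun v : ℤ => |(v : ℝ)| < η * M) with hS₁
  set k := ⌊1 / η⌋₊ with hk
  set S₂ := (Ioo k (2 * M)).biUnion fun g => (I.filter fun u => (g : ℤ) ∣ u) ×ˢ (I.filter fun u => (g : ℤ) ∣ u) with hS₂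
  have hsub : S ⊆ S₁ ∪ S₂ := by
    intro p hp
    obtain ⟨h1, h2, h3⟩ := hS p hp
    rw [mem_union]
    by_cases hv : |(p.2 : ℝ)| < η * M
    · left
      simp only [hS₁, mem_product, mem_filter]
      exact ⟨h1, h2, hv⟩
    · right
      push Not at hv
      have hg : 1 / η < (Int.gcd p.1 p.2 : ℝ) := by
        by_contra hcon
        push Not at hcon
        exact h3 (good_of M hM hP1 hP2 η hη hη1 _ _ h1 h2 hv hcon)
      have hv0 : p.2 ≠ 0 := by
        intro h0
        rw [h0] at hv
        simp at hv
        nlinarith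
      simp only [hS₂, mem_biUnion, mem_product, mem_filter, mem_Ioo]
      refine ⟨Int.gcd p.1 p.2, ⟨?_, ?_⟩, ⟨h1, Int.gcd_dvd_left ..⟩, h2, Int.gcd_dvd_right ..⟩
      · exact (Nat.floor_lt (by positivity)).2 hg
      · have : Int.gcd p.1 p.2 ≤ p.2.natAbs := Nat.le_of_dvd (Int.natAbs_pos.2 hv0) (Int.gcd_dvd_natAbs_right ..)
        simp only [hI, mem_Ioo] at h2
        omega
  have hIc : #I ≤ 4 * M := by simp [hI]; omega
  have c1 : (#S₁ : ℝ) ≤ 12 * η * M ^ 2 := by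
    rw [hS₁, card_product]
    have h1 : #(I.filter fun v : ℤ => |(v : ℝ)| < η * M) ≤ 2 * ⌊η * M⌋₊ + 1 := by
      have : I.filter (fun v : ℤ => |(v : ℝ)| < η * M) ⊆ Icc (-(⌊η * M⌋₊ : ℤ)) ⌊η * M⌋₊ := by
        intro v hv
        simp only [mem_filter] at hv
        have : v.natAbs ≤ ⌊η * M⌋₊ := by
          refine Nat.le_floor ?_
          rw [Nat.cast_natAbs, Int.cast_abs]; exact hv.2.le
        rw [mem_Icc]; omega
      refine (card_le_card this).trans ?_
      simp; omega
    have h2 : (#(I.filter fun v : ℤ => |(v : ℝ)| < η * M) : ℝ) ≤ 3 * (η * M) := by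
      have h3 : (#(I.filter fun v : ℤ => |(v : ℝ)| < η * M) : ℝ) ≤ 2 * ⌊η * M⌋₊ + 1 := by exact_mod_cast h1
      have := Nat.floor_le (show 0 ≤ η * M by positivity)
      linarith
    have h3 : (#I : ℝ) ≤ 4 * M := by exact_mod_cast hIc
    push_cast
    calc (#I : ℝ) * _ ≤ (4 * M) * (3 * (η * M)) := by gcongr
      _ = _ := by ring
  have c2 : (#S₂ : ℝ) ≤ 72 * η * M ^ 2 := by
    have h1 : (#S₂ : ℝ) ≤ ∑ g ∈ Ioo k (2 * M), 36 * M ^ 2 * ((g : ℝ) ^ 2)⁻¹ := by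
      refine le_trans (b := ((∑ g ∈ Ioo k (2 * M), #((I.filter fun u => (g : ℤ) ∣ u) ×ˢ (I.filter fun u => (g : ℤ) ∣ u)) : ℕ) : ℝ)) ?_ ?_
      · exact_mod_cast card_biUnion_le
      push_cast
      refine sum_le_sum fun g hg => ?_
      rw [mem_Ioo] at hg
      have hg0 : 0 < g := by omega
      have h2 := card_ap (2 * M) g hg0 (I.filter fun u => (g : ℤ) ∣ u) (by
        intro a ha
        simp only [hI, mem_filter, mem_Ioo] at ha
        push_cast; exact ha.1) (by
        intro a ha b hb
        simp only [mem_filter] at ha hb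
        exact dvd_sub ha.2 hb.2)
      have hgR : (0 : ℝ) < g := by exact_mod_cast hg0
      have h3 : (#(I.filter fun u => (g : ℤ) ∣ u) : ℝ) ≤ 6 * M / g := by
        have h4 : (#(I.filter fun u => (g : ℤ) ∣ u) : ℝ) ≤ ((2 * (2 * M) / g : ℕ) : ℝ) + 1 := by exact_mod_cast h2
        have h5 : ((2 * (2 * M) / g : ℕ) : ℝ) ≤ 4 * M / g := by
          refine Nat.cast_div_le.trans (le_of_eq ?_); push_cast; ring
        have h6 : (1 : ℝ) ≤ 2 * M / g := by
          rw [le_div_iff₀ hgR, one_mul]; exact_mod_cast hg.2.le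
        have h7 : (6 : ℝ) * M / g = 4 * M / g + 2 * M / g := by ring
        linarith
      rw [card_product]
      push_cast
      calc _ ≤ (6 * M / g : ℝ) * (6 * M / g) := by gcongr
        _ = _ := by field_simp; norm_num
    rw [← mul_sum] at h1
    have h2 := sum_Ioo_inv_sq_le (α := ℝ) k (2 * M)
    have h3 : (2 : ℝ) / (k + 1) ≤ 2 * η := by
      rw [div_le_iff₀ (by positivity)]
      have := (Nat.lt_floor_add_one (1 / η)).le
      have h4 : 1 ≤ ((k : ℝ) + 1) * η := by rwa [div_le_iff₀ hη] at this
      linarith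
    calc (#S₂ : ℝ) ≤ 36 * M ^ 2 * (2 * η) := h1.trans (by gcongr; exact h2.trans h3)
      _ = _ := by ring
  have : (#S : ℝ) ≤ #S₁ + #S₂ := by exact_mod_cast (card_le_card hsub).trans (card_union_le _ _)
  nlinarith [sq_nonneg (M : ℝ), mul_pos hη (pow_pos hMR 2)]

open Classical in
lemma bad_avg (M : ℕ) (hM : 0 < M) (hP1 : M ^ 2 ≤ P) (hP2 : P ≤ 16 * M ^ 2) (η : ℝ) (hη : 0 < η) (hη1 : η ≤ 1)
    (hηM : 1 ≤ η * M) (p : ℤ → ℤ → ℤ × ℤ) (hp : ∀ x y x' y', p x y = p x' y' → x = x' ∧ y = y')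
    (hpm : ∀ x ∈ Ioo (-M : ℤ) M, ∀ y ∈ Ioo (-M : ℤ) M, (p x y).1 ∈ Ioo (-(2 * M) : ℤ) (2 * M) ∧
      (p x y).2 ∈ Ioo (-(2 * M) : ℤ) (2 * M)) :
    𝔼 x ∈ Ioo (-M : ℤ) M, 𝔼 y ∈ Ioo (-M : ℤ) M,
      (if good P M (200 / η ^ 2) (p x y).1 (p x y).2 then (0 : ℝ) else 1) ≤ 100 * η := by
  have hMR : (0 : ℝ) < M := by exact_mod_cast hM
  set D := Ioo (-M : ℤ) M with hD
  have hDc : M ≤ #D := by simp [hD]; omega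
  have hDR : (M : ℝ) ≤ #D := by exact_mod_cast hDc
  rw [← expect_product' D D (fun x y => if good P M (200 / η ^ 2) (p x y).1 (p x y).2 then (0 : ℝ) else 1)]
  rw [expect_eq_sum_div_card, card_product]
  push_cast
  rw [div_le_iff₀ (by nlinarith)]
  set S := ((D ×ˢ D).filter fun z => ¬ good P M (200 / η ^ 2) (p z.1 z.2).1 (p z.1 z.2).2) with hS
  have h1 : ∑ z ∈ D ×ˢ D, (if good P M (200 / η ^ 2) (p z.1 z.2).1 (p z.1 z.2).2 then (0 : ℝ) else 1) = #S := by
    rw [hS, card_filter]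
    push_cast
    refine sum_congr rfl fun z _ => ?_
    split_ifs <;> simp_all
  rw [h1]
  have h2 := bad_count M hM hP1 hP2 η hη hη1 hηM (S.image fun z => p z.1 z.2) (by
    intro q hq
    simp only [mem_image, hS, mem_filter, mem_product] at hq
    obtain ⟨z, ⟨⟨hz1, hz2⟩, hz3⟩, rfl⟩ := hq
    exact ⟨(hpm _ hz1 _ hz2).1, (hpm _ hz1 _ hz2).2, hz3⟩)
  rw [card_image_of_injective _ (by
    rintro ⟨a, b⟩ ⟨a', b'⟩ h
    obtain ⟨h1, h2⟩ := hp _ _ _ _ h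
    simp_all)] at h2
  refine h2.trans ?_
  have : (M : ℝ) ^ 2 ≤ #D * #D := by nlinarith
  gcongr

end cnt
end MAC

namespace MAC
open Finset
open scoped BigOperators ComplexConjugate
set_option linter.unusedSectionVars false
set_option linter.unusedVariables false
set_option linter.unusedSimpArgs false

section conc
variable {P : ℕ} [NeZero P]

noncomputable def U : ℕ → ((ZMod P → ℂ) → ℝ) → (ZMod P → ℂ) → ℝ
  | 0, F, K => F K
  | s + 1, F, K => 𝔼 n, U s F (dd n K)

lemma U_mono (s : ℕ) (F F' : (ZMod P → ℂ) → ℝ) (h : ∀ K, (∀ x, ‖K x‖ ≤ 1) → F K ≤ F' K)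
    (K : ZMod P → ℂ) (hK : ∀ x, ‖K x‖ ≤ 1) : U s F K ≤ U s F' K := by
  induction s generalizing K with
  | zero => exact h K hK
  | succ s ih => exact expect_le_expect fun n _ => ih _ (dd_bdd hK)

lemma U_sq (s : ℕ) (F : (ZMod P → ℂ) → ℝ) (K : ZMod P → ℂ) :
    (U s F K) ^ 2 ≤ U s (fun K => F K ^ 2) K := by
  induction s generalizing K with
  | zero => exact le_rfl
  | succ s ih => exact (jensen_sq _ _).trans (expect_le_expect fun n _ => ih _)

lemma U_expect {ι : Type*} (S : Finset ι) (s : ℕ) (F : ι → (ZMod P → ℂ) → ℝ) (K : ZMod P → ℂ) :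
    U s (fun K => 𝔼 i ∈ S, F i K) K = 𝔼 i ∈ S, U s (F i) K := by
  induction s generalizing K with
  | zero => rfl
  | succ s ih =>
    simp only [U, ih]
    rw [expect_comm]

lemma U_U (s t : ℕ) (F : (ZMod P → ℂ) → ℝ) (K : ZMod P → ℂ) : U s (U t F) K = U (s + t) F K := by
  induction s generalizing K with
  | zero => simp [U]
  | succ s ih => rw [Nat.succ_add]; simp only [U, ih]

lemma U_affine (s : ℕ) (a b : ℝ) (F : (ZMod P → ℂ) → ℝ) (K : ZMod P → ℂ) :
    U s (fun K => a + b * F K) K = a + b * U s F K := by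
  induction s generalizing K with
  | zero => simp [U]
  | succ s ih =>
    simp only [U, ih]
    rw [expect_add_distrib, ← mul_expect, expect_const univ_nonempty]

lemma U_VV (s : ℕ) (K : ZMod P → ℂ) : U s (fun K => ‖𝔼 x, K x‖ ^ 2) K = VV s K := by
  induction s generalizing K with
  | zero => rfl
  | succ s ih => simp only [U, VV, ih]

lemma U_dd (F : (ZMod P → ℂ) → ℝ) (a : ZMod P) (K : ZMod P → ℂ) :
    U 1 F (dd a K) = U 1 (fun K => F (dd a K)) K := by
  simp only [U]
  refine expect_congr rfl fun n _ => ?_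
  rw [dd_comm]

/-- norm of mean -/
noncomputable def nm (K : ZMod P → ℂ) : ℝ := ‖𝔼 x, K x‖

lemma cs_T {ι : Type*} (J : Finset ι) (m : ι → ZMod P) (L : ZMod P → ℂ) (hL : ∀ x, ‖L x‖ ≤ 1) :
    (𝔼 j ∈ J, nm (dd (m j) L)) ^ 2 ≤ 𝔼 j ∈ J, 𝔼 j' ∈ J, nm (dd (m j - m j') L) := by
  set T : ZMod P → ℝ := fun n => nm (dd n L) with hT
  have hT0 : ∀ n, 0 ≤ T n := fun n => norm_nonneg _
  have hθ : ∀ j, ∃ c : ℂ, ‖c‖ = 1 ∧ ((T (m j) : ℝ) : ℂ) = c * 𝔼 x, dd (m j) L x :=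
    fun j => RCLike.exists_norm_eq_mul_self (K := ℂ) (𝔼 x, dd (m j) L x)
  choose θ hθ1 hθ2 using hθ
  have e1 : ((𝔼 j ∈ J, T (m j) : ℝ) : ℂ) = 𝔼 x, conj (L x) * 𝔼 j ∈ J, θ j * L (x + m j) := by
    rw [Complex.ofReal_expect]
    simp_rw [hθ2, mul_expect]
    rw [expect_comm]
    refine expect_congr rfl fun x _ => expect_congr rfl fun j _ => ?_
    simp only [dd]; ring
  have e2 : (𝔼 j ∈ J, T (m j)) ^ 2 ≤ 𝔼 x, ‖𝔼 j ∈ J, θ j * L (x + m j)‖ ^ 2 := by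
    have : 𝔼 j ∈ J, T (m j) ≤ ‖𝔼 x, conj (L x) * 𝔼 j ∈ J, θ j * L (x + m j)‖ :=
      of_real_le (expect_nonneg fun j _ => hT0 _) e1
    calc _ ≤ ‖𝔼 x, conj (L x) * 𝔼 j ∈ J, θ j * L (x + m j)‖ ^ 2 := by
          exact pow_le_pow_left₀ (expect_nonneg fun j _ => hT0 _) this 2
      _ ≤ _ := cs_bdd _ _ _ fun x _ => by simpa using hL x
  have e3 : ((𝔼 x, ‖𝔼 j ∈ J, θ j * L (x + m j)‖ ^ 2 : ℝ) : ℂ) = 𝔼 j ∈ J, 𝔼 j' ∈ J, θ j * conj (θ j') *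
      𝔼 x, dd (m j - m j') L x := by
    rw [Complex.ofReal_expect]
    simp_rw [norm_sq_expect]
    rw [expect_comm]
    refine expect_congr rfl fun j _ => ?_
    rw [expect_comm]
    refine expect_congr rfl fun j' _ => ?_
    rw [mul_expect, ← shift (fun x => θ j * conj (θ j') * dd (m j - m j') L x) (m j')]
    refine expect_congr rfl fun x _ => ?_
    simp only [dd, map_mul]
    rw [show x + m j' + (m j - m j') = x + m j by ring]
    ring
  have e4 : (𝔼 j ∈ J, T (m j)) ^ 2 ≤ 𝔼 j ∈ J, 𝔼 j' ∈ J, T (m j - m j') := by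
    refine e2.trans ((of_real_le (expect_nonneg fun x _ => by positivity) e3).trans ?_)
    refine (norm_expect_le' _ _).trans (expect_le_expect fun j _ => ?_)
    refine (norm_expect_le' _ _).trans (expect_le_expect fun j' _ => ?_)
    rw [norm_mul, norm_mul, RCLike.norm_conj, hθ1, hθ1, one_mul, one_mul]
    exact le_rfl
  exact e4

lemma one_d (M : ℕ) (hM : 0 < M) (hP1 : M ^ 2 ≤ P) (hP2 : P ≤ 16 * M ^ 2) (η : ℝ) (hη : 0 < η) (hη1 : η ≤ 1)
    (hηM : 1 ≤ η * M) (σ : ℤ) (L : ZMod P → ℂ) (hL : ∀ x, ‖L x‖ ≤ 1) :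
    (𝔼 c ∈ Ioo (-M : ℤ) M, 𝔼 d ∈ Ioo (-(4 * M) : ℤ) (4 * M),
      nm (dd (2 * c * (d + σ) : ZMod P) L)) ^ 2 ≤ 100 * η + 200 / η ^ 2 * U 1 nm L := by
  classical
  set D := Ioo (-M : ℤ) M with hD
  set E := Ioo (-(4 * M) : ℤ) (4 * M) with hE
  have hDne : D.Nonempty := ⟨0, by simp [hD]; omega⟩
  set J := D ×ˢ E with hJ
  set m : ℤ × ℤ → ZMod P := fun j => 2 * j.1 * (j.2 + σ) with hm
  set T : ZMod P → ℝ := fun n => nm (dd n L) with hT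
  have hT0 : ∀ n, 0 ≤ T n := fun n => norm_nonneg _
  have hT1 : ∀ n, T n ≤ 1 := fun n => norm_expect_le_one _ _ fun x _ => dd_bdd hL x
  have hU : U 1 nm L = 𝔼 n, T n := rfl
  have e0 : 𝔼 c ∈ D, 𝔼 d ∈ E, nm (dd (2 * c * (d + σ) : ZMod P) L) = 𝔼 j ∈ J, T (m j) := by
    rw [hJ, expect_product]
  rw [e0]
  have e4 : (𝔼 j ∈ J, T (m j)) ^ 2 ≤ 𝔼 j ∈ J, 𝔼 j' ∈ J, T (m j - m j') := cs_T J m L hL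
  refine e4.trans ?_
  have e5 : 𝔼 j ∈ J, 𝔼 j' ∈ J, T (m j - m j') = 𝔼 c ∈ D, 𝔼 c' ∈ D, 𝔼 d ∈ E ×ˢ E,
      T (2 * ((c : ZMod P) * d.1 + ((-c' : ℤ) : ZMod P) * d.2) + 2 * (c - c') * σ) := by
    rw [hJ, expect_product]
    refine expect_congr rfl fun c _ => ?_
    simp_rw [expect_product]
    rw [expect_comm]
    refine expect_congr rfl fun c' _ => ?_
    refine expect_congr rfl fun d _ => ?_
    refine expect_congr rfl fun d' _ => ?_
    congr 1
    simp only [hm]; push_cast; ring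
  rw [e5]
  have e6 : ∀ c ∈ D, ∀ c' ∈ D, 𝔼 d ∈ E ×ˢ E,
      T (2 * ((c : ZMod P) * d.1 + ((-c' : ℤ) : ZMod P) * d.2) + 2 * (c - c') * σ) ≤
      (if good P M (200 / η ^ 2) c (-c') then (0 : ℝ) else 1) + 200 / η ^ 2 * U 1 nm L := by
    intro c _ c' _
    have hUn : 0 ≤ U 1 nm L := by rw [hU]; exact expect_nonneg fun _ _ => hT0 _
    split_ifs with hgood
    · rw [zero_add, hU, ← shift T (2 * (c - c') * σ : ZMod P)]
      exact good_avg M hM _ c (-c') hgood (fun n => T (n + 2 * (c - c') * σ)) fun n => hT0 _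
    · refine (expect_le_one _ _ fun d _ => hT1 _).trans ?_
      have : 0 ≤ 200 / η ^ 2 * U 1 nm L := by positivity
      linarith
  refine (expect_le_expect fun c hc => expect_le_expect fun c' hc' => e6 c hc c' hc').trans ?_
  simp_rw [expect_add_distrib, expect_const hDne]
  refine add_le_add_left ?_ _
  refine bad_avg M hM hP1 hP2 η hη hη1 hηM (fun x y => (x, -y)) (by
    intro x y x' y' h
    simp only [Prod.mk.injEq, neg_inj] at h; exact h) (by
    intro x hx y hy
    simp only [hD, mem_Ioo] at *
    omega)

lemma Q_good (M : ℕ) (hM : 0 < M) (A : ℝ) (u v : ℤ) (hg : good P M A u v)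
    (l : ℤ × ℤ → ZMod P) (hl : ∀ d, l d = 2 * ((u : ZMod P) * d.1 + v * d.2)) (ls : List (ℤ × ℤ → ZMod P))
    (K : ZMod P → ℂ) :
    Q (Ioo (-(4 * M) : ℤ) (4 * M) ×ˢ Ioo (-(4 * M) : ℤ) (4 * M)) (l :: ls) K ≤
     A * U 1 (Q (Ioo (-(4 * M) : ℤ) (4 * M) ×ˢ Ioo (-(4 * M) : ℤ) (4 * M)) ls) K := by
  obtain rfl : l = fun d => 2 * ((u : ZMod P) * d.1 + v * d.2) := funext hl
  simp only [Q, U]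
  exact good_avg M hM A u v hg (fun n => Q _ ls (dd n K)) (fun n => Q_nonneg _ _ _)

lemma U_const_mul (s : ℕ) (b : ℝ) (F : (ZMod P → ℂ) → ℝ) (K : ZMod P → ℂ) :
    U s (fun K => b * F K) K = b * U s F K := by
  have := U_affine s 0 b F K
  simpa using this

lemma U_nonneg (s : ℕ) (F : (ZMod P → ℂ) → ℝ) (hF : ∀ K, 0 ≤ F K) (K : ZMod P → ℂ) : 0 ≤ U s F K := by
  induction s generalizing K with
  | zero => exact hF K
  | succ s ih => exact expect_nonneg fun n _ => ih _

open Classical in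
lemma Q7 (M : ℕ) (hM : 0 < M) (A : ℝ) (hA : 0 ≤ A) (c₁ c₂ c₃ : ℤ) (K : ZMod P → ℂ) (hK : ∀ x, ‖K x‖ ≤ 1) :
    Q (Ioo (-(4 * M) : ℤ) (4 * M) ×ˢ Ioo (-(4 * M) : ℤ) (4 * M)) (R7 c₁ c₂ c₃) K ≤
    (if good P M A (c₁ + c₃) (c₁ + c₂) then (0 : ℝ) else 1) + (if good P M A c₁ (c₁ + c₂) then (0 : ℝ) else 1)
    + (if good P M A (c₁ + c₃) c₁ then (0 : ℝ) else 1) + (if good P M A c₃ c₂ then (0 : ℝ) else 1)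
    + A ^ 4 * U 4 (Q (Ioo (-(4 * M) : ℤ) (4 * M) ×ˢ Ioo (-(4 * M) : ℤ) (4 * M)) (R3 c₁ c₂ c₃)) K := by
  set E2 := Ioo (-(4 * M) : ℤ) (4 * M) ×ˢ Ioo (-(4 * M) : ℤ) (4 * M) with hE2
  have hU0 : 0 ≤ A ^ 4 * U 4 (Q E2 (R3 c₁ c₂ c₃)) K :=
    mul_nonneg (by positivity) (U_nonneg _ _ (fun K => Q_nonneg _ _ _) _)
  have h1 := Q_le_one E2 (R7 c₁ c₂ c₃) K hK
  have hind : ∀ p : Prop, (0 : ℝ) ≤ if p then (0 : ℝ) else 1 := by intro p; split_ifs <;> norm_num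
  by_cases g1 : good P M A (c₁ + c₃) (c₁ + c₂)
  swap
  · have := hind (good P M A c₁ (c₁ + c₂)); have := hind (good P M A (c₁ + c₃) c₁)
    have := hind (good P M A c₃ c₂); rw [if_neg g1]; linarith
  by_cases g2 : good P M A c₁ (c₁ + c₂)
  swap
  · have := hind (good P M A (c₁ + c₃) c₁)
    have := hind (good P M A c₃ c₂); rw [if_neg g2, if_pos g1]; linarith
  by_cases g3 : good P M A (c₁ + c₃) c₁
  swap
  · have := hind (good P M A c₃ c₂); rw [if_neg g3, if_pos g1, if_pos g2]; linarith
  by_cases g4 : good P M A c₃ c₂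
  swap
  · rw [if_neg g4, if_pos g1, if_pos g2, if_pos g3]; linarith
  rw [if_pos g1, if_pos g2, if_pos g3, if_pos g4]
  simp only [zero_add]
  have s4 : ∀ K, Q E2 _ K ≤ A * U 1 (Q E2 (R3 c₁ c₂ c₃)) K := fun K =>
    Q_good M hM A c₃ c₂ g4 (fun d => 2 * ((c₃ : ℤ) * d.1 + (c₂ : ℤ) * d.2)) (fun d => rfl) _ K
  have s3 : ∀ K, Q E2 _ K ≤ A * U 1 (Q E2 _) K := fun K =>
    Q_good M hM A (c₁ + c₃) c₁ g3 (fun d => 2 * ((c₁ + c₃ : ℤ) * d.1 + (c₁ : ℤ) * d.2)) (fun d => rfl)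
      ((fun d => 2 * ((c₃ : ℤ) * d.1 + (c₂ : ℤ) * d.2)) :: R3 c₁ c₂ c₃) K
  have s2 : ∀ K, Q E2 _ K ≤ A * U 1 (Q E2 _) K := fun K =>
    Q_good M hM A c₁ (c₁ + c₂) g2 (fun d => 2 * ((c₁ : ℤ) * d.1 + (c₁ + c₂ : ℤ) * d.2)) (fun d => rfl)
      ((fun d => 2 * ((c₁ + c₃ : ℤ) * d.1 + (c₁ : ℤ) * d.2)) :: 
      (fun d => 2 * ((c₃ : ℤ) * d.1 + (c₂ : ℤ) * d.2)) :: R3 c₁ c₂ c₃) K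
  have s1 : ∀ K, Q E2 _ K ≤ A * U 1 (Q E2 _) K := fun K =>
    Q_good M hM A (c₁ + c₃) (c₁ + c₂) g1 (fun d => 2 * ((c₁ + c₃ : ℤ) * d.1 + (c₁ + c₂ : ℤ) * d.2)) (fun d => rfl)
      ((fun d => 2 * ((c₁ : ℤ) * d.1 + (c₁ + c₂ : ℤ) * d.2)) ::
        (fun d => 2 * ((c₁ + c₃ : ℤ) * d.1 + (c₁ : ℤ) * d.2)) :: 
      (fun d => 2 * ((c₃ : ℤ) * d.1 + (c₂ : ℤ) * d.2)) :: R3 c₁ c₂ c₃) K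
  refine (s1 K).trans ?_
  have t1 := U_mono 1 _ _ (fun K _ => s2 K) K hK
  have t2 := U_mono 2 _ _ (fun K _ => s3 K) K hK
  have t3 := U_mono 3 _ _ (fun K _ => s4 K) K hK
  rw [U_const_mul, U_U] at t1 t2 t3
  calc _ ≤ A * (A * (A * (A * U 4 (Q E2 (R3 c₁ c₂ c₃)) K))) := by
        refine mul_le_mul_of_nonneg_left (t1.trans ?_) hA
        refine mul_le_mul_of_nonneg_left (t2.trans ?_) hA
        refine mul_le_mul_of_nonneg_left t3 hA
    _ = _ := by ring

end conc
end MAC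

namespace MAC
open Finset
open scoped BigOperators ComplexConjugate
set_option linter.unusedSectionVars false
set_option linter.unusedVariables false
set_option linter.unusedSimpArgs false

section pone
variable {P : ℕ} [NeZero P]

noncomputable def Ap (M : ℕ) (l : ℤ × ℤ → ZMod P) (F : (ZMod P → ℂ) → ℝ) (K : ZMod P → ℂ) : ℝ :=
  𝔼 c ∈ Ioo (-M : ℤ) M, 𝔼 d ∈ Ioo (-(4 * M) : ℤ) (4 * M) ×ˢ Ioo (-(4 * M) : ℤ) (4 * M),
    F (dd (2 * c * l d) K)

lemma Ap_mono (M : ℕ) (l : ℤ × ℤ → ZMod P) (F F' : (ZMod P → ℂ) → ℝ)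
    (h : ∀ K, (∀ x, ‖K x‖ ≤ 1) → F K ≤ F' K)
    (K : ZMod P → ℂ) (hK : ∀ x, ‖K x‖ ≤ 1) : Ap M l F K ≤ Ap M l F' K :=
  expect_le_expect fun c _ => expect_le_expect fun d _ => h _ (dd_bdd hK)

lemma Ap_sq (M : ℕ) (l : ℤ × ℤ → ZMod P) (F : (ZMod P → ℂ) → ℝ) (K : ZMod P → ℂ) :
    (Ap M l F K) ^ 2 ≤ Ap M l (fun K => F K ^ 2) K :=
  (jensen_sq _ _).trans (expect_le_expect fun c _ => jensen_sq _ _)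

lemma Ap_affine (M : ℕ) (hM : 0 < M) (l : ℤ × ℤ → ZMod P) (a b : ℝ) (F : (ZMod P → ℂ) → ℝ) (K : ZMod P → ℂ) :
    Ap M l (fun K => a + b * F K) K = a + b * Ap M l F K := by
  have h1 : (Ioo (-M : ℤ) M).Nonempty := ⟨0, by simp; omega⟩
  have h2 : (Ioo (-(4 * M) : ℤ) (4 * M) ×ˢ Ioo (-(4 * M) : ℤ) (4 * M)).Nonempty := ⟨(0, 0), by simp; omega⟩
  simp only [Ap, expect_add_distrib, ← mul_expect, expect_const h1, expect_const h2]

lemma Ap_U (M : ℕ) (l : ℤ × ℤ → ZMod P) (F : (ZMod P → ℂ) → ℝ) (K : ZMod P → ℂ) :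
    Ap M l (U 1 F) K = U 1 (Ap M l F) K := by
  have : U 1 (Ap M l F) K = U 1 (fun K => 𝔼 c ∈ Ioo (-M : ℤ) M,
    𝔼 d ∈ Ioo (-(4 * M) : ℤ) (4 * M) ×ˢ Ioo (-(4 * M) : ℤ) (4 * M), F (dd (2 * c * l d) K)) K := rfl
  rw [this, U_expect]
  refine expect_congr rfl fun c _ => ?_
  rw [U_expect]
  refine expect_congr rfl fun d _ => ?_
  rw [U_dd]

lemma base_fst (M : ℕ) (hM : 0 < M) (hP1 : M ^ 2 ≤ P) (hP2 : P ≤ 16 * M ^ 2) (η : ℝ) (hη : 0 < η) (hη1 : η ≤ 1)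
    (hηM : 1 ≤ η * M) (κ : ℤ) (L : ZMod P → ℂ) (hL : ∀ x, ‖L x‖ ≤ 1) :
    (Ap M (fun d => d.1 + κ * d.2) nm L) ^ 2 ≤ 100 * η + 200 / η ^ 2 * U 1 nm L := by
  have hE : (Ioo (-(4 * M) : ℤ) (4 * M)).Nonempty := ⟨0, by simp; omega⟩
  have e : Ap M (fun d => d.1 + κ * d.2) nm L = 𝔼 s ∈ Ioo (-(4 * M) : ℤ) (4 * M), 𝔼 c ∈ Ioo (-M : ℤ) M,
      𝔼 d ∈ Ioo (-(4 * M) : ℤ) (4 * M), nm (dd (2 * c * (d + (κ * s : ℤ)) : ZMod P) L) := by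
    rw [expect_comm]
    refine expect_congr rfl fun c _ => ?_
    rw [expect_product, expect_comm]
    simp
  rw [e]
  refine (jensen_sq _ _).trans (expect_le hE fun s _ => ?_)
  exact one_d M hM hP1 hP2 η hη hη1 hηM (κ * s) L hL

lemma base_snd (M : ℕ) (hM : 0 < M) (hP1 : M ^ 2 ≤ P) (hP2 : P ≤ 16 * M ^ 2) (η : ℝ) (hη : 0 < η) (hη1 : η ≤ 1)
    (hηM : 1 ≤ η * M) (L : ZMod P → ℂ) (hL : ∀ x, ‖L x‖ ≤ 1) :
    (Ap M (fun d => d.2) nm L) ^ 2 ≤ 100 * η + 200 / η ^ 2 * U 1 nm L := by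
  have hE : (Ioo (-(4 * M) : ℤ) (4 * M)).Nonempty := ⟨0, by simp; omega⟩
  have e : Ap M (fun d => d.2) nm L = 𝔼 c ∈ Ioo (-M : ℤ) M,
      𝔼 d ∈ Ioo (-(4 * M) : ℤ) (4 * M), nm (dd (2 * c * (d + (0 : ℤ)) : ZMod P) L) := by
    refine expect_congr rfl fun c _ => ?_
    rw [expect_product]
    simp only [expect_const hE, Int.cast_zero, add_zero]
  rw [e]
  exact one_d M hM hP1 hP2 η hη hη1 hηM 0 L hL

lemma thresh (ε X Y : ℝ) (M : ℕ) (hε : 0 < ε) (hε1 : ε ≤ 1 / 2) (hM : 1 ≤ ε ^ 10 * M) (hX : ε ≤ X)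
    (h : ∀ η : ℝ, 0 < η → η ≤ 1 → 1 ≤ η * M → X ^ 2 ≤ 100 * η + 200 / η ^ 2 * Y) : ε ^ 30 ≤ Y := by
  have h2 : ∀ k : ℕ, ε ^ k * 2 ^ k ≤ 1 := fun k => by
    rw [← mul_pow]; exact pow_le_one₀ (by positivity) (by linarith)
  have hM0 : (0 : ℝ) ≤ M := by positivity
  have h1 := h (ε ^ 2 / 200) (by positivity) (by nlinarith) (by
    have := h2 8
    have h3 : ε ^ 10 * M = ε ^ 2 * M * ε ^ 8 := by ring
    have h4 : 0 ≤ ε ^ 2 * M := by positivity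
    nlinarith)
  have h5 : ε ^ 2 ≤ X ^ 2 := pow_le_pow_left₀ hε.le hX 2
  have h6 : ε ^ 2 / 2 ≤ 200 / (ε ^ 2 / 200) ^ 2 * Y := by linarith
  have h7 : ε ^ 6 ≤ 16000000 * Y := by
    have : 200 / (ε ^ 2 / 200) ^ 2 * Y = 8000000 * Y / ε ^ 4 := by field_simp; ring
    rw [this, le_div_iff₀ (by positivity)] at h6
    nlinarith
  have h8 := h2 24
  have h9 : ε ^ 30 = ε ^ 6 * ε ^ 24 := by ring
  have : 0 ≤ ε ^ 24 := by positivity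
  have h10 : ε ^ 6 * ε ^ 24 ≤ (16000000 * Y) * ε ^ 24 := by gcongr
  have hY : 0 ≤ Y := by have : 0 < ε ^ 6 := by positivity
                        linarith
  nlinarith

lemma one_step (M s : ℕ) (hM : 0 < M) (hP1 : M ^ 2 ≤ P) (hP2 : P ≤ 16 * M ^ 2) (F F' : (ZMod P → ℂ) → ℝ)
    (hF : ∀ η : ℝ, 0 < η → η ≤ 1 → 1 ≤ η * M → ∀ L : ZMod P → ℂ, (∀ x, ‖L x‖ ≤ 1) →
      F L ^ 2 ≤ 100 * η + 200 / η ^ 2 * U 1 F' L) (ε : ℝ) (hε : 0 < ε) (hε1 : ε ≤ 1 / 2) (hεM : 1 ≤ ε ^ 10 * M)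
    (h : ZMod P → ℂ) (hh : ∀ x, ‖h x‖ ≤ 1) (hX : ε ≤ U s F h) : ε ^ 30 ≤ U (s + 1) F' h := by
  refine thresh ε _ _ M hε hε1 hεM hX fun η h0 h1 h2 => ?_
  refine (U_sq _ _ _).trans ((U_mono s _ _ (fun K hK => hF η h0 h1 h2 K hK) h hh).trans ?_)
  rw [U_affine, U_U]

lemma lift_step (M : ℕ) (hM : 0 < M) (l : ℤ × ℤ → ZMod P) (F F' : (ZMod P → ℂ) → ℝ) 
    (hF : ∀ η : ℝ, 0 < η → η ≤ 1 → 1 ≤ η * M → ∀ L : ZMod P → ℂ, (∀ x, ‖L x‖ ≤ 1) →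
      F L ^ 2 ≤ 100 * η + 200 / η ^ 2 * U 1 F' L) : ∀ η : ℝ, 0 < η → η ≤ 1 → 1 ≤ η * M → ∀ L : ZMod P → ℂ, (∀ x, ‖L x‖ ≤ 1) →
      Ap M l F L ^ 2 ≤ 100 * η + 200 / η ^ 2 * U 1 (Ap M l F') L := by
  intro η h0 h1 h2 L hL
  refine (Ap_sq _ _ _ _).trans ((Ap_mono M l _ _ (fun K hK => hF η h0 h1 h2 K hK) L hL).trans ?_)
  rw [Ap_affine M hM, Ap_U]

lemma expect_R3 (M : ℕ) (K : ZMod P → ℂ) :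
    𝔼 c₁ ∈ Ioo (-M : ℤ) M, 𝔼 c₂ ∈ Ioo (-M : ℤ) M, 𝔼 c₃ ∈ Ioo (-M : ℤ) M,
      Q (Ioo (-(4 * M) : ℤ) (4 * M) ×ˢ Ioo (-(4 * M) : ℤ) (4 * M)) (R3 c₁ c₂ c₃) K =
    Ap M (fun d => d.1 + (1 : ℤ) * d.2) (Ap M (fun d => d.2) (Ap M (fun d => d.1 + (0 : ℤ) * d.2) nm)) K := by
  simp only [Ap, R3, Q, nm, Int.cast_one, one_mul, Int.cast_zero, zero_mul, add_zero]
  refine expect_congr rfl fun c₁ _ => ?_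
  have : ∀ c₂ ∈ Ioo (-M : ℤ) M, ∀ (Φ : ℤ → ℤ × ℤ → ℤ × ℤ → ℝ), 
     𝔼 c₃ ∈ Ioo (-M : ℤ) M, 𝔼 d ∈ Ioo (-(4 * M) : ℤ) (4 * M) ×ˢ Ioo (-(4 * M) : ℤ) (4 * M),
      𝔼 e ∈ Ioo (-(4 * M) : ℤ) (4 * M) ×ˢ Ioo (-(4 * M) : ℤ) (4 * M), Φ c₃ d e = 
      𝔼 d ∈ Ioo (-(4 * M) : ℤ) (4 * M) ×ˢ Ioo (-(4 * M) : ℤ) (4 * M),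
      𝔼 e ∈ Ioo (-(4 * M) : ℤ) (4 * M) ×ˢ Ioo (-(4 * M) : ℤ) (4 * M), 𝔼 c₃ ∈ Ioo (-M : ℤ) M, Φ c₃ d e := by
    intro c₂ _ Φ
    rw [expect_comm]
    refine expect_congr rfl fun d _ => ?_
    rw [expect_comm]
  rw [expect_congr rfl fun c₂ hc => this c₂ hc _, expect_comm]
  refine expect_congr rfl fun d _ => ?_
  refine expect_congr rfl fun c₂ _ => ?_
  refine expect_congr rfl fun e _ => ?_
  push_cast
  rfl

open Classical in
lemma pet3 (M : ℕ) (hM : 0 < M) (hP1 : M ^ 2 ≤ P) (hP2 : P ≤ 16 * M ^ 2) (η : ℝ) (hη : 0 < η) (hη1 : η ≤ 1)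
    (hηM : 1 ≤ η * M) (h : ZMod P → ℂ) (hh : ∀ x, ‖h x‖ ≤ 1) :
      𝔼 c₁ ∈ Ioo (-M : ℤ) M, 𝔼 c₂ ∈ Ioo (-M : ℤ) M, 𝔼 c₃ ∈ Ioo (-M : ℤ) M, 𝔼 k : ZMod P,
       Q (Ioo (-(4 * M) : ℤ) (4 * M) ×ˢ Ioo (-(4 * M) : ℤ) (4 * M)) (R7 c₁ c₂ c₃) (dd k h) ≤
      400 * η + (200 / η ^ 2) ^ 4 * U 5
      (Ap M (fun d => d.1 + (1 : ℤ) * d.2) (Ap M (fun d => d.2) (Ap M (fun d => d.1 + (0 : ℤ) * d.2) nm))) h := by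
  set D := Ioo (-M : ℤ) M with hD
  set E2 := Ioo (-(4 * M) : ℤ) (4 * M) ×ˢ Ioo (-(4 * M) : ℤ) (4 * M) with hE2
  have hDne : D.Nonempty := ⟨0, by simp [hD]; omega⟩
  set A := 200 / η ^ 2 with hA
  have hA0 : 0 ≤ A := by positivity
  have e1 : ∀ c₁ c₂ c₃ : ℤ, 𝔼 k : ZMod P, Q E2 (R7 c₁ c₂ c₃) (dd k h) ≤ 
    ((if good P M A (c₁ + c₃) (c₁ + c₂) then (0 : ℝ) else 1) + (if good P M A c₁ (c₁ + c₂) then (0 : ℝ) else 1)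
    + (if good P M A (c₁ + c₃) c₁ then (0 : ℝ) else 1) + (if good P M A c₃ c₂ then (0 : ℝ) else 1))
    + A ^ 4 * U 5 (Q E2 (R3 c₁ c₂ c₃)) h := by
    intro c₁ c₂ c₃
    refine (expect_le_expect fun k _ => Q7 M hM A hA0 c₁ c₂ c₃ (dd k h) (dd_bdd hh)).trans ?_
    rw [expect_add_distrib, expect_const univ_nonempty, ← mul_expect]
    exact le_rfl
  have hU : U 5 (Ap M (fun d => d.1 + (1 : ℤ) * d.2) (Ap M (fun d => d.2) (Ap M (fun d => d.1 + (0 : ℤ) * d.2) nm))) h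
     = 𝔼 c₁ ∈ D, 𝔼 c₂ ∈ D, 𝔼 c₃ ∈ D, U 5 (Q E2 (R3 c₁ c₂ c₃)) h := by
    rw [← funext (expect_R3 M), U_expect]
    refine expect_congr rfl fun c₁ _ => ?_
    rw [U_expect]
    refine expect_congr rfl fun c₂ _ => ?_
    rw [U_expect]
  refine (expect_le_expect fun c₁ _ => expect_le_expect fun c₂ _ => expect_le_expect fun c₃ _ => e1 c₁ c₂ c₃).trans ?_
  rw [hU]
  simp only [expect_add_distrib, ← mul_expect]
  have hb := bad_avg (P := P) M hM hP1 hP2 η hη hη1 hηM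
  have b1 : 𝔼 c₁ ∈ D, 𝔼 c₂ ∈ D, 𝔼 c₃ ∈ D, (if good P M A (c₁ + c₃) (c₁ + c₂) then (0 : ℝ) else 1) ≤ 100 * η := by
    refine expect_le hDne fun c₁ h1 => hb (fun x y => (c₁ + y, c₁ + x)) (by
      intro x y x' y' h
      simp only [Prod.mk.injEq] at h; omega) (by
      intro x hx y hy
      simp only [hD, mem_Ioo] at *
      omega)
  have b2 : 𝔼 c₁ ∈ D, 𝔼 c₂ ∈ D, 𝔼 c₃ ∈ D, (if good P M A c₁ (c₁ + c₂) then (0 : ℝ) else 1) ≤ 100 * η := by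
    simp only [expect_const hDne]
    exact hb (fun x y => (x, x + y)) (by
      intro x y x' y' h
      simp only [Prod.mk.injEq] at h; omega) (by
      intro x hx y hy
      simp only [hD, mem_Ioo] at *
      omega)
  have b3 : 𝔼 c₁ ∈ D, 𝔼 c₂ ∈ D, 𝔼 c₃ ∈ D, (if good P M A (c₁ + c₃) c₁ then (0 : ℝ) else 1) ≤ 100 * η := by
    simp only [expect_const hDne]
    exact hb (fun x y => (x + y, x)) (by
      intro x y x' y' h
      simp only [Prod.mk.injEq] at h; omega) (by
      intro x hx y hy
      simp only [hD, mem_Ioo] at *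
      omega)
  have b4 : 𝔼 c₁ ∈ D, 𝔼 c₂ ∈ D, 𝔼 c₃ ∈ D, (if good P M A c₃ c₂ then (0 : ℝ) else 1) ≤ 100 * η := by
    rw [expect_const hDne]
    exact hb (fun x y => (y, x)) (by
      intro x y x' y' h
      simp only [Prod.mk.injEq] at h; omega) (by
      intro x hx y hy
      simp only [hD, mem_Ioo] at *
      omega)
  linarith

end pone

lemma thresh0 (ε X : ℝ) (hε : 0 < ε) (hε1 : ε ≤ 1 / 2) (h : ε ≤ 400 * (ε / 800) + (200 / (ε / 800) ^ 2) ^ 4 * X) :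
    ε ^ 118 ≤ X := by
  have h2 : ∀ k : ℕ, ε ^ k * 2 ^ k ≤ 1 := fun k => by
    rw [← mul_pow]; exact pow_le_one₀ (by positivity) (by linarith)
  have h6 : ε / 2 ≤ (200 / (ε / 800) ^ 2) ^ 4 * X := by linarith
  have e : (200 / (ε / 800) ^ 2) ^ 4 * X = 128000000 ^ 4 * X / ε ^ 8 := by field_simp; ring
  rw [e, le_div_iff₀ (by positivity)] at h6
  have h7 : ε ^ 9 ≤ 2 * 128000000 ^ 4 * X := by
    have : ε ^ 9 = 2 * (ε / 2 * ε ^ 8) := by ring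
    rw [this]; linarith
  have hX : 0 ≤ X := by
    have : 0 < ε ^ 9 := by positivity
    by_contra! hc
    nlinarith
  have h8 := h2 109
  have h9 : ε ^ 118 = ε ^ 9 * ε ^ 109 := by ring
  have h10 : ε ^ 9 * ε ^ 109 ≤ (2 * 128000000 ^ 4 * X) * ε ^ 109 := by gcongr
  rw [h9]
  refine h10.trans ?_
  have : (2 * 128000000 ^ 4 * X) * ε ^ 109 ≤ X * (ε ^ 109 * 2 ^ 109) := by
    have : 0 ≤ X * ε ^ 109 := by positivity
    nlinarith
  refine this.trans ?_
  calc _ ≤ X * 1 := by gcongr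
    _ = X := mul_one X

lemma thresh1 (δ L Z : ℝ) (n : ℕ) (hδ : 0 < δ) (hδ1 : δ ≤ 1 / 2) (hL : δ ≤ L) (h : L ^ n ≤ 98 ^ n * Z) : δ ^ (8 * n) ≤ Z := by
  have h1 : δ ^ 8 ≤ δ / 98 := by
    have : δ ^ 7 ≤ (1 / 2) ^ 7 := by gcongr
    have h3 : δ ^ 8 = δ * δ ^ 7 := by ring
    rw [h3]
    nlinarith
  rw [pow_mul]
  calc _ ≤ (δ / 98) ^ n := by gcongr
    _ = δ ^ n / 98 ^ n := by rw [div_pow]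
    _ ≤ L ^ n / 98 ^ n := by gcongr
    _ ≤ Z := by rw [div_le_iff₀ (by positivity)]; linarith

theorem pOne : ∃ C : ℕ, ∀ (P : ℕ) [NeZero P] (M : ℕ), 0 < M → M ^ 2 ≤ P → P ≤ 16 * M ^ 2 →
    ∀ δ : ℝ, 0 < δ → δ ≤ 1 / 2 → 1 ≤ δ ^ C * M → ∀ f g h : ZMod P → ℂ, (∀ x, ‖f x‖ ≤ 1) → (∀ x, ‖g x‖ ≤ 1) →
    (∀ x, ‖h x‖ ≤ 1) → δ ≤ ‖Lam M f g h‖ → δ ^ C ≤ VV 8 h := by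
  obtain ⟨n, hn⟩ : ∃ n, n = 2 ^ 13 := ⟨_, rfl⟩
  refine ⟨8 * n * 118 * 30 * 30 * 30 * 2, ?_⟩
  intro P _ M hM hP1 hP2 δ hδ hδ1 hδM f g h hf hg hh hL
  have hle : ∀ k : ℕ, k ≤ 8 * n * 118 * 30 * 30 * 30 * 2 → 1 ≤ δ ^ k * M := fun k hk =>
    hδM.trans (mul_le_mul_of_nonneg_right (pow_le_pow_of_le_one hδ.le (by linarith) hk) (by positivity))
  have hn1 : 1 ≤ n := by rw [hn]; exact Nat.one_le_two_pow
  have hhalf : ∀ k : ℕ, 1 ≤ k → δ ^ k ≤ 1 / 2 := fun k hk => by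
    refine le_trans ?_ hδ1
    calc δ ^ k ≤ δ ^ 1 := pow_le_pow_of_le_one hδ.le (by linarith) hk
      _ = δ := pow_one _
  have s0 := pet2 M hM f g h hf hg hh
  rw [← hn] at s0
  have s1 := thresh1 δ _ _ n hδ hδ1 hL s0
  have s2 : δ ^ (8 * n * 118) ≤ U 5 (Ap M (fun d => d.1 + (1 : ℤ) * d.2) (Ap M (fun d => d.2) (Ap M (fun d => d.1 + (0 : ℤ) * d.2) nm))) h := by
    rw [pow_mul]
    refine thresh0 _ _ (by positivity) (hhalf _ (by omega)) (s1.trans ?_)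
    refine pet3 M hM hP1 hP2 _ (by positivity) ?_ ?_ h hh
    · have := hhalf (8 * n) (by omega); linarith
    · have h1 := hle (8 * n + 10) (by omega)
      have h2 : δ ^ 10 ≤ (1 / 2) ^ 10 := by gcongr
      have h3 : δ ^ (8 * n + 10) * M ≤ δ ^ (8 * n) * (1 / 2) ^ 10 * M := by rw [pow_add]; gcongr
      have h4 : 0 ≤ δ ^ (8 * n) * M := by positivity
      nlinarith
  have l1 := fun η h0 h1 h2 => base_fst (P := P) M hM hP1 hP2 η h0 h1 h2 0
  have l1' := fun η h0 h1 h2 => base_fst (P := P) M hM hP1 hP2 η h0 h1 h2 1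
  have l2 := fun η h0 h1 h2 => base_snd (P := P) M hM hP1 hP2 η h0 h1 h2
  have l3 := lift_step M hM (fun d => d.2) _ _ l1
  have l4 := lift_step M hM (fun d => d.1 + (1 : ℤ) * d.2) _ _ l3
  have l5 := lift_step M hM (fun d => d.1 + (1 : ℤ) * d.2) _ _ l2
  have pp : ∀ a b c : ℕ, (δ ^ a) ^ b = δ ^ (a * b) := fun a b _ => (pow_mul _ _ _).symm
  have s3 := one_step M 5 hM hP1 hP2 _ _ l4 _ (by positivity) (hhalf _ (by omega))
    (by rw [← pow_mul]; exact hle _ (by omega)) h hh s2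
  rw [← pow_mul] at s3
  have s4 := one_step M 6 hM hP1 hP2 _ _ l5 _ (by positivity) (hhalf _ (by omega))
    (by rw [← pow_mul]; exact hle _ (by omega)) h hh s3
  rw [← pow_mul] at s4
  have s5 := one_step M 7 hM hP1 hP2 _ _ l1' _ (by positivity) (hhalf _ (by omega))
    (by rw [← pow_mul]; exact hle _ (by omega)) h hh s4
  rw [← pow_mul] at s5
  have s6 := U_sq 8 nm h
  rw [show (fun K : ZMod P → ℂ => nm K ^ 2) = fun K => ‖𝔼 x, K x‖ ^ 2 from rfl, U_VV] at s6
  refine le_trans ?_ s6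
  rw [pow_mul]
  exact pow_le_pow_left₀ (by positivity) s5 2

end MAC

namespace MAC
open Finset
open scoped BigOperators ComplexConjugate
set_option linter.unusedSectionVars false
set_option linter.unusedVariables false
set_option linter.unusedSimpArgs false

lemma expect_coe {ι : Type*} (s : Finset ι) (F : ι → ℂ) : 𝔼 y : s, F y = 𝔼 y ∈ s, F y := by
  simp only [Finset.expect, Finset.sum_coe_sort, card_univ, Fintype.card_coe]

lemma box_top {X : Type} (t : ℕ) (F : (Fin t → X) → ℂ) (hF : ∀ n, ‖F n‖ ≤ 1)
    (n n' : Fin t → X) : ‖box t F n n'‖ ≤ ‖F n‖ := by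
  induction t with
  | zero => exact le_rfl
  | succ t ih =>
    simp only [box]
    refine (ih _ (fun m => ?_) _ _).trans ?_
    · rw [norm_mul, RCLike.norm_conj]
      exact mul_le_one₀ (hF _) (norm_nonneg _) (hF _)
    · rw [norm_mul, RCLike.norm_conj, Fin.cons_self_tail]
      exact mul_le_of_le_one_right (norm_nonneg _) (hF _)

section low
variable {P : ℕ} [NeZero P]

def abox {X : Type} : (t : ℕ) → ((Fin t → X) → ZMod P) → (Fin t → X) → (Fin t → X) → ZMod P
  | 0, F, n, _ => F n
  | t + 1, F, n, n' => abox t (fun m => F (Fin.cons (n 0) m) - F (Fin.cons (n' 0) m))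
      (Fin.tail n) (Fin.tail n')

lemma box_ee {X : Type} (t : ℕ) (φ : (Fin t → X) → ZMod P) (x : ZMod P) (n n' : Fin t → X) :
    box t (fun m => ee (φ m * x)) n n' = ee (abox t φ n n' * x) := by
  induction t with
  | zero => rfl
  | succ t ih =>
    simp only [box, abox]
    rw [← ih]
    congr 1
    funext m
    rw [← ee_sub, sub_mul]

lemma abox_top {X : Type} (t : ℕ) (φ : (Fin t → X) → ZMod P) (n' : Fin t → X) :
    ∃ ψ : Fin t → (Fin t → X) → ZMod P, (∀ i n v, ψ i (Function.update n i v) = ψ i n) ∧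
      ∀ n, φ n = abox t φ n n' + ∑ i, ψ i n := by
  induction t with
  | zero => exact ⟨fun i => i.elim0, fun i => i.elim0, by simp [abox]⟩
  | succ t ih =>
    choose ψ hψ hψe using fun a => ih (fun m => φ (Fin.cons a m) - φ (Fin.cons (n' 0) m)) (Fin.tail n')
    refine ⟨fun i n => Fin.cases (φ (Fin.cons (n' 0) (Fin.tail n))) (fun j => ψ (n 0) j (Fin.tail n)) i, ?_, ?_⟩
    · intro i n v
      refine Fin.cases ?_ (fun j => ?_) i
      · simp only [Fin.cases_zero, Fin.tail_update_zero]
      · simp only [Fin.cases_succ, Fin.tail_update_succ]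
        rw [Function.update_of_ne (Fin.succ_ne_zero j).symm, hψ]
    · intro n
      rw [Fin.sum_univ_succ]
      simp only [Fin.cases_zero, Fin.cases_succ, abox]
      have := hψe (n 0) (Fin.tail n)
      rw [Fin.cons_self_tail] at this
      linear_combination this

lemma fh_sq (L : ZMod P → ℂ) (r : ZMod P) :
    ((‖fh L r‖ ^ 2 : ℝ) : ℂ) = 𝔼 k, 𝔼 x, dd k L x * ee (r * k) := by
  rw [fh, norm_sq_mean]
  refine expect_congr rfl fun k _ => expect_congr rfl fun x _ => ?_
  simp only [dd, map_mul]
  have : ee (r * k) = ee (r * (x + k)) * conj (ee (r * x)) := by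
    rw [← ee_sub]; congr 1; ring
  rw [this]; ring

lemma lowC (t : ℕ) (H : ZMod P → ℂ) (hH : ∀ x, ‖H x‖ ≤ 1) (ψ : Fin t → (Fin t → ZMod P) → ZMod P)
    (hψ : ∀ i n v, ψ i (Function.update n i v) = ψ i n) (ρ : ℝ) (hρ : 0 ≤ ρ)
    (h : ρ ≤ 𝔼 n : Fin t → ZMod P, ‖fh (ds t n H) (∑ i, ψ i n)‖) : (ρ ^ 2) ^ (2 ^ t) ≤ VV t H := by
  have h1 : ρ ^ 2 ≤ 𝔼 n : Fin t → ZMod P, ‖fh (ds t n H) (∑ i, ψ i n)‖ ^ 2 :=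
    (pow_le_pow_left₀ hρ h 2).trans (jensen_sq _ _)
  have e1 : ((𝔼 n : Fin t → ZMod P, ‖fh (ds t n H) (∑ i, ψ i n)‖ ^ 2 : ℝ) : ℂ) =
      𝔼 k, 𝔼 x, 𝔼 n, ds t n (dd k H) x * ∏ i, ee (ψ i n * k) := by
    rw [Complex.ofReal_expect]
    simp_rw [fh_sq]
    rw [expect_comm]
    refine expect_congr rfl fun k _ => ?_
    rw [expect_comm]
    refine expect_congr rfl fun x _ => expect_congr rfl fun n _ => ?_
    rw [ds_dd, sum_mul]
    congr 1
    induction (univ : Finset (Fin t)) using Finset.cons_induction with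
    | empty => simp [ee_zero]
    | cons a s ha ih => rw [sum_cons, prod_cons, ee_add, ih]
  have h2 := h1.trans (of_real_le (expect_nonneg fun _ _ => by positivity) e1)
  have h3 := gowersCS (Y := ZMod P) t (fun k => dd k H) (fun k => dd_bdd hH) (fun i k x n => ee (ψ i n * k))
    (fun i k x n => (ee_norm _).le) (fun i k x n v => by rw [hψ])
  refine (pow_le_pow_left₀ (by positivity) h2 _).trans (h3.trans (le_of_eq ?_))
  have e2 : 𝔼 n : Fin t → ZMod P, 𝔼 k, 𝔼 x, ds t n (dd k H) x = ((VV t H : ℝ) : ℂ) := by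
    have := VV_ds t 0 H
    rw [zero_add] at this
    rw [this, Complex.ofReal_expect]
    refine expect_congr rfl fun n _ => ?_
    simp only [VV]
    rw [norm_sq_mean]
    simp only [ds_dd]
  rw [e2, Complex.norm_of_nonneg (VV_nonneg _ _)]

noncomputable def dual (M : ℕ) (f g : ZMod P → ℂ) (x : ZMod P) : ℂ :=
  𝔼 y ∈ Icc (1 : ℤ) M, f (x - (y : ZMod P) ^ 2) * g (x - (y : ZMod P) ^ 2 + y)

lemma dual_bdd (M : ℕ) (f g : ZMod P → ℂ) (hf : ∀ x, ‖f x‖ ≤ 1) (hg : ∀ x, ‖g x‖ ≤ 1) (x : ZMod P) :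
    ‖dual M f g x‖ ≤ 1 :=
  norm_expect_le_one _ _ fun y _ => by rw [norm_mul]; exact mul_le_one₀ (hf _) (norm_nonneg _) (hg _)

lemma lam_dual (M : ℕ) (f g h : ZMod P → ℂ) : Lam M f g h = 𝔼 x, h x * dual M f g x := by
  simp only [Lam, dual, mul_expect]
  rw [expect_comm]
  conv_rhs => rw [expect_comm]
  refine expect_congr rfl fun y _ => ?_
  rw [← shift (fun x => h x * _) ((y : ZMod P) ^ 2)]
  refine expect_congr rfl fun x _ => ?_
  simp only [add_sub_cancel_right]
  ring

lemma lam_le_one (M : ℕ) (f g h : ZMod P → ℂ) (hf : ∀ x, ‖f x‖ ≤ 1) (hg : ∀ x, ‖g x‖ ≤ 1) (hh : ∀ x, ‖h x‖ ≤ 1) :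
    ‖Lam M f g h‖ ≤ 1 :=
  norm_expect_le_one _ _ fun x _ => norm_expect_le_one _ _ fun y _ => by
    rw [norm_mul, norm_mul]
    exact mul_le_one₀ (mul_le_one₀ (hf _) (norm_nonneg _) (hg _)) (norm_nonneg _) (hh _)

lemma lowA (t M : ℕ) (f g : ZMod P → ℂ) (hf : ∀ x, ‖f x‖ ≤ 1) (hg : ∀ x, ‖g x‖ ≤ 1)
    (φ : (Fin t → ZMod P) → ZMod P) (δ : ℝ) (hδ : 0 ≤ δ)
    (h : δ ≤ 𝔼 n : Fin t → ZMod P, ‖fh (ds t n (dual M f g)) (φ n)‖ ^ 2) :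
    ∃ n' : Fin t → ZMod P, ∃ f' g' : (Fin t → ZMod P) → ZMod P → ℂ, (∀ n x, ‖f' n x‖ ≤ 1) ∧ (∀ n x, ‖g' n x‖ ≤ 1) ∧
      δ ^ (2 ^ t) ≤ 𝔼 n : Fin t → ZMod P, ‖fh (ds t n (dual M f g)) (φ n)‖ *
        ‖Lam M (f' n) (g' n) (fun x => ee (abox t φ n n' * x))‖ := by
  set H := dual M f g with hHd
  have hH : ∀ x, ‖H x‖ ≤ 1 := dual_bdd M f g hf hg
  obtain ⟨b, hb, hbi, hbe⟩ := ds_top t H hH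
  set θ : (Fin t → ZMod P) → ℂ := fun n => conj (fh (ds t n H) (φ n)) with hθ
  have hθn : ∀ n, ‖θ n‖ = ‖fh (ds t n H) (φ n)‖ := fun n => RCLike.norm_conj _
  have hθ1 : ∀ n, ‖θ n‖ ≤ 1 := fun n => by
    rw [hθn]
    exact norm_expect_le_one _ _ fun x _ => by
      rw [norm_mul, ee_norm, mul_one]; exact ds_bdd _ _ _ hH _
  have e1 : ((𝔼 n : Fin t → ZMod P, ‖fh (ds t n H) (φ n)‖ ^ 2 : ℝ) : ℂ) =
      𝔼 p : ZMod P × Icc (1 : ℤ) M, 𝔼 n, (θ n * ee (φ n * p.1) * (f (p.1 - (p.2 : ZMod P) ^ 2 + ∑ i, n i) *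
        g (p.1 - (p.2 : ZMod P) ^ 2 + p.2 + ∑ i, n i))) * ∏ i, b i p.1 n := by
    rw [Complex.ofReal_expect, ← univ_product_univ, expect_product, expect_congr rfl fun x _ => expect_comm _ _ _]
    conv_rhs => rw [expect_comm]
    refine expect_congr rfl fun n _ => ?_
    rw [← Complex.normSq_eq_norm_sq, Complex.normSq_eq_conj_mul_self]
    conv_lhs => arg 2; rw [fh]
    rw [mul_expect]
    refine expect_congr rfl fun x _ => ?_
    rw [hbe, hHd, dual, ← expect_coe (Icc (1 : ℤ) M), expect_mul, expect_mul, mul_expect]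
    refine expect_congr rfl fun y _ => ?_
    simp only [hθ]
    rw [show x - (y : ZMod P) ^ 2 + ∑ i, n i = x + ∑ i, n i - (y : ZMod P) ^ 2 by ring,
      show x - (y : ZMod P) ^ 2 + y + ∑ i, n i = x + ∑ i, n i - (y : ZMod P) ^ 2 + y by ring]
    ring
  have h2 := h.trans (of_real_le (expect_nonneg fun _ _ => by positivity) e1)
  have h3 := boxCS (X := ZMod P) (Y := ZMod P × Icc (1 : ℤ) M) t
    (fun p n => θ n * ee (φ n * p.1) * (f (p.1 - (p.2 : ZMod P) ^ 2 + ∑ i, n i) *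
        g (p.1 - (p.2 : ZMod P) ^ 2 + p.2 + ∑ i, n i))) (fun i p n => b i p.1 n)
    (fun i p n => hb _ _ _) (fun i p n v => hbi _ _ _ _)
  have h4 := (pow_le_pow_left₀ hδ h2 _).trans h3
  rw [expect_comm] at h4
  have h5 := h4.trans (norm_expect_le' _ _)
  obtain ⟨n', -, hn'⟩ := exists_le_of_le_expect univ_nonempty h5
  refine ⟨n', fun n x => box t (fun m => f (x + ∑ i, m i)) n n', fun n x => box t (fun m => g (x + ∑ i, m i)) n n',
    fun n x => box_bdd _ _ (fun m => hf _) _ _, fun n x => box_bdd _ _ (fun m => hg _) _ _, ?_⟩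
  refine hn'.trans ((norm_expect_le' _ _).trans (expect_le_expect fun n _ => ?_))
  have e2 : 𝔼 p : ZMod P × Icc (1 : ℤ) M, box t (fun n => θ n * ee (φ n * p.1) * (f (p.1 - (p.2 : ZMod P) ^ 2 + ∑ i, n i) *
        g (p.1 - (p.2 : ZMod P) ^ 2 + p.2 + ∑ i, n i))) n n' = box t θ n n' *
        Lam M (fun x => box t (fun m => f (x + ∑ i, m i)) n n') (fun x => box t (fun m => g (x + ∑ i, m i)) n n')
          (fun x => ee (abox t φ n n' * x)) := by
    rw [lam_dual]
    simp only [box_mul, box_ee]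
    rw [← univ_product_univ, expect_product, mul_expect]
    refine expect_congr rfl fun x _ => ?_
    rw [dual, ← expect_coe (Icc (1 : ℤ) M), mul_expect, mul_expect]
    refine expect_congr rfl fun y _ => ?_
    ring
  rw [e2, norm_mul]
  gcongr
  rw [← hθn]
  exact box_top t θ hθ1 n n'

end low

end MAC

namespace MAC
open Finset
open scoped BigOperators ComplexConjugate
set_option linter.unusedSectionVars false
set_option linter.unusedVariables false
set_option linter.unusedSimpArgs false

structure Reg (P M : ℕ) (δ : ℝ) (C : ℕ) : Prop where
  hp : P.Prime
  hM : 0 < M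
  h1 : M ^ 2 ≤ P
  h2 : P ≤ 16 * M ^ 2
  h0 : 0 < δ
  hh : δ ≤ 1 / 2
  hC : 1 ≤ δ ^ C * M

lemma Reg.mono {P M : ℕ} {δ : ℝ} {C : ℕ} (h : Reg P M δ C) (k : ℕ) (hk : k ≤ C) : 1 ≤ δ ^ k * M :=
  h.hC.trans (mul_le_mul_of_nonneg_right (pow_le_pow_of_le_one h.h0.le (by linarith [h.hh]) hk) (by positivity))

lemma Reg.pow {P M : ℕ} {δ : ℝ} {C : ℕ} (h : Reg P M δ C) (a b : ℕ) (ha : 1 ≤ a) (hab : a * b ≤ C) :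
    Reg P M (δ ^ a) b := by
  refine ⟨h.hp, h.hM, h.h1, h.h2, pow_pos h.h0 _, ?_, ?_⟩
  · refine le_trans ?_ h.hh
    calc δ ^ a ≤ δ ^ 1 := pow_le_pow_of_le_one h.h0.le (by linarith [h.hh]) ha
      _ = δ := pow_one _
  · rw [← pow_mul]; exact h.mono _ hab

lemma Reg.le {P M : ℕ} {δ : ℝ} {C : ℕ} (h : Reg P M δ C) {a b : ℕ} (hab : a ≤ b) : δ ^ b ≤ δ ^ a :=
  pow_le_pow_of_le_one h.h0.le (by linarith [h.hh]) hab

lemma Reg.two {P M : ℕ} {δ : ℝ} {C : ℕ} (h : Reg P M δ C) (k : ℕ) : δ ^ k * 2 ^ k ≤ 1 := by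
  rw [← mul_pow]; exact pow_le_one₀ (by have := h.h0; positivity) (by linarith [h.hh])

section maj
variable {P : ℕ} [NeZero P]

noncomputable def MJ (P : ℕ) (Q J : ℕ) : Finset (ZMod P) :=
  ((Icc 1 Q) ×ˢ (Icc (-J : ℤ) J)).image (fun p => (p.2 : ZMod P) * (p.1 : ZMod P)⁻¹)

lemma card_MJ (Q J : ℕ) : #(MJ P Q J) ≤ Q * (2 * J + 1) := by
  refine card_image_le.trans ?_
  rw [card_product, Nat.card_Icc, Int.card_Icc]
  apply le_of_eq
  congr 1
  omega

lemma mem_MJ (hp : P.Prime) (Q J q : ℕ) (j : ℤ) (r : ZMod P) (hq : 1 ≤ q) (hqQ : q ≤ Q) (hQ : Q < P)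
    (hj : |j| ≤ J) (h : (q : ZMod P) * r = j) : r ∈ MJ P Q J := by
  have := Fact.mk hp
  rw [MJ, mem_image]
  refine ⟨(q, j), ?_, ?_⟩
  · rw [mem_product, mem_Icc, mem_Icc]; exact ⟨⟨hq, hqQ⟩, abs_le.mp hj⟩
  · have : (q : ZMod P) ≠ 0 := by
      rw [Ne, ZMod.natCast_eq_zero_iff]
      intro hd
      exact absurd (Nat.le_of_dvd (by omega) hd) (by omega)
    rw [← h]; field_simp

lemma maj_set (M : ℕ) (ε : ℝ) (hR : Reg P M ε 14) : ∃ S : Finset (ZMod P), ε ^ 30 * #S ≤ 1 ∧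
    ∀ (f g : ZMod P → ℂ), (∀ x, ‖f x‖ ≤ 1) → (∀ x, ‖g x‖ ≤ 1) → ∀ r : ZMod P,
      ε ≤ ‖Lam M f g (fun x => ee (r * x))‖ → r ∈ S := by
  have hε := hR.h0
  have hMR : (0 : ℝ) < M := by exact_mod_cast hR.hM
  have hM4 : 1024 / ε ^ 4 ≤ M := by
    rw [div_le_iff₀ (by positivity)]
    have h1 := hR.hC
    have h2 := hR.two 10
    have h3 : ε ^ 14 * M = ε ^ 4 * M * ε ^ 10 := by ring
    have h4 : 0 < ε ^ 4 * M := by positivity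
    nlinarith
  refine ⟨MJ P ⌊32 / ε ^ 2⌋₊ ⌊2 ^ 15 / ε ^ 6⌋₊, ?_, ?_⟩
  · have h1 : (#(MJ P ⌊32 / ε ^ 2⌋₊ ⌊2 ^ 15 / ε ^ 6⌋₊) : ℝ) ≤ 32 / ε ^ 2 * (2 * (2 ^ 15 / ε ^ 6) + 1) := by
      calc _ ≤ ((⌊32 / ε ^ 2⌋₊ * (2 * ⌊2 ^ 15 / ε ^ 6⌋₊ + 1) : ℕ) : ℝ) := by exact_mod_cast card_MJ _ _
        _ ≤ _ := by
          push_cast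
          gcongr
          · exact Nat.floor_le (by positivity)
          · exact Nat.floor_le (by positivity)
    have h2 : 32 / ε ^ 2 * (2 * (2 ^ 15 / ε ^ 6) + 1) ≤ 2 ^ 22 / ε ^ 8 := by
      have : (1 : ℝ) ≤ 2 ^ 16 / ε ^ 6 := by
        rw [le_div_iff₀ (by positivity)]
        have := hR.two 6
        nlinarith [pow_pos hε 6]
      calc _ ≤ 32 / ε ^ 2 * (2 * (2 ^ 15 / ε ^ 6) + 2 ^ 16 / ε ^ 6) := by gcongr
        _ = _ := by field_simp; norm_num
    have h3 := hR.two 22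
    calc _ ≤ ε ^ 30 * (2 ^ 22 / ε ^ 8) := by gcongr; exact h1.trans h2
      _ = ε ^ 22 * 2 ^ 22 := by field_simp
      _ ≤ 1 := h3
  · intro f g hf hg r hr
    obtain ⟨q, j, hq, hq2, hj, he⟩ := lemW M ε hε (by linarith [hR.hh]) hM4 f g hf hg r hr
    refine mem_MJ hR.hp _ _ q j r hq (Nat.le_floor hq2) ?_ ?_ he
    · have h1 : (⌊32 / ε ^ 2⌋₊ : ℝ) < P := by
        calc (⌊32 / ε ^ 2⌋₊ : ℝ) ≤ 32 / ε ^ 2 := Nat.floor_le (by positivity)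
          _ < 1024 / ε ^ 4 := by
            rw [div_lt_div_iff₀ (by positivity) (by positivity)]
            have : ε ^ 4 ≤ ε ^ 2 := hR.le (by norm_num)
            nlinarith [pow_pos hε 2]
          _ ≤ M := hM4
          _ ≤ M ^ 2 := by 
            have : (1 : ℝ) ≤ M := by exact_mod_cast hR.hM
            nlinarith
          _ ≤ P := by exact_mod_cast hR.h1
      exact_mod_cast h1
    · have h1 : |(j : ℝ)| ≤ 2 ^ 15 / ε ^ 6 := by
        refine hj.trans ?_
        rw [div_le_div_iff₀ (by positivity) (by positivity)]
        have : (P : ℝ) ≤ 16 * M ^ 2 := by exact_mod_cast hR.h2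
        nlinarith [pow_pos hε 6]
      have h2 : j.natAbs ≤ ⌊2 ^ 15 / ε ^ 6⌋₊ := Nat.le_floor (by
        rw [Nat.cast_natAbs]; push_cast; exact h1)
      rw [Int.abs_eq_natAbs]
      exact_mod_cast h2

end maj

theorem lower (t : ℕ) : ∃ C : ℕ, 1 ≤ C ∧ ∀ (P : ℕ) [NeZero P] (M : ℕ) (δ : ℝ), Reg P M δ C →
    ∀ f g : ZMod P → ℂ, (∀ x, ‖f x‖ ≤ 1) → (∀ x, ‖g x‖ ≤ 1) → δ ≤ VV (t + 2) (dual M f g) →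
    δ ^ C ≤ VV (t + 1) (dual M f g) := by
  classical
  obtain ⟨E, hE⟩ : ∃ E : ℕ, E = 2 ^ (t + 1) := ⟨_, rfl⟩
  have hE1 : 1 ≤ E := by rw [hE]; exact Nat.one_le_two_pow
  refine ⟨(E + 1) * 64 * E, by nlinarith, ?_⟩
  intro P _ M δ hR f g hf hg hV
  set H := dual M f g with hHd
  have hH : ∀ x, ‖H x‖ ≤ 1 := dual_bdd M f g hf hg
  have hδ := hR.h0
  set ε := δ ^ (E + 1) with hε
  have hRε : Reg P M ε 14 := hR.pow _ _ (by omega) (by nlinarith)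
  have hε0 := hRε.h0
  obtain ⟨S, hS, hSm⟩ := maj_set M ε hRε
  choose φ hφ using fun n : Fin (t + 1) → ZMod P => u2_inverse (ds (t + 1) n H) (ds_bdd _ _ _ hH)
  have h1 : δ ≤ 𝔼 n : Fin (t + 1) → ZMod P, ‖fh (ds (t + 1) n H) (φ n)‖ ^ 2 := by
    have := VV_ds (t + 1) 1 H
    rw [show 1 + (t + 1) = t + 2 by omega] at this
    rw [this] at hV
    exact hV.trans (expect_le_expect fun n _ => hφ n)
  obtain ⟨n', f', g', hf', hg', h2⟩ := lowA (t + 1) M f g hf hg φ δ hδ.le h1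
  rw [← hE, ← hHd] at h2
  set w : (Fin (t + 1) → ZMod P) → ℝ := fun n => ‖fh (ds (t + 1) n H) (φ n)‖ with hw
  have hw0 : ∀ n, 0 ≤ w n := fun n => norm_nonneg _
  have hw1 : ∀ n, w n ≤ 1 := fun n => norm_expect_le_one _ _ fun x _ => by
      rw [norm_mul, ee_norm, mul_one]; exact ds_bdd _ _ _ hH _
  set Φ := fun n => abox (t + 1) φ n n' with hΦ
  have h3 : ∀ n, w n * ‖Lam M (f' n) (g' n) (fun x => ee (Φ n * x))‖ ≤
      ∑ m ∈ S, w n * (if Φ n = m then 1 else 0) + ε := by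
    intro n
    have hL1 := lam_le_one M (f' n) (g' n) (fun x => ee (Φ n * x)) (hf' n) (hg' n) (fun x => (ee_norm _).le)
    rw [← mul_sum, sum_ite_eq]
    by_cases hm : Φ n ∈ S
    · rw [if_pos hm]; nlinarith [hw0 n]
    · rw [if_neg hm]
      have : ‖Lam M (f' n) (g' n) (fun x => ee (Φ n * x))‖ < ε := by
        by_contra! hc
        exact hm (hSm _ _ (hf' n) (hg' n) _ hc)
      nlinarith [hw0 n, hw1 n, norm_nonneg (Lam M (f' n) (g' n) (fun x => ee (Φ n * x)))]
  have h4 : δ ^ E ≤ ∑ m ∈ S, 𝔼 n, w n * (if Φ n = m then 1 else 0) + ε := by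
    refine h2.trans ((expect_le_expect fun n _ => h3 n).trans ?_)
    rw [expect_add_distrib, expect_const univ_nonempty, expect_sum_comm]
  have h5 : 2 * ε ≤ δ ^ E := by
    rw [hε, pow_succ]
    nlinarith [pow_pos hδ E, hR.hh]
  have h6 : ∃ m ∈ S, ε ^ 32 ≤ 𝔼 n, w n * (if Φ n = m then 1 else 0) := by
    by_contra! hc
    have h7 : ∑ m ∈ S, 𝔼 n, w n * (if Φ n = m then 1 else 0) ≤ #S * ε ^ 32 := by
      rw [← nsmul_eq_mul]; exact sum_le_card_nsmul _ _ _ fun m hm => (hc m hm).le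
    have h8 : #S * ε ^ 32 ≤ ε ^ 2 := by
      have : #S * ε ^ 32 = (ε ^ 30 * #S) * ε ^ 2 := by ring
      rw [this]; nlinarith [pow_pos hε0 2]
    nlinarith [hRε.hh]
  obtain ⟨m, -, hm⟩ := h6
  obtain ⟨ψ, hψ, hψe⟩ := abox_top (t + 1) φ n'
  have h7 := lowC (t + 1) H hH (fun i n => (if i = 0 then m else 0) + ψ i n) (fun i n v => by rw [hψ]) (ε ^ 32)
    (by positivity) (by
      refine hm.trans (expect_le_expect fun n _ => ?_)
      split_ifs with hc
      · rw [mul_one, sum_add_distrib, sum_ite_eq' univ (0 : Fin (t + 1)), if_pos (mem_univ _), ← hc, hΦ, ← hψe]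
      · rw [mul_zero]; exact norm_nonneg _)
  rw [← hE, hε, ← pow_mul, ← pow_mul, ← pow_mul] at h7
  refine le_trans (le_of_eq ?_) h7
  congr 1
  ring

theorem lower_all (k : ℕ) : ∃ C : ℕ, 1 ≤ C ∧ ∀ (P : ℕ) [NeZero P] (M : ℕ) (δ : ℝ), Reg P M δ C →
    ∀ f g : ZMod P → ℂ, (∀ x, ‖f x‖ ≤ 1) → (∀ x, ‖g x‖ ≤ 1) → δ ≤ VV (k + 1) (dual M f g) →
    δ ^ C ≤ VV 1 (dual M f g) := by
  induction k with
  | zero => exact ⟨1, le_rfl, fun P _ M δ hR f g hf hg h => by rw [pow_one]; exact h⟩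
  | succ k ih =>
    obtain ⟨C2, hC2, h2⟩ := ih
    obtain ⟨C1, hC1, h1⟩ := lower k
    refine ⟨C1 * C2, by nlinarith, ?_⟩
    intro P _ M δ hR f g hf hg h
    have hR1 : Reg P M δ C1 := by
      have := hR.pow 1 C1 le_rfl (by nlinarith)
      rwa [pow_one] at this
    have := h2 P M (δ ^ C1) (hR.pow _ _ hC1 le_rfl) f g hf hg (h1 P M δ hR1 f g hf hg h)
    rwa [← pow_mul] at this

lemma VV_conj {P : ℕ} [NeZero P] (s : ℕ) (K : ZMod P → ℂ) : VV s (fun x => conj (K x)) = VV s K := by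
  induction s generalizing K with
  | zero =>
    simp only [VV]
    congr 1
    have : 𝔼 x, conj (K x) = conj (𝔼 x, K x) := by
      simp [Fintype.expect_eq_sum_div_card, map_div₀, map_sum]
    rw [this, RCLike.norm_conj]
  | succ s ih =>
    simp only [VV]
    refine expect_congr rfl fun n _ => ?_
    rw [← ih (dd n K)]
    congr 1
    funext x
    simp [dd]

theorem concA : ∃ C : ℕ, 1 ≤ C ∧ ∀ (P : ℕ) [NeZero P] (M : ℕ) (δ : ℝ), Reg P M δ C →
    ∀ f g h : ZMod P → ℂ, (∀ x, ‖f x‖ ≤ 1) → (∀ x, ‖g x‖ ≤ 1) → (∀ x, ‖h x‖ ≤ 1) → δ ≤ ‖Lam M f g h‖ →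
    ∃ r : ZMod P, δ ^ C ≤ ‖Lam M f g (fun x => ee (r * x))‖ := by
  obtain ⟨C1, h1⟩ := pOne
  obtain ⟨C2, hC2, h2⟩ := lower_all 7
  refine ⟨2 * (C1 + 1) * C2, by nlinarith, ?_⟩
  intro P _ M δ hR f g h hf hg hh hL
  set H := dual M f g with hHd
  have hH : ∀ x, ‖H x‖ ≤ 1 := dual_bdd M f g hf hg
  have hδ := hR.h0
  have e1 : δ ^ 2 ≤ ‖Lam M f g (fun x => conj (H x))‖ := by
    have e2 : ((𝔼 x, ‖H x‖ ^ 2 : ℝ) : ℂ) = Lam M f g (fun x => conj (H x)) := by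
      rw [lam_dual, Complex.ofReal_expect]
      refine expect_congr rfl fun x _ => ?_
      rw [← Complex.normSq_eq_norm_sq, Complex.normSq_eq_conj_mul_self]
    refine le_trans ?_ (of_real_le (expect_nonneg fun _ _ => by positivity) e2)
    rw [lam_dual] at hL
    refine (pow_le_pow_left₀ hδ.le hL 2).trans (cs_bdd _ _ _ fun x _ => hh x)
  have hR2 : Reg P M (δ ^ 2) C1 := hR.pow _ _ (by norm_num) (by nlinarith)
  have e3 := h1 P M hR.hM hR.h1 hR.h2 (δ ^ 2) hR2.h0 hR2.hh hR2.hC f g (fun x => conj (H x)) hf hg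
    (fun x => by rw [RCLike.norm_conj]; exact hH x) e1
  rw [VV_conj, ← pow_mul] at e3
  have e4 : δ ^ (2 * (C1 + 1)) ≤ VV (7 + 1) H := (hR.le (by omega)).trans e3
  have e5 := h2 P M _ (hR.pow (2 * (C1 + 1)) C2 (by omega) le_rfl) f g hf hg e4
  obtain ⟨r, hr⟩ := u2_inverse H hH
  refine ⟨r, ?_⟩
  rw [pow_mul]
  refine (e5.trans hr).trans ?_
  have e6 : Lam M f g (fun x => ee (r * x)) = fh H r := by
    rw [lam_dual, fh]
    refine expect_congr rfl fun x _ => ?_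
    ring
  have e7 : ‖fh H r‖ ≤ 1 := by rw [← e6]; exact lam_le_one _ _ _ _ hf hg fun x => (ee_norm _).le
  rw [e6]
  nlinarith [norm_nonneg (fh H r)]

end MAC

namespace MAC
open Finset
open scoped BigOperators ComplexConjugate
set_option linter.unusedSectionVars false
set_option linter.unusedVariables false
set_option linter.unusedSimpArgs false

lemma sum_Icc_int (M : ℕ) (Φ : ℤ → ℂ) : ∑ y ∈ Icc (1 : ℤ) M, Φ y = ∑ i ∈ range M, Φ (i + 1) := by
  symm
  refine sum_bij (fun i _ => (i : ℤ) + 1) ?_ ?_ ?_ ?_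
  · intro i hi; simp only [mem_range, mem_Icc] at *; omega
  · intro i _ j _ h; omega
  · intro y hy
    simp only [mem_Icc] at hy
    exact ⟨(y - 1).toNat, by simp only [mem_range]; omega, by omega⟩
  · intro i _; rfl

lemma shift_avg (M : ℕ) (hM : 0 < M) (Φ : ℤ → ℂ) (hΦ : ∀ y, ‖Φ y‖ ≤ 1) (s : ℕ) :
    ‖𝔼 y ∈ Icc (1 : ℤ) M, Φ (y + s) - 𝔼 y ∈ Icc (1 : ℤ) M, Φ y‖ ≤ 2 * s / M := by
  have hMR : (0 : ℝ) < M := by exact_mod_cast hM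
  induction s generalizing Φ with
  | zero => simp
  | succ s ih =>
    have h1 := ih (fun y => Φ (y + 1)) (fun y => hΦ _)
    have h2 : ‖𝔼 y ∈ Icc (1 : ℤ) M, Φ (y + 1) - 𝔼 y ∈ Icc (1 : ℤ) M, Φ y‖ ≤ 2 / M := by
      rw [expect_eq_sum_div_card, expect_eq_sum_div_card, sum_Icc_int, sum_Icc_int, ← sub_div, ← sum_sub_distrib]
      have := sum_range_sub (fun i : ℕ => Φ ((i : ℤ) + 1)) M
      push_cast at this
      rw [this, norm_div]
      have hc : ‖((#(Icc (1 : ℤ) M) : ℕ) : ℂ)‖ = M := by simp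
      rw [hc]
      gcongr
      refine (norm_sub_le _ _).trans ?_
      have := hΦ (M + 1); have := hΦ 1
      push_cast
      linarith
    have e : ∀ y : ℤ, Φ (y + ((s + 1 : ℕ) : ℤ)) = Φ (y + s + 1) := fun y => by push_cast; rw [add_assoc]
    simp_rw [e]
    calc _ ≤ ‖𝔼 y ∈ Icc (1 : ℤ) M, Φ (y + s + 1) - 𝔼 y ∈ Icc (1 : ℤ) M, Φ (y + 1)‖ +
          ‖𝔼 y ∈ Icc (1 : ℤ) M, Φ (y + 1) - 𝔼 y ∈ Icc (1 : ℤ) M, Φ y‖ := norm_sub_le_norm_sub_add_norm_sub _ _ _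
      _ ≤ 2 * s / M + 2 / M := add_le_add h1 h2
      _ = _ := by push_cast; ring

section three
variable {P : ℕ} [NeZero P]

/-- structured function -/
noncomputable def ph (M : ℕ) (r : ZMod P) (F : ZMod P → ℂ) (x : ZMod P) : ℂ :=
  𝔼 y ∈ Icc (1 : ℤ) M, F (x - (y : ZMod P)) * ee (r * (y : ZMod P) ^ 2)

lemma ph_bdd (M : ℕ) (r : ZMod P) (F : ZMod P → ℂ) (hF : ∀ x, ‖F x‖ ≤ 1) (x : ZMod P) : ‖ph M r F x‖ ≤ 1 :=
  norm_expect_le_one _ _ fun y _ => by rw [norm_mul, ee_norm, mul_one]; exact hF _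

lemma ph_close (M : ℕ) (hM : 0 < M) (r : ZMod P) (q : ℕ) (j : ℤ) (hq : (q : ZMod P) * r = j)
    (F : ZMod P → ℂ) (hF : ∀ x, ‖F x‖ ≤ 1) (t : ℕ) (x : ZMod P) :
    ‖ph M r F (x + q * t) - ph M r F x‖ ≤ 2 * (q * t) / M + 7 * (|(j : ℝ)| * t * (2 * M + q * t)) / P := by
  have hPR : (0 : ℝ) < P := by exact_mod_cast NeZero.pos P
  have h1 := shift_avg M hM (fun y => F (x + q * t - (y : ZMod P)) * ee (r * (y : ZMod P) ^ 2))
    (fun y => by rw [norm_mul, ee_norm, mul_one]; exact hF _) (q * t)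
  have h2 : ‖𝔼 y ∈ Icc (1 : ℤ) M, F (x + q * t - ((y + (q * t : ℕ) : ℤ) : ZMod P)) * ee (r * ((y + (q * t : ℕ) : ℤ) : ZMod P) ^ 2) - 
      ph M r F x‖ ≤ 7 * (|(j : ℝ)| * t * (2 * M + q * t)) / P := by
    rw [ph, ← expect_sub_distrib]
    refine (norm_expect_le' _ _).trans (expect_le ⟨1, by simp; omega⟩ fun y hy => ?_)
    have e1 : x + q * t - ((y + (q * t : ℕ) : ℤ) : ZMod P) = x - y := by push_cast; ring
    have e2 : r * ((y + (q * t : ℕ) : ℤ) : ZMod P) ^ 2 = r * (y : ZMod P) ^ 2 + ((j * t * (2 * y + q * t) : ℤ) : ZMod P) := by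
      push_cast
      rw [← hq]; ring
    rw [e1, e2, ee_add, show ∀ a b c : ℂ, a * (b * c) - a * b = a * b * (c - 1) by intros; ring, norm_mul, norm_mul,
      ee_norm, mul_one]
    have h3 := ee_lip (P := P) (j * t * (2 * y + q * t))
    refine (mul_le_of_le_one_left (norm_nonneg _) (hF _)).trans (h3.trans ?_)
    push_cast
    rw [abs_mul, abs_mul, Nat.abs_cast]
    simp only [mem_Icc] at hy
    have hy1 : (1 : ℝ) ≤ y := by exact_mod_cast hy.1
    have hy2 : (y : ℝ) ≤ M := by exact_mod_cast hy.2
    have : |2 * (y : ℝ) + q * t| ≤ 2 * M + q * t := by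
      rw [abs_of_nonneg (by positivity)]; linarith
    gcongr
  have h4 : ph M r F (x + q * t) = 𝔼 y ∈ Icc (1 : ℤ) M, F (x + q * t - (y : ZMod P)) * ee (r * (y : ZMod P) ^ 2) := rfl
  rw [h4]
  have h5 := norm_sub_le_norm_sub_add_norm_sub (𝔼 y ∈ Icc (1 : ℤ) M, F (x + q * t - (y : ZMod P)) * ee (r * (y : ZMod P) ^ 2))
    (𝔼 y ∈ Icc (1 : ℤ) M, F (x + q * t - ((y + (q * t : ℕ) : ℤ) : ZMod P)) * ee (r * ((y + (q * t : ℕ) : ℤ) : ZMod P) ^ 2))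
    (ph M r F x)
  rw [norm_sub_rev] at h1
  push_cast at h1 h2 h5 ⊢
  linarith

lemma stepFive (M T : ℕ) (hM : 0 < M) (hT : 0 < T) (r : ZMod P) (q : ℕ) (j : ℤ) (hq : (q : ZMod P) * r = j)
    (f F h : ZMod P → ℂ) (hf : ∀ x, ‖f x‖ ≤ 1) (hF : ∀ x, ‖F x‖ ≤ 1) (hh : ∀ x, ‖h x‖ ≤ 1) (ε err : ℝ)
    (herr : 2 * (q * T) / M + (2 * (q * T) / M + 7 * (|(j : ℝ)| * T * (2 * M + q * T)) / P) ≤ err)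
    (hL : ε ≤ ‖Lam M f (fun x => conj (ph M r F x)) h‖) :
    ∃ (y : ℤ) (F' : ZMod P → ℂ), (∀ x, ‖F' x‖ ≤ 1) ∧
      ε - err ≤ ‖𝔼 x, F' x * 𝔼 t ∈ Icc (1 : ℤ) T, h (x + ((y : ZMod P) + q * t) ^ 2)‖ := by
  set φ := ph M r F with hφ
  have hφ1 : ∀ x, ‖φ x‖ ≤ 1 := ph_bdd M r F hF
  have hTne : (Icc (1 : ℤ) T).Nonempty := ⟨1, by simp; omega⟩
  have hMne : (Icc (1 : ℤ) M).Nonempty := ⟨1, by simp; omega⟩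
  set Y : ℤ → ℂ := fun t => 𝔼 x, 𝔼 y ∈ Icc (1 : ℤ) M, f x * conj (φ (x + y)) * h (x + ((y : ZMod P) + q * t) ^ 2) with hY
  have h1 : ∀ t ∈ Icc (1 : ℤ) T, ‖Lam M f (fun x => conj (φ x)) h - Y t‖ ≤ err := by
    intro t ht
    obtain ⟨s, rfl⟩ : ∃ s : ℕ, t = s := ⟨t.toNat, by simp only [mem_Icc] at ht; omega⟩
    have hsT : (s : ℝ) ≤ T := by simp only [mem_Icc] at ht; exact_mod_cast ht.2
    refine le_trans ?_ herr
    rw [Lam, hY]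
    simp only []
    rw [← expect_sub_distrib]
    refine (norm_expect_le' _ _).trans (expect_le univ_nonempty fun x _ => ?_)
    have a1 := shift_avg M hM (fun y => f x * conj (φ (x + (y : ZMod P))) * h (x + (y : ZMod P) ^ 2))
      (fun y => by
        rw [norm_mul, norm_mul, RCLike.norm_conj]
        exact mul_le_one₀ (mul_le_one₀ (hf _) (norm_nonneg _) (hφ1 _)) (norm_nonneg _) (hh _)) (q * s)
    have a2 : ‖𝔼 y ∈ Icc (1 : ℤ) M, f x * conj (φ (x + ((y + (q * s : ℕ) : ℤ) : ZMod P))) * h (x + ((y + (q * s : ℕ) : ℤ) : ZMod P) ^ 2) -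
        𝔼 y ∈ Icc (1 : ℤ) M, f x * conj (φ (x + y)) * h (x + ((y : ZMod P) + q * (s : ℤ)) ^ 2)‖ ≤
        2 * (q * s) / M + 7 * (|(j : ℝ)| * s * (2 * M + q * s)) / P := by
      rw [← expect_sub_distrib]
      refine (norm_expect_le' _ _).trans (expect_le hMne fun y _ => ?_)
      have a3 := ph_close M hM r q j hq F hF s (x + y)
      refine le_trans ?_ a3
      have e1 : ((y + (q * s : ℕ) : ℤ) : ZMod P) = y + q * s := by push_cast; ring
      rw [e1, Int.cast_natCast, ← add_assoc, ← sub_mul, ← mul_sub, ← map_sub, norm_mul, norm_mul, RCLike.norm_conj]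
      refine (mul_le_of_le_one_right (by positivity) (hh _)).trans ?_
      exact mul_le_of_le_one_left (norm_nonneg _) (hf _)
    rw [norm_sub_rev] at a1
    refine (norm_sub_le_norm_sub_add_norm_sub _ _ _).trans ((add_le_add a1 a2).trans ?_)
    push_cast
    gcongr
  have h2 : ‖Lam M f (fun x => conj (φ x)) h - 𝔼 t ∈ Icc (1 : ℤ) T, Y t‖ ≤ err := by
    rw [← expect_const hTne (Lam M f (fun x => conj (φ x)) h), ← expect_sub_distrib]
    exact (norm_expect_le' _ _).trans (expect_le hTne h1)
  have h3 : ε - err ≤ ‖𝔼 t ∈ Icc (1 : ℤ) T, Y t‖ := by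
    have := norm_sub_norm_le (Lam M f (fun x => conj (φ x)) h) (𝔼 t ∈ Icc (1 : ℤ) T, Y t)
    linarith
  have e3 : 𝔼 t ∈ Icc (1 : ℤ) T, Y t = 𝔼 y ∈ Icc (1 : ℤ) M, 𝔼 x, (f x * conj (φ (x + y))) *
      𝔼 t ∈ Icc (1 : ℤ) T, h (x + ((y : ZMod P) + q * t) ^ 2) := by
    rw [expect_comm]
    conv_rhs => rw [expect_comm]
    refine expect_congr rfl fun x _ => ?_
    rw [expect_comm]
    refine expect_congr rfl fun y _ => ?_
    rw [mul_expect]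
  rw [e3] at h3
  obtain ⟨y, -, hy⟩ := exists_le_of_le_expect hMne (h3.trans (norm_expect_le' _ _))
  refine ⟨y, fun x => f x * conj (φ (x + y)), fun x => ?_, hy⟩
  rw [norm_mul, RCLike.norm_conj]
  exact mul_le_one₀ (hf _) (norm_nonneg _) (hφ1 _)

lemma cs_sum (a b : ZMod P → ℝ) (ha : ∑ r, a r ^ 2 ≤ 1) (hb : ∑ r, b r ^ 2 ≤ 1) : ∑ r, a r * b r ≤ 1 := by
  have : ∀ r, a r * b r ≤ (a r ^ 2 + b r ^ 2) / 2 := fun r => by nlinarith [sq_nonneg (a r - b r)]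
  calc _ ≤ ∑ r, (a r ^ 2 + b r ^ 2) / 2 := sum_le_sum fun r _ => this r
    _ = (∑ r, a r ^ 2 + ∑ r, b r ^ 2) / 2 := by rw [← sum_div, sum_add_distrib]
    _ ≤ 1 := by linarith

lemma stepSix (T : ℕ) (q : ℕ) (y : ℤ) (F h : ZMod P → ℂ) (hF : ∀ x, ‖F x‖ ≤ 1) (hh : ∀ x, ‖h x‖ ≤ 1)
    (ε ρ : ℝ) (hρ : 0 ≤ ρ) (hL : ε ≤ ‖𝔼 x, F x * 𝔼 t ∈ Icc (1 : ℤ) T, h (x + ((y : ZMod P) + q * t) ^ 2)‖) :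
    ∃ S : Finset (ZMod P), (∀ β ∈ S, ∃ f' g' : ZMod P → ℂ, (∀ x, ‖f' x‖ ≤ 1) ∧ (∀ x, ‖g' x‖ ≤ 1) ∧
      ρ ≤ ‖Lam T f' g' (fun x : ZMod P => ee (-((q : ZMod P) ^ 2 * β) * x))‖) ∧ ε - ρ ≤ ∑ β ∈ S, ‖fh h β‖ := by
  classical
  set W : ZMod P → ℂ := fun β => 𝔼 t ∈ Icc (1 : ℤ) T, ee (-(β * ((y : ZMod P) + (q : ZMod P) * (t : ZMod P)) ^ 2)) with hW
  have hW1 : ∀ β, ‖W β‖ ≤ 1 := fun β => norm_expect_le_one _ _ fun t _ => (ee_norm _).le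
  have e1 : 𝔼 x, F x * 𝔼 t ∈ Icc (1 : ℤ) T, h (x + ((y : ZMod P) + q * t) ^ 2) =
      ∑ β, fh h β * W β * fh F (-β) := by
    have : ∀ x, F x * 𝔼 t ∈ Icc (1 : ℤ) T, h (x + ((y : ZMod P) + q * t) ^ 2) = 
        ∑ β, fh h β * W β * (F x * ee (-β * x)) := by
      intro x
      have e2 : ∀ t : ℤ, h (x + ((y : ZMod P) + q * t) ^ 2) = 
         ∑ β, fh h β * (ee (-β * x) * ee (-(β * ((y : ZMod P) + (q : ZMod P) * (t : ZMod P)) ^ 2))) := by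
        intro t
        rw [fh_inv h]
        refine sum_congr rfl fun β _ => ?_
        rw [← ee_add]; congr 2; ring
      simp_rw [e2]
      rw [expect_sum_comm, mul_sum]
      refine sum_congr rfl fun β _ => ?_
      rw [← mul_expect, ← mul_expect]
      ring
    simp_rw [this]
    rw [expect_sum_comm]
    refine sum_congr rfl fun β _ => ?_
    rw [← mul_expect]; rfl
  have hFh1 : ∀ β, ‖fh F β‖ ≤ 1 := fun β => norm_expect_le_one _ _ fun x _ => by
    rw [norm_mul, ee_norm, mul_one]; exact hF _
  refine ⟨univ.filter (fun β => ρ ≤ ‖W β‖), ?_, ?_⟩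
  · intro β hβ
    rw [mem_filter] at hβ
    refine ⟨fun x : ZMod P => ee (-(-(2 * β * (y : ZMod P) * (q : ZMod P)) + -((q : ZMod P) ^ 2 * β)) * x), fun x : ZMod P => ee (-(2 * β * (y : ZMod P) * (q : ZMod P)) * x), fun x => (ee_norm _).le,
      fun x => (ee_norm _).le, ?_⟩
    have : Lam T (fun x : ZMod P => ee (-(-(2 * β * (y : ZMod P) * (q : ZMod P)) + -((q : ZMod P) ^ 2 * β)) * x)) (fun x : ZMod P => ee (-(2 * β * (y : ZMod P) * (q : ZMod P)) * x))
        (fun x : ZMod P => ee (-((q : ZMod P) ^ 2 * β) * x)) = ee (β * (y : ZMod P) ^ 2) * W β := by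
      rw [Lam]
      have : ∀ x : ZMod P, 𝔼 t ∈ Icc (1 : ℤ) T, ee (-(-(2 * β * (y : ZMod P) * (q : ZMod P)) + -((q : ZMod P) ^ 2 * β)) * x) * ee (-(2 * β * (y : ZMod P) * (q : ZMod P)) * (x + (t : ZMod P))) * 
          ee (-((q : ZMod P) ^ 2 * β) * (x + (t : ZMod P) ^ 2)) = ee (β * (y : ZMod P) ^ 2) * W β := by
        intro x
        rw [hW]
        simp only []
        rw [mul_expect]
        refine expect_congr rfl fun t _ => ?_
        rw [← ee_add, ← ee_add, ← ee_add]; congr 1; ring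
      simp only [this, expect_const univ_nonempty]
    rw [this, norm_mul, ee_norm, one_mul]
    exact hβ.2
  · rw [e1] at hL
    have h1 : ∀ β, ‖fh h β * W β * fh F (-β)‖ ≤ (if ρ ≤ ‖W β‖ then ‖fh h β‖ else 0) + 
        (if ρ ≤ ‖W β‖ then 0 else ρ * (‖fh h β‖ * ‖fh F (-β)‖)) := by
      intro β
      rw [norm_mul, norm_mul]
      split_ifs with hc
      · rw [add_zero]
        calc _ ≤ ‖fh h β‖ * 1 * 1 := by gcongr; exact hW1 _; exact hFh1 _
          _ = _ := by ring
      · push Not at hc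
        rw [zero_add, show ρ * (‖fh h β‖ * ‖fh F (-β)‖) = ‖fh h β‖ * ρ * ‖fh F (-β)‖ by ring]
        gcongr
    have h2 : ∑ β, (if ρ ≤ ‖W β‖ then 0 else ρ * (‖fh h β‖ * ‖fh F (-β)‖)) ≤ ρ := by
      have h3 : ∑ β, ‖fh h β‖ * ‖fh F (-β)‖ ≤ 1 := cs_sum _ _ (parseval_le h hh) (by
        rw [Fintype.sum_equiv (Equiv.neg (ZMod P)) (fun r => ‖fh F (-r)‖ ^ 2) (fun r => ‖fh F r‖ ^ 2) (fun _ => rfl)]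
        exact parseval_le F hF)
      calc _ ≤ ∑ β, ρ * (‖fh h β‖ * ‖fh F (-β)‖) := by
            refine sum_le_sum fun β _ => ?_
            split_ifs
            · positivity
            · exact le_rfl
        _ ≤ _ := by rw [← mul_sum]; exact mul_le_of_le_one_right hρ h3
    have h4 := hL.trans ((norm_sum_le _ _).trans (sum_le_sum fun β _ => h1 β))
    rw [sum_add_distrib] at h4
    rw [sum_filter]
    linarith

end three
end MAC

namespace MAC
open Finset
open scoped BigOperators ComplexConjugate
set_option linter.unusedSectionVars false
set_option linter.unusedVariables false
set_option linter.unusedSimpArgs false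

section fin
variable {P : ℕ} [NeZero P]

set_option maxHeartbeats 1000000 in
lemma mainEps (M : ℕ) (ε : ℝ) (hR : Reg P M ε 100) (r : ZMod P) (f F h f1 g1 : ZMod P → ℂ)
    (hf : ∀ x, ‖f x‖ ≤ 1) (hF : ∀ x, ‖F x‖ ≤ 1) (hh : ∀ x, ‖h x‖ ≤ 1)
    (hf1 : ∀ x, ‖f1 x‖ ≤ 1) (hg1 : ∀ x, ‖g1 x‖ ≤ 1)
    (hL : ε ≤ ‖Lam M f (fun x => conj (ph M r F x)) h‖)
    (hL1 : ε ≤ ‖Lam M f1 g1 (fun x => ee (r * x))‖) :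
    ∃ (β : ZMod P) (q : ℕ) (j : ℤ), 1 ≤ q ∧ ε ^ 150 * q ≤ 1 ∧ ε ^ 150 * |(j : ℝ)| ≤ 1 ∧
      (q : ZMod P) * β = j ∧ ε ^ 150 ≤ ‖fh h β‖ := by
  have hε := hR.h0
  have hε1 : ε ≤ 1 / 2 := hR.hh
  have hMR : (0 : ℝ) < M := by exact_mod_cast hR.hM
  have hPR : (0 : ℝ) < P := by exact_mod_cast NeZero.pos P
  have hP1 : (M : ℝ) ^ 2 ≤ P := by exact_mod_cast hR.h1
  have hP2 : (P : ℝ) ≤ 16 * M ^ 2 := by exact_mod_cast hR.h2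
  have hM4 : 1024 / ε ^ 4 ≤ M := by
    rw [div_le_iff₀ (by positivity)]
    have h1 := hR.mono 14 (by norm_num)
    have h2 := hR.two 10
    have h3 : ε ^ 14 * M = ε ^ 4 * M * ε ^ 10 := by ring
    have h4 : 0 < ε ^ 4 * M := by positivity
    nlinarith
  obtain ⟨q, j, hq, hq2, hj, he⟩ := lemW M ε hε (by linarith) hM4 f1 g1 hf1 hg1 r hL1
  have hqε : ε ^ 7 * q ≤ 1 := by
    have := hR.two 5
    calc ε ^ 7 * q ≤ ε ^ 7 * (32 / ε ^ 2) := by gcongr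
      _ = ε ^ 5 * 2 ^ 5 := by field_simp; norm_num
      _ ≤ 1 := this
  have hjε : ε ^ 21 * |(j : ℝ)| ≤ 1 := by
    have := hR.two 15
    calc ε ^ 21 * |(j : ℝ)| ≤ ε ^ 21 * (2048 * P / (ε ^ 6 * M ^ 2)) := by gcongr
      _ ≤ ε ^ 21 * (2048 * (16 * M ^ 2) / (ε ^ 6 * M ^ 2)) := by gcongr
      _ = ε ^ 15 * 2 ^ 15 := by field_simp; norm_num
      _ ≤ 1 := this
  set T : ℕ := ⌊ε ^ 40 * M⌋₊ with hT
  have hT1 : (T : ℝ) ≤ ε ^ 40 * M := Nat.floor_le (by positivity)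
  have hT40 := hR.mono 40 (by norm_num)
  have hT0 : 0 < T := Nat.floor_pos.2 hT40
  have hTR : (0 : ℝ) < T := by exact_mod_cast hT0
  have hT2 : ε ^ 41 * M ≤ T := by
    have h1 : ε ^ 40 * M < T + 1 := Nat.lt_floor_add_one _
    have h2 : (1 : ℝ) ≤ T := by exact_mod_cast hT0
    have h3 : ε ^ 41 * M = ε ^ 40 * M * ε := by ring
    nlinarith
  have p19 := pow_pos hε 19
  have hqT : q * T / M ≤ ε ^ 33 := by
    rw [div_le_iff₀ hMR]
    calc (q : ℝ) * T ≤ q * (ε ^ 40 * M) := by gcongr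
      _ = (ε ^ 7 * q) * (ε ^ 33 * M) := by ring
      _ ≤ 1 * (ε ^ 33 * M) := by gcongr
      _ = _ := one_mul _
  have hjT : |(j : ℝ)| * T * (2 * M + q * T) / P ≤ 3 * ε ^ 19 := by
    rw [div_le_iff₀ hPR]
    have a1 : |(j : ℝ)| * T ≤ ε ^ 19 * M := by
      calc |(j : ℝ)| * T ≤ |(j : ℝ)| * (ε ^ 40 * M) := by gcongr
        _ = (ε ^ 21 * |(j : ℝ)|) * (ε ^ 19 * M) := by ring
        _ ≤ 1 * (ε ^ 19 * M) := by gcongr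
        _ = _ := one_mul _
    have a2 : (q : ℝ) * T ≤ M := by
      rw [div_le_iff₀ hMR] at hqT
      have : ε ^ 33 ≤ 1 := pow_le_one₀ hε.le (by linarith)
      nlinarith
    calc |(j : ℝ)| * T * (2 * M + q * T) ≤ ε ^ 19 * M * (2 * M + M) := by gcongr
      _ = 3 * ε ^ 19 * M ^ 2 := by ring
      _ ≤ 3 * ε ^ 19 * P := by gcongr
  have herr : 2 * (q * T) / M + (2 * (q * T) / M + 7 * (|(j : ℝ)| * T * (2 * M + q * T)) / P) ≤ ε ^ 14 := by
    rw [mul_div_assoc 2 ((q : ℝ) * T), mul_div_assoc 7]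
    have h1 : ε ^ 33 ≤ ε ^ 19 := hR.le (by norm_num)
    have h2 : 32 * ε ^ 19 ≤ ε ^ 14 := by
      have := hR.two 5
      have h3 : ε ^ 19 = ε ^ 14 * ε ^ 5 := by ring
      nlinarith [pow_pos hε 14]
    linarith
  obtain ⟨y, F', hF', hy⟩ := stepFive M T hR.hM hT0 r q j he f F h hf hF hh ε (ε ^ 14) herr hL
  have hy2 : ε ^ 2 ≤ ε - ε ^ 14 := by
    have : ε ^ 14 ≤ ε ^ 2 := hR.le (by norm_num)
    nlinarith
  obtain ⟨S, hS, hsum⟩ := stepSix T q y F' h hF' hh (ε ^ 2) (ε ^ 3) (by positivity) (hy2.trans hy)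
  have hsum2 : ε ^ 3 ≤ ∑ β ∈ S, ‖fh h β‖ := by
    refine le_trans ?_ hsum
    nlinarith [pow_pos hε 2]
  have hT4 : 1024 / (ε ^ 3) ^ 4 ≤ T := by
    refine le_trans ?_ hT2
    rw [div_le_iff₀ (by positivity)]
    have h1 := hR.mono 63 (by norm_num)
    have h2 := hR.two 10
    have h3 : ε ^ 63 * M = ε ^ 53 * M * ε ^ 10 := by ring
    have h4 : 0 < ε ^ 53 * M := by positivity
    have h5 : ε ^ 41 * M * (ε ^ 3) ^ 4 = ε ^ 53 * M := by ring
    nlinarith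
  have e31 : ε ^ 3 ≤ 1 := pow_le_one₀ hε.le (by linarith)
  have hSβ : ∀ β ∈ S, ∃ (Q : ℕ) (j : ℤ), 1 ≤ Q ∧ ε ^ 25 * Q ≤ 1 ∧ ε ^ 115 * |(j : ℝ)| ≤ 1 ∧ (Q : ZMod P) * β = j := by
    intro β hβ
    obtain ⟨f', g', hf', hg', hL'⟩ := hS β hβ
    obtain ⟨q', j', hq', hq2', hj', he'⟩ := lemW T (ε ^ 3) (by positivity) e31 hT4 f' g' hf' hg' _ hL'
    refine ⟨q ^ 2 * q', -j', Nat.mul_pos (pow_pos hq 2) hq', ?_, ?_, ?_⟩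
    · have hqε' : ε ^ 11 * q' ≤ 1 := by
        have := hR.two 5
        calc ε ^ 11 * q' ≤ ε ^ 11 * (32 / (ε ^ 3) ^ 2) := by gcongr
          _ = ε ^ 5 * 2 ^ 5 := by field_simp; norm_num
          _ ≤ 1 := this
      calc ε ^ 25 * ((q ^ 2 * q' : ℕ) : ℝ) = (ε ^ 7 * q) ^ 2 * (ε ^ 11 * q') := by push_cast; ring
        _ ≤ 1 ^ 2 * 1 := by gcongr
        _ = 1 := by norm_num
    · have := hR.two 15
      push_cast
      rw [abs_neg]
      calc ε ^ 115 * |(j' : ℝ)| ≤ ε ^ 115 * (2048 * P / ((ε ^ 3) ^ 6 * T ^ 2)) := by gcongr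
        _ ≤ ε ^ 115 * (2048 * (16 * M ^ 2) / ((ε ^ 3) ^ 6 * (ε ^ 41 * M) ^ 2)) := by gcongr
        _ = ε ^ 15 * 2 ^ 15 := by field_simp; norm_num
        _ ≤ 1 := this
    · push_cast
      rw [← he']; ring
  have hQP : ⌊1 / ε ^ 25⌋₊ < P := by
    have h1 : (⌊1 / ε ^ 25⌋₊ : ℝ) < P := by
      calc (⌊1 / ε ^ 25⌋₊ : ℝ) ≤ 1 / ε ^ 25 := Nat.floor_le (by positivity)
        _ ≤ ε * M := by
          rw [div_le_iff₀ (by positivity)]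
          have := hR.mono 26 (by norm_num)
          linarith [show ε * M * ε ^ 25 = ε ^ 26 * M by ring]
        _ < 1 * M := mul_lt_mul_of_pos_right (by linarith) hMR
        _ = M := one_mul _
        _ ≤ M ^ 2 := by
          have : (1 : ℝ) ≤ M := by exact_mod_cast hR.hM
          rw [sq]; exact le_mul_of_one_le_left hMR.le this
        _ ≤ P := hP1
    exact_mod_cast h1
  have hSsub : S ⊆ MJ P ⌊1 / ε ^ 25⌋₊ ⌊1 / ε ^ 115⌋₊ := by
    intro β hβ
    obtain ⟨Q, j, h1, h2, h3, h4⟩ := hSβ β hβ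
    refine mem_MJ hR.hp _ _ Q j β h1 (Nat.le_floor ?_) hQP ?_ h4
    · rw [le_div_iff₀ (by positivity)]; linarith
    · have h5 : j.natAbs ≤ ⌊1 / ε ^ 115⌋₊ := Nat.le_floor (by
        rw [Nat.cast_natAbs]; push_cast; rw [le_div_iff₀ (by positivity)]; linarith)
      rw [Int.abs_eq_natAbs]
      exact_mod_cast h5
  have hcard : ε ^ 142 * #S ≤ 1 := by
    have h1 : (#S : ℝ) ≤ 1 / ε ^ 25 * (2 * (1 / ε ^ 115) + 1) := by
      calc (#S : ℝ) ≤ #(MJ P ⌊1 / ε ^ 25⌋₊ ⌊1 / ε ^ 115⌋₊) := by exact_mod_cast card_le_card hSsub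
        _ ≤ ((⌊1 / ε ^ 25⌋₊ * (2 * ⌊1 / ε ^ 115⌋₊ + 1) : ℕ) : ℝ) := by exact_mod_cast card_MJ _ _
        _ ≤ _ := by
          push_cast
          gcongr
          · exact Nat.floor_le (by positivity)
          · exact Nat.floor_le (by positivity)
    have h2 : (1 : ℝ) ≤ 1 / ε ^ 115 := by
      rw [le_div_iff₀ (by positivity), one_mul]; exact pow_le_one₀ hε.le (by linarith)
    have := hR.two 2
    calc ε ^ 142 * #S ≤ ε ^ 142 * (1 / ε ^ 25 * (2 * (1 / ε ^ 115) + 2 * (1 / ε ^ 115))) := by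
          gcongr; refine h1.trans ?_; gcongr; linarith
      _ = ε ^ 2 * 2 ^ 2 := by field_simp; norm_num
      _ ≤ 1 := this
  obtain ⟨β, hβ, hβ2⟩ : ∃ β ∈ S, ε ^ 146 ≤ ‖fh h β‖ := by
    by_contra hcon
    push Not at hcon
    have h1 : ∑ β ∈ S, ‖fh h β‖ ≤ ∑ β ∈ S, ε ^ 146 := sum_le_sum fun β hβ => (hcon β hβ).le
    rw [sum_const, nsmul_eq_mul] at h1
    have h2 : (#S : ℝ) * ε ^ 146 = (ε ^ 142 * #S) * ε ^ 4 := by ring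
    have h3 : (ε ^ 142 * #S) * ε ^ 4 ≤ 1 * ε ^ 4 := by gcongr
    have h4 : ε ^ 4 < ε ^ 3 := pow_lt_pow_right_of_lt_one₀ hε (by linarith) (by norm_num)
    linarith
  obtain ⟨Q, j, h1, h2, h3, h4⟩ := hSβ β hβ
  refine ⟨β, Q, j, h1, ?_, ?_, h4, (hR.le (by norm_num)).trans hβ2⟩
  · exact le_trans (mul_le_mul_of_nonneg_right (hR.le (by norm_num)) (by positivity)) h2
  · exact le_trans (mul_le_mul_of_nonneg_right (hR.le (by norm_num)) (by positivity)) h3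

/-- second dual -/
noncomputable def dualG (M : ℕ) (f h : ZMod P → ℂ) (x : ZMod P) : ℂ :=
  𝔼 y ∈ Icc (1 : ℤ) M, f (x - (y : ZMod P)) * h (x - (y : ZMod P) + (y : ZMod P) ^ 2)

lemma dualG_bdd (M : ℕ) (f h : ZMod P → ℂ) (hf : ∀ x, ‖f x‖ ≤ 1) (hg : ∀ x, ‖h x‖ ≤ 1) (x : ZMod P) :
    ‖dualG M f h x‖ ≤ 1 :=
  norm_expect_le_one _ _ fun y _ => by rw [norm_mul]; exact mul_le_one₀ (hf _) (norm_nonneg _) (hg _)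

lemma lam_dualG (M : ℕ) (f g h : ZMod P → ℂ) : Lam M f g h = 𝔼 x, g x * dualG M f h x := by
  simp only [Lam, dualG, mul_expect]
  rw [expect_comm]
  conv_rhs => rw [expect_comm]
  refine expect_congr rfl fun y _ => ?_
  rw [← shift (fun x => g x * _) ((y : ZMod P))]
  refine expect_congr rfl fun x _ => ?_
  simp only [add_sub_cancel_right]
  ring

lemma dualG_ee (M : ℕ) (f : ZMod P → ℂ) (r x : ZMod P) :
    dualG M f (fun x => ee (r * x)) x = ph M r (fun z => f z * ee (r * z)) x := by
  rw [dualG, ph]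
  refine expect_congr rfl fun y _ => ?_
  rw [mul_add, ee_add]; ring

end fin

theorem final : ∃ C : ℕ, 1 ≤ C ∧ ∀ (P : ℕ) [NeZero P] (M : ℕ) (δ : ℝ), Reg P M δ C →
    ∀ f g h : ZMod P → ℂ, (∀ x, ‖f x‖ ≤ 1) → (∀ x, ‖g x‖ ≤ 1) → (∀ x, ‖h x‖ ≤ 1) → δ ≤ ‖Lam M f g h‖ →
    ∃ (β : ZMod P) (q : ℕ) (j : ℤ), 1 ≤ q ∧ δ ^ C * q ≤ 1 ∧ δ ^ C * |(j : ℝ)| ≤ 1 ∧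
      (q : ZMod P) * β = j ∧ δ ^ C ≤ ‖fh h β‖ := by
  obtain ⟨A, hA1, hA⟩ := concA
  refine ⟨300 * A, by omega, ?_⟩
  intro P _ M δ hR f g h hf hg hh hL
  have hδ := hR.h0
  set D := dualG M f h with hD
  have hD1 : ∀ x, ‖D x‖ ≤ 1 := dualG_bdd M f h hf hh
  have hcD1 : ∀ x, ‖(fun x => conj (D x)) x‖ ≤ 1 := fun x => by simp only [RCLike.norm_conj]; exact hD1 x
  have h1 : δ ^ 2 ≤ ‖Lam M f (fun x => conj (D x)) h‖ := by
    rw [lam_dualG] at hL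
    have a1 := cs_bdd univ g D (fun i _ => hg i)
    have a2 : δ ^ 2 ≤ 𝔼 x, ‖D x‖ ^ 2 := (pow_le_pow_left₀ hδ.le hL 2).trans a1
    refine a2.trans (of_real_le (expect_nonneg fun i _ => by positivity) ?_)
    rw [lam_dualG, ← hD]
    rw [Complex.ofReal_expect]
    refine expect_congr rfl fun x _ => ?_
    rw [Complex.conj_mul']
    push_cast; rfl
  obtain ⟨r, hr⟩ := hA P M (δ ^ 2) (hR.pow 2 A (by norm_num) (by omega)) f _ h hf hcD1 hh h1
  rw [← pow_mul] at hr
  have hRε : Reg P M (δ ^ (2 * A)) 100 := hR.pow _ _ (by omega) (by omega)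
  have hF : ∀ z, ‖f z * ee (r * z)‖ ≤ 1 := fun z => by rw [norm_mul, ee_norm, mul_one]; exact hf z
  have h2 : δ ^ (2 * A) ≤ ‖Lam M f (fun x => conj (ph M r (fun z => f z * ee (r * z)) x)) h‖ := by
    refine hr.trans (le_of_eq ?_)
    rw [lam_dualG, lam_dualG, ← RCLike.norm_conj]
    congr 1
    rw [map_expect]
    refine expect_congr rfl fun x _ => ?_
    rw [dualG_ee, map_mul, Complex.conj_conj, ← hD]
    ring
  have h3 := mainEps M (δ ^ (2 * A)) hRε r f _ h f _ hf hF hh hf hcD1 h2 hr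
  rw [← pow_mul, show 2 * A * 150 = 300 * A by ring] at h3
  exact h3

end MAC

namespace MAC
open Finset
open scoped BigOperators ComplexConjugate
set_option linter.unusedSectionVars false
set_option linter.unusedVariables false
set_option linter.unusedSimpArgs false

section asm
variable {P : ℕ} [NeZero P]

lemma val_cast_int (x : ℤ) (h0 : 0 ≤ x) (h1 : x < P) : (((x : ZMod P).val : ℕ) : ℤ) = x := by
  rw [ZMod.val_intCast, Int.emod_eq_of_lt h0 h1]

lemma sum_zmod (N : ℕ) (hN : N < P) (Φ : ZMod P → ℂ) (hΦ : ∀ z : ZMod P, ((z.val : ℕ) : ℤ) ∉ Icc (1 : ℤ) N → Φ z = 0) :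
    ∑ z, Φ z = ∑ x ∈ Icc (1 : ℤ) N, Φ (x : ZMod P) := by
  classical
  rw [← sum_filter_of_ne (s := univ) (p := fun z : ZMod P => ((z.val : ℕ) : ℤ) ∈ Icc (1 : ℤ) N)
    (fun z _ hz => by by_contra hc; exact hz (hΦ z hc))]
  refine sum_bij (fun z _ => ((z.val : ℕ) : ℤ)) ?_ ?_ ?_ ?_
  · intro z hz; exact (mem_filter.1 hz).2
  · intro a _ b _ h
    exact ZMod.val_injective P (by exact_mod_cast h)
  · intro x hx
    have hx' := mem_Icc.1 hx
    have := val_cast_int (P := P) x (by omega) (by omega)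
    exact ⟨(x : ZMod P), mem_filter.2 ⟨mem_univ _, by rw [this]; exact hx⟩, this⟩
  · intro z _
    congr 1
    simp

lemma lam_eq (N M : ℕ) (hM : 0 < M) (hMN : M ^ 2 ≤ N) (hNP : 2 * N < P) (f g h : ℤ → ℂ)
    (hf : ∀ x, f x ≠ 0 → x ∈ Icc (1 : ℤ) N) :
    ∑ x ∈ Icc (1 : ℤ) N, ∑ y ∈ Icc (1 : ℤ) M, f x * g (x + y) * h (x + y ^ 2) =
      P * M * Lam M (fun z : ZMod P => f z.val) (fun z => g z.val) (fun z => h z.val) := by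
  have hMC : (M : ℂ) ≠ 0 := by exact_mod_cast hM.ne'
  have hPC : (P : ℂ) ≠ 0 := by exact_mod_cast NeZero.ne P
  rw [Lam, expect_eq_sum_div_card, sum_zmod N (by omega)]
  · simp only [expect_eq_sum_div_card, ← sum_div, card_univ, ZMod.card, Int.card_Icc, add_sub_cancel_right, Int.toNat_natCast]
    rw [div_div, mul_comm (M : ℂ), mul_div_cancel₀ _ (mul_ne_zero hPC hMC)]
    refine sum_congr rfl fun x hx => sum_congr rfl fun y hy => ?_
    rw [mem_Icc] at hx hy
    have hN2 : ((M : ℤ)) ^ 2 ≤ N := by exact_mod_cast hMN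
    have hy2 : y ^ 2 ≤ M ^ 2 := by nlinarith
    have hy3 : y ≤ y ^ 2 := by nlinarith
    have hP2 : 2 * (N : ℤ) < P := by exact_mod_cast hNP
    rw [← Int.cast_add, ← Int.cast_pow, ← Int.cast_add, val_cast_int x (by omega) (by omega),
      val_cast_int (x + y) (by omega) (by omega), val_cast_int (x + y ^ 2) (by omega) (by omega)]
  · intro z hz
    have : f z.val = 0 := by by_contra hc; exact hz (hf _ hc)
    simp only [this, zero_mul, expect_const_zero]

lemma fh_eq (N : ℕ) (hNP : 2 * N < P) (h : ℤ → ℂ) (hh : ∀ x, h x ≠ 0 → x ∈ Icc (1 : ℤ) N) (β : ZMod P) :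
    ∑ x ∈ Icc (1 : ℤ) N, h x * Complex.exp (2 * (Real.pi : ℂ) * Complex.I * (((β.val : ℝ) / P : ℝ) : ℂ) * (x : ℂ)) =
      P * fh (fun z : ZMod P => h z.val) β := by
  have hPC : (P : ℂ) ≠ 0 := by exact_mod_cast NeZero.ne P
  rw [fh, expect_eq_sum_div_card, sum_zmod N (by omega)]
  · simp only [card_univ, ZMod.card]
    rw [mul_div_cancel₀ _ hPC]
    refine sum_congr rfl fun x hx => ?_
    rw [mem_Icc] at hx
    have hP2 : 2 * (N : ℤ) < P := by exact_mod_cast hNP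
    rw [val_cast_int x (by omega) (by omega)]
    congr 1
    have : β * (x : ZMod P) = (((β.val : ℤ) * x : ℤ) : ZMod P) := by simp
    rw [this, ee_int]
    congr 1
    push_cast
    ring
  · intro z hz
    have : h z.val = 0 := by by_contra hc; exact hz (hh _ hc)
    simp only [this, zero_mul]

lemma round_bound (β : ZMod P) (q : ℕ) (j : ℤ) (h : (q : ZMod P) * β = j) :
    |(q : ℝ) * ((β.val : ℝ) / P) - ((round ((q : ℝ) * ((β.val : ℝ) / P)) : ℤ) : ℝ)| ≤ |(j : ℝ)| / P := by
  have hPR : (0 : ℝ) < P := by exact_mod_cast NeZero.pos P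
  have h1 : (((q : ℤ) * (β.val : ℤ) - j : ℤ) : ZMod P) = 0 := by
    push_cast; rw [ZMod.natCast_zmod_val, h, sub_self]
  rw [ZMod.intCast_zmod_eq_zero_iff_dvd] at h1
  obtain ⟨m, hm⟩ := h1
  have hm' : (q : ℝ) * β.val - j = P * m := by exact_mod_cast hm
  refine (round_le _ m).trans (le_of_eq ?_)
  rw [show (q : ℝ) * ((β.val : ℝ) / P) - m = j / P by field_simp; linarith, abs_div, abs_of_pos hPR]

end asm

lemma trunc (N M : ℕ) (hM : M = Nat.sqrt N) (f g h : ℤ → ℂ) (hh : ∀ x, h x ≠ 0 → x ∈ Icc (1 : ℤ) N) :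
    ∑ x ∈ Icc (1 : ℤ) N, ∑ y ∈ Icc (1 : ℤ) N, f x * g (x + y) * h (x + y ^ 2) =
    ∑ x ∈ Icc (1 : ℤ) N, ∑ y ∈ Icc (1 : ℤ) M, f x * g (x + y) * h (x + y ^ 2) := by
  refine sum_congr rfl fun x hx => ?_
  symm
  have hMN : M ≤ N := hM ▸ Nat.sqrt_le_self N
  refine sum_subset (Icc_subset_Icc_right (by exact_mod_cast hMN)) fun y hy hy2 => ?_
  rw [mem_Icc] at hx hy hy2
  have h1 : N < (M + 1) ^ 2 := by rw [hM]; exact Nat.lt_succ_sqrt' N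
  have h2 : (N : ℤ) < (M + 1) ^ 2 := by exact_mod_cast h1
  have h3 : (M : ℤ) + 1 ≤ y := by omega
  have h4 : h (x + y ^ 2) = 0 := by
    by_contra hc
    have := mem_Icc.1 (hh _ hc)
    nlinarith
  rw [h4, mul_zero]

end MAC

/-- **Major-arc control for the nonlinear Roth counting operator.**
Since `f`, `g`, `h` are supported in `[N] = {1, …, N}`, the double sum
`∑_{x ∈ ℤ} ∑_{y ∈ ℕ} f(x) g(x+y) h(x+y²)` equals the finite sum over
`x ∈ [N]`, `y ∈ [N]` appearing below.  Here `e(θ) = exp(2πiθ)` and the distance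
of `θ` to the nearest integer is `|θ - round θ|`. -/
theorem major_arc_control :
    ∃ C c : ℝ, 0 < C ∧ 0 < c ∧
      ∀ (N : ℕ) (δ : ℝ) (f g h : ℤ → ℂ), 0 < δ →
        (∀ x, ‖f x‖ ≤ 1) → (∀ x, ‖g x‖ ≤ 1) → (∀ x, ‖h x‖ ≤ 1) →
        (∀ x, f x ≠ 0 → x ∈ Finset.Icc (1 : ℤ) (N : ℤ)) →
        (∀ x, g x ≠ 0 → x ∈ Finset.Icc (1 : ℤ) (N : ℤ)) →
        (∀ x, h x ≠ 0 → x ∈ Finset.Icc (1 : ℤ) (N : ℤ)) →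
        δ * (N : ℝ) ^ ((3 : ℝ) / 2) ≤
          ‖∑ x ∈ Finset.Icc (1 : ℤ) (N : ℤ), ∑ y ∈ Finset.Icc (1 : ℤ) (N : ℤ),
              f x * g (x + y) * h (x + y ^ 2)‖ →
        ((N : ℝ) ≤ C * δ ^ (-C) ∨
          ∃ (α : ℝ) (q : ℕ), 0 < q ∧ (q : ℝ) ≤ C * δ ^ (-C) ∧
            |(q : ℝ) * α - ((round ((q : ℝ) * α) : ℤ) : ℝ)| ≤ C * δ ^ (-C) / N ∧
            c * δ ^ C * N ≤
              ‖∑ x ∈ Finset.Icc (1 : ℤ) (N : ℤ),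
                  h x * Complex.exp (2 * (Real.pi : ℂ) * Complex.I * (α : ℂ) * (x : ℂ))‖) := by
  obtain ⟨A, hA1, hA⟩ := MAC.final
  refine ⟨4 * 64 ^ A, (1 / 8) ^ A, by positivity, by positivity, ?_⟩
  intro N δ f g h hδ hf hg hh sf sg sh hS
  rcases Nat.eq_zero_or_pos N with rfl | hN
  · left; push_cast; positivity
  set M := Nat.sqrt N with hMdef
  have hM : 0 < M := Nat.sqrt_pos.2 hN
  have hMN : M ^ 2 ≤ N := Nat.sqrt_le' N
  have hNM : N < (M + 1) ^ 2 := Nat.lt_succ_sqrt' N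
  have hNM4 : N ≤ 4 * M ^ 2 := by nlinarith
  have hMR : (1 : ℝ) ≤ M := by exact_mod_cast hM
  have hNR : (0 : ℝ) < N := by exact_mod_cast hN
  rw [MAC.trunc N M rfl f g h sh] at hS
  have h32 : (N : ℝ) ^ ((3 : ℝ) / 2) = N * Real.sqrt N := by
    rw [show (3 : ℝ) / 2 = 1 + 1 / 2 by norm_num, Real.rpow_add hNR, Real.rpow_one, ← Real.sqrt_eq_rpow]
  have hsq : (M : ℝ) ≤ Real.sqrt N := Real.le_sqrt_of_sq_le (by exact_mod_cast hMN)
  have hsq0 : 0 < Real.sqrt N := Real.sqrt_pos.2 hNR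
  rw [h32] at hS
  have hδ1 : δ ≤ 1 := by
    have h1 : ‖∑ x ∈ Finset.Icc (1 : ℤ) (N : ℤ), ∑ y ∈ Finset.Icc (1 : ℤ) (M : ℤ),
              f x * g (x + y) * h (x + y ^ 2)‖ ≤ N * M := by
      refine (norm_sum_le_of_le _ fun x _ => norm_sum_le_of_le _ fun y _ => (?_ : _ ≤ (1 : ℝ))).trans ?_
      · rw [norm_mul, norm_mul]
        exact mul_le_one₀ (mul_le_one₀ (hf _) (norm_nonneg _) (hg _)) (norm_nonneg _) (hh _)
      · simp
    have h2 : δ * (N * Real.sqrt N) ≤ 1 * (N * Real.sqrt N) := by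
      rw [one_mul]
      refine hS.trans (h1.trans ?_)
      gcongr
    exact le_of_mul_le_mul_right h2 (by positivity)
  -- comparison of powers
  have hC : ∀ B : ℕ, B ≤ 2 * A → δ ^ ((4 * 64 ^ A : ℝ)) ≤ δ ^ B := by
    intro B hB
    rw [← Real.rpow_natCast δ B]
    refine Real.rpow_le_rpow_of_exponent_ge hδ hδ1 ?_
    have h1 : 2 * A ≤ 4 * 64 ^ A := by
      have : A < 64 ^ A := Nat.lt_pow_self (by norm_num)
      omega
    calc (B : ℝ) ≤ ((4 * 64 ^ A : ℕ) : ℝ) := by exact_mod_cast hB.trans h1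
      _ = _ := by push_cast; rfl
  have hCinv : ∀ (B : ℕ) (a : ℝ), B ≤ 2 * A → a * δ ^ B ≤ 4 * 64 ^ A → a ≤ 4 * 64 ^ A * δ ^ (-(4 * 64 ^ A : ℝ)) := by
    intro B a hB ha
    rw [Real.rpow_neg hδ.le, ← div_eq_mul_inv]
    have h1 : 0 < δ ^ B := by positivity
    have h2 : 0 < δ ^ ((4 * 64 ^ A : ℝ)) := by positivity
    calc a ≤ 4 * 64 ^ A / δ ^ B := by rw [le_div_iff₀ h1]; exact ha
      _ ≤ _ := by
        have := hC B hB
        gcongr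
  have h64 : (1 : ℝ) ≤ 64 ^ A := one_le_pow₀ (by norm_num)
  have h864 : (8 : ℝ) ^ A ≤ 64 ^ A := by gcongr; norm_num
  by_cases hreg : 1 ≤ (δ / 8) ^ A * M
  swap
  · left
    refine hCinv (2 * A) _ le_rfl ?_
    push Not at hreg
    have h1 : (N : ℝ) ≤ 4 * M ^ 2 := by exact_mod_cast hNM4
    have h2 : ((δ / 8) ^ A * M) ^ 2 ≤ 1 := pow_le_one₀ (by positivity) hreg.le
    have h3 : 64 ^ A * ((δ / 8) ^ A * M) ^ 2 = (M : ℝ) ^ 2 * δ ^ (2 * A) := by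
      rw [div_pow, show (64 : ℝ) = 8 ^ 2 by norm_num, ← pow_mul, pow_mul' 8 2 A, pow_mul']
      field_simp
    calc (N : ℝ) * δ ^ (2 * A) ≤ 4 * M ^ 2 * δ ^ (2 * A) := by gcongr
      _ = 4 * (64 ^ A * ((δ / 8) ^ A * M) ^ 2) := by rw [h3]; ring
      _ ≤ 4 * (64 ^ A * 1) := by gcongr
      _ = _ := by ring
  right
  obtain ⟨P, hPp, hP1, hP2⟩ := Nat.exists_prime_lt_and_le_two_mul (2 * N) (by omega)
  have : NeZero P := ⟨hPp.ne_zero⟩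
  have hPR : (0 : ℝ) < P := by exact_mod_cast hPp.pos
  have hNP : (N : ℝ) ≤ P := by exact_mod_cast (by omega : N ≤ P)
  have hPN : (P : ℝ) ≤ 4 * N := by exact_mod_cast (by omega : P ≤ 4 * N)
  have hR : MAC.Reg P M (δ / 8) A := ⟨hPp, hM, by omega, by omega, by positivity, by linarith, hreg⟩
  rw [MAC.lam_eq N M hM hMN hP1 f g h sf, norm_mul, norm_mul, Complex.norm_natCast, Complex.norm_natCast] at hS
  have hL : δ / 8 ≤ ‖MAC.Lam M (fun z : ZMod P => f z.val) (fun z => g z.val) (fun z => h z.val)‖ := by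
    set L := ‖MAC.Lam M (fun z : ZMod P => f z.val) (fun z => g z.val) (fun z => h z.val)‖
    have hL0 : 0 ≤ L := norm_nonneg _
    have h1 : δ * (N * Real.sqrt N) ≤ 4 * L * (N * Real.sqrt N) := by
      calc _ ≤ (P : ℝ) * M * L := hS
        _ ≤ 4 * N * Real.sqrt N * L := by gcongr
        _ = _ := by ring
    have h2 := le_of_mul_le_mul_right h1 (by positivity)
    linarith
  obtain ⟨β, q, j, hq, hq2, hj, he, hβ⟩ := hA P M (δ / 8) hR _ _ _ (fun z => hf _) (fun z => hg _) (fun z => hh _) hL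
  rw [div_pow] at hq2 hj hβ
  have h8 : (0 : ℝ) < 8 ^ A := by positivity
  refine ⟨(β.val : ℝ) / P, q, hq, ?_, ?_, ?_⟩
  · refine hCinv A _ (by omega) ?_
    rw [div_mul_eq_mul_div, div_le_one h8] at hq2
    linarith
  · refine (MAC.round_bound β q j he).trans ?_
    have h1 : |(j : ℝ)| ≤ 4 * 64 ^ A * δ ^ (-(4 * 64 ^ A : ℝ)) := by
      refine hCinv A _ (by omega) ?_
      rw [div_mul_eq_mul_div, div_le_one h8] at hj
      linarith
    gcongr
  · rw [MAC.fh_eq N hP1 h sh β, norm_mul, Complex.norm_natCast]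
    have h1 := hC A (by omega)
    calc (1 / 8) ^ A * δ ^ ((4 * 64 ^ A : ℝ)) * N ≤ (1 / 8) ^ A * δ ^ A * P := by gcongr
      _ = P * (δ ^ A / 8 ^ A) := by rw [div_pow, one_pow]; ring
      _ ≤ _ := by gcongr
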